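/- For integers 1 ≤ j < k and s ≥ 2, let 0 ≤ p1 = p1(n) ≤ … ≤ ps = ps(n) ≤ 1 and let H ∼ H_k(n,p1,…,ps). Then there is a constant c = c(s,k,j) > 0 such that: (1) if p1 ≤ log n/(c·n^{k−j}), or if for some 2 ≤ r ≤ s we have Π_{i=1}^{r} p_i ≤ 1/(c·n^{r(k−j−1)+1}·(log n)^{r−1}), then with high probability H does not j-percolate; (2) if p1 ≥ c·log n/n^{k−j} and for each 2 ≤ r ≤ s we have Π_{i=1}^{r} p_i ≥ c/(n^{r(k−j−1)+1}·(log n)^{r−1}), then with high probability H j-percolates. -/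

import Mathlib

open Finset Filter

/-- Two clusters `C`, `C'` of `j`-sets can be merged in the `s`-fold setting: for every
colour `i` there is an edge of colour `i` joining them. -/
def MergeableS {V : Type*} [DecidableEq V] {s : ℕ} (E : Fin s → Finset (Finset V))
    (C C' : Finset (Finset V)) : Prop :=
  ∀ i : Fin s, ∃ J1 ∈ C, ∃ J1' ∈ C', ∃ e ∈ E i, J1 ∪ J1' ⊆ e

/-- One elementary merging step of `j`-jigsaw percolation on an `s`-fold `k`-graph:
two distinct mergeable clusters of the current partition `P` are replaced by their union.
Iterating such pairwise merges as long as possible yields exactly the final partition of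
the (deterministic) jigsaw percolation process. -/
def MergeStepS {V : Type*} [DecidableEq V] {s : ℕ} (E : Fin s → Finset (Finset V))
    (P P' : Finset (Finset (Finset V))) : Prop :=
  ∃ C ∈ P, ∃ C' ∈ P, C ≠ C' ∧ MergeableS E C C' ∧
    P' = insert (C ∪ C') ((P.erase C).erase C')

/-- The family `J0` of `j`-sets percolates on the `s`-fold `k`-graph given by `E`. -/
def PercolatesOnS {V : Type*} [DecidableEq V] {s : ℕ} (J0 : Finset (Finset V))
    (E : Fin s → Finset (Finset V)) : Prop :=
  Relation.ReflTransGen (MergeStepS E)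
    (J0.image fun J => ({J} : Finset (Finset V))) {J0}

/-- The `s`-fold `k`-graph given by `E` `j`-percolates: the family of all `j`-element
subsets of `V` percolates. -/
def JPercolatesS {V : Type*} [DecidableEq V] [Fintype V] (j : ℕ) {s : ℕ}
    (E : Fin s → Finset (Finset V)) : Prop :=
  PercolatesOnS ((Finset.univ : Finset V).powersetCard j) E

open scoped Classical in
/-- The probability that an `s`-tuple of independent binomial random subsets of the ground
set `K` (the `i`-th subset containing each element of `K` with probability `p i`,
independently) satisfies the event `A`. -/
noncomputable def probMulti {α : Type*} [DecidableEq α] (K : Finset α) {s : ℕ}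
    (p : Fin s → ℝ) (A : (Fin s → Finset α) → Prop) : ℝ :=
  ∑ E ∈ Fintype.piFinset (fun _ : Fin s => K.powerset),
    if A E then ∏ i : Fin s, (p i) ^ (E i).card * (1 - p i) ^ (K.card - (E i).card)
    else 0

/-- The probability that the binomial random `s`-fold `k`-graph `H_k(n, p_1, …, p_s)` on
vertex set `Fin n` satisfies the event `A`. -/
noncomputable def probHkS (n k : ℕ) {s : ℕ} (p : Fin s → ℝ)
    (A : (Fin s → Finset (Finset (Fin n))) → Prop) : ℝ :=
  probMulti ((Finset.univ : Finset (Fin n)).powersetCard k) p A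

section ProbFramework
open MeasureTheory ProbabilityTheory

/-- event determined by coordinates in S -/
def Det {Ω ι : Type*} (X : ι → Ω → Prop) (S : Set ι) (A : Set Ω) : Prop :=
  ∀ ω ω', (∀ i ∈ S, (X i ω ↔ X i ω')) → ω ∈ A → ω' ∈ A

def IndepFam {Ω ι : Type*} [MeasurableSpace Ω] (μ : Measure Ω) (X : ι → Ω → Prop) : Prop :=
  ∀ (S T : Set ι) (A B : Set Ω), Disjoint S T → Det X S A → Det X T B →
    μ.real (A ∩ B) = μ.real A * μ.real B

variable {Ω ι κ : Type*} {X : ι → Ω → Prop} {S T : Set ι} {A B : Set Ω}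

lemma Det.mono (h : Det X S A) (hST : S ⊆ T) : Det X T A :=
  fun ω ω' hω => h ω ω' fun i hi => hω i (hST hi)

lemma Det.compl (h : Det X S A) : Det X S Aᶜ := by
  intro ω ω' hω hA hA'
  exact hA (h ω' ω (fun i hi => (hω i hi).symm) hA')

lemma Det.inter (hA : Det X S A) (hB : Det X S B) : Det X S (A ∩ B) :=
  fun ω ω' hω h => ⟨hA ω ω' hω h.1, hB ω ω' hω h.2⟩

lemma Det.iInter {κ : Sort*} {A : κ → Set Ω} (h : ∀ a, Det X S (A a)) : Det X S (⋂ a, A a) := by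
  intro ω ω' hω hA
  simp only [Set.mem_iInter] at *
  exact fun a => h a ω ω' hω (hA a)

lemma Det.iUnion {κ : Sort*} {A : κ → Set Ω} (h : ∀ a, Det X S (A a)) : Det X S (⋃ a, A a) := by
  intro ω ω' hω hA
  simp only [Set.mem_iUnion] at *
  obtain ⟨a, ha⟩ := hA
  exact ⟨a, h a ω ω' hω ha⟩

lemma Det.coord (i : ι) (hi : i ∈ S) : Det X S {ω | X i ω} := by
  intro ω ω' hω hA
  exact (hω i hi).1 hA

lemma IndepFam.prod [MeasurableSpace Ω] {μ : Measure Ω} [IsProbabilityMeasure μ]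
    (hX : IndepFam μ X) [DecidableEq κ] (F : Finset κ) (S : κ → Set ι) (A : κ → Set Ω)
    (hdisj : ∀ a ∈ F, ∀ b ∈ F, a ≠ b → Disjoint (S a) (S b))
    (hA : ∀ a ∈ F, Det X (S a) (A a)) :
    μ.real (⋂ a ∈ F, A a) = ∏ a ∈ F, μ.real (A a) := by
  induction F using Finset.induction_on with
  | empty => simp
  | insert a F ha ih =>
    rw [Finset.set_biInter_insert, Finset.prod_insert ha,
      hX (S a) (⋃ b ∈ F, S b) _ _ ?_ (hA a (by simp)) ?_, ih]
    · intro b hb c hc; exact hdisj b (by simp [hb]) c (by simp [hc])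
    · intro b hb; exact hA b (by simp [hb])
    · rw [Set.disjoint_iUnion₂_right]
      intro b hb
      exact hdisj a (by simp) b (by simp [hb]) (by rintro rfl; exact ha hb)
    · apply Det.iInter; intro b; apply Det.iInter; intro hb
      exact (hA b (by simp [hb])).mono (Set.subset_biUnion_of_mem (u := fun b => S b) hb)

/-- Bernoulli measure on Bool -/
noncomputable def bernB (q : ℝ) : Measure Bool :=
  ENNReal.ofReal q • Measure.dirac true + ENNReal.ofReal (1 - q) • Measure.dirac false

lemma bernB_prob {q : ℝ} (h0 : 0 ≤ q) (h1 : q ≤ 1) : IsProbabilityMeasure (bernB q) := by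
  constructor
  simp only [bernB, Measure.coe_add, Measure.coe_smul, Pi.add_apply, Pi.smul_apply, measure_univ,
    smul_eq_mul, mul_one]
  rw [← ENNReal.ofReal_add h0 (by linarith)]; simp

lemma bernB_true {q : ℝ} (h0 : 0 ≤ q) : (bernB q).real {true} = q := by
  simp [bernB, Measure.real, h0]

/-- concrete product measure -/
lemma exists_space (ι : Type*) [Fintype ι] (p : ι → ℝ) (hp : ∀ i, 0 ≤ p i ∧ p i ≤ 1) :
    ∃ μ : Measure (ι → Bool), IsProbabilityMeasure μ ∧
      IndepFam μ (fun i (ω : ι → Bool) => ω i = true) ∧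
      ∀ i, μ.real {ω | ω i = true} = p i := by
  classical
  have : ∀ i, IsProbabilityMeasure (bernB (p i)) := fun i => bernB_prob (hp i).1 (hp i).2
  refine ⟨Measure.pi fun i => bernB (p i), inferInstance, ?_, ?_⟩
  · have hind : iIndepFun (fun i (ω : ι → Bool) => ω i) (Measure.pi fun i => bernB (p i)) :=
      iIndepFun_pi (X := fun i (b : Bool) => b) (fun i => aemeasurable_id)
    intro S T A B hST hA hB
    have key : ∀ (S : Set ι) (A : Set (ι → Bool)), Det (fun i (ω : ι → Bool) => ω i = true) S A →
        A = (fun (ω : ι → Bool) (i : S.toFinset) => ω i) ⁻¹'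
          ((fun (ω : ι → Bool) (i : S.toFinset) => ω i) '' A) := by
      intro S A hA
      apply Set.Subset.antisymm (Set.subset_preimage_image _ _)
      rintro ω ⟨ω', hω', h⟩
      refine hA ω' ω (fun i hi => ?_) hω'
      have := congrFun h ⟨i, by simpa using hi⟩
      simp only at this
      show ω' i = true ↔ ω i = true
      rw [this]
    have h2 := hind.indepFun_finset S.toFinset T.toFinset (by simpa using hST)
      (fun i => measurable_pi_apply i)
    rw [indepFun_iff_measure_inter_preimage_eq_mul] at h2
    have h3 := h2 ((fun (ω : ι → Bool) (i : S.toFinset) => ω i) '' A)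
      ((fun (ω : ι → Bool) (i : T.toFinset) => ω i) '' B)
      (Set.toFinite _).measurableSet (Set.toFinite _).measurableSet
    rw [← key S A hA, ← key T B hB] at h3
    simp only [Measure.real, h3, ENNReal.toReal_mul]
  · intro i
    have : {ω : ι → Bool | ω i = true} = (fun ω : ι → Bool => ω i) ⁻¹' ({true} : Set Bool) := by ext; simp
    rw [this, Measure.real]
    erw [(measurePreserving_eval (fun i => bernB (p i)) i).measure_preimage
      (measurableSet_singleton _).nullMeasurableSet]
    exact bernB_true (hp i).1

lemma probMulti_eq {α : Type*} [DecidableEq α] [Fintype α] (K : Finset α) {s : ℕ}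
    (p : Fin s → ℝ) (μ : Measure (Fin s × α → Bool)) [IsProbabilityMeasure μ]
    (hμ : IndepFam μ (fun i (ω : Fin s × α → Bool) => ω i = true))
    (hp : ∀ i, μ.real {ω | ω i = true} = p i.1) (A : (Fin s → Finset α) → Prop) :
    probMulti K p A = μ.real {ω | A fun i => K.filter fun e => ω (i, e) = true} := by
  classical
  have hE : ∀ E ∈ Fintype.piFinset (fun _ : Fin s => K.powerset),
      μ.real {ω : Fin s × α → Bool | (fun i => K.filter fun e => ω (i, e) = true) = E} =
        ∏ i : Fin s, (p i) ^ (E i).card * (1 - p i) ^ (K.card - (E i).card) := by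
    intro E hE
    simp only [Fintype.mem_piFinset, Finset.mem_powerset] at hE
    have h1 : {ω : Fin s × α → Bool | (fun i => K.filter fun e => ω (i, e) = true) = E} =
        ⋂ x ∈ (Finset.univ ×ˢ K : Finset (Fin s × α)),
          (if x.2 ∈ E x.1 then {ω | ω x = true} else {ω : Fin s × α → Bool | ω x = true}ᶜ) := by
      ext ω
      simp only [Set.mem_ofPred_eq, Set.mem_iInter, Finset.mem_product, Finset.mem_univ, true_and]
      constructor
      · rintro rfl ⟨i, e⟩ he
        simp only at he
        by_cases h : ω (i, e) = true <;> simp [he, h]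
      · intro h
        funext i
        ext e
        simp only [Finset.mem_filter]
        constructor
        · rintro ⟨he, h'⟩
          by_contra hc
          have := h (i, e) he
          simp [hc, h'] at this
        · intro he
          have := h (i, e) (hE i he)
          simp [he] at this
          exact ⟨hE i he, this⟩
    rw [h1, hμ.prod _ (fun x => {x})]
    · rw [Finset.prod_product]
      refine Finset.prod_congr rfl fun i _ => ?_
      have : ∀ e ∈ K, μ.real (if (i, e).2 ∈ E (i, e).1 then {ω | ω (i, e) = true}
          else {ω : Fin s × α → Bool | ω (i, e) = true}ᶜ) = if e ∈ E i then p i else 1 - p i := by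
        intro e he
        split_ifs with h1
        · exact hp _
        · rw [measureReal_compl (Set.toFinite _).measurableSet, hp]; simp
      rw [Finset.prod_congr rfl this, Finset.prod_ite]
      simp only [Finset.prod_const]
      have e1 : K.filter (fun e => e ∈ E i) = E i := by
        ext e; simp; exact fun h => hE i h
      have e2 : K.filter (fun e => e ∉ E i) = K \ E i := by
        ext e; simp
      rw [e1, e2, Finset.card_sdiff_of_subset (hE i)]
    · intro a _ b _ hab; simpa using hab
    · intro a _
      split_ifs
      · exact Det.coord (X := fun i (ω : Fin s × α → Bool) => ω i = true) a (by simp)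
      · exact (Det.coord (X := fun i (ω : Fin s × α → Bool) => ω i = true) (S := {a}) a (by simp)).compl
  have hU : {ω : Fin s × α → Bool | A fun i => K.filter fun e => ω (i, e) = true} =
      ⋃ E ∈ (Fintype.piFinset (fun _ : Fin s => K.powerset)).filter A,
        {ω : Fin s × α → Bool | (fun i => K.filter fun e => ω (i, e) = true) = E} := by
    ext ω
    simp only [Set.mem_ofPred_eq, Set.mem_iUnion, Finset.mem_filter, Fintype.mem_piFinset,
      Finset.mem_powerset, exists_prop]
    constructor
    · intro h; exact ⟨_, ⟨fun i => Finset.filter_subset _ _, h⟩, rfl⟩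
    · rintro ⟨E, ⟨_, h⟩, rfl⟩; exact h
  rw [hU, measureReal_biUnion_finset, probMulti, Finset.sum_filter]
  · refine Finset.sum_congr rfl fun E hE' => ?_
    by_cases h : A E
    · simp only [h, if_true]; exact (hE E hE').symm
    · simp [h]
  · intro a _ b _ hab
    simp only [Function.onFun]
    rw [Set.disjoint_left]
    rintro ω rfl h
    exact hab h
  · intro b _; exact (Set.toFinite _).measurableSet

end ProbFramework

section GraphPart
open MeasureTheory ProbabilityTheory

variable {Ω α : Type*} {s : ℕ} (X : Fin s × Sym2 α → Ω → Prop)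

def AdjG (ω : Ω) (C : Finset α) (w : α) : Prop := ∀ i : Fin s, ∃ u ∈ C, X (i, s(u, w)) ω

inductive SpanG [DecidableEq α] (ω : Ω) : Finset α → Prop
  | single (v : α) : SpanG ω {v}
  | step (S : Finset α) (w : α) : SpanG ω S → w ∉ S → AdjG X ω S w → SpanG ω (insert w S)

open scoped Classical in
noncomputable def growG [DecidableEq α] (ω : Ω) : Finset α → List α → Finset α
  | C, [] => C
  | C, w :: l => growG ω (if AdjG X ω C w then insert w C else C) l

/-- growth recursion -/
noncomputable def gRec (φ : ℕ → ℝ) (M : ℕ) : ℕ → ℕ → ℝ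
  | 0, x => if M ≤ x then 1 else 0
  | N + 1, x => φ x * gRec φ M N (x + 1) + (1 - φ x) * gRec φ M N x

lemma gRec_bounds {φ : ℕ → ℝ} (hφ : ∀ x, 0 ≤ φ x ∧ φ x ≤ 1) (M N : ℕ) :
    ∀ x, 0 ≤ gRec φ M N x ∧ gRec φ M N x ≤ gRec φ M N (x + 1) := by
  induction N with
  | zero =>
    intro x; simp only [gRec]
    split_ifs <;> first | omega | norm_num
  | succ N ih =>
    intro x
    simp only [gRec]
    have h1 := ih x; have h2 := ih (x+1)
    have p1 := hφ x; have p2 := hφ (x+1)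
    constructor
    · have := mul_nonneg p1.1 h2.1
      have := mul_nonneg (sub_nonneg.2 p1.2) h1.1
      linarith
    · nlinarith [mul_nonneg p2.1 (sub_nonneg.2 h2.2), mul_nonneg (sub_nonneg.2 p1.2) (sub_nonneg.2 h1.2)]

variable [DecidableEq α]
variable {X}

lemma adj_congr {ω ω' : Ω} {C : Finset α} {w : α}
    (h : ∀ i, ∀ u ∈ C, (X (i, s(u, w)) ω ↔ X (i, s(u, w)) ω')) :
    AdjG X ω C w ↔ AdjG X ω' C w := by
  unfold AdjG
  refine forall_congr' fun i => exists_congr fun u => ?_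
  constructor
  · rintro ⟨hu, h'⟩; exact ⟨hu, (h i u hu).1 h'⟩
  · rintro ⟨hu, h'⟩; exact ⟨hu, (h i u hu).2 h'⟩

lemma subset_growG (ω : Ω) (C : Finset α) (l : List α) : C ⊆ growG X ω C l := by
  classical
  induction l generalizing C with
  | nil => simp [growG]
  | cons w l ih =>
    simp only [growG]
    refine Finset.Subset.trans ?_ (ih _)
    split_ifs
    · exact Finset.subset_insert _ _
    · exact Finset.Subset.refl _

lemma growG_subset (ω : Ω) (C : Finset α) (l : List α) : growG X ω C l ⊆ C ∪ l.toFinset := by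
  classical
  induction l generalizing C with
  | nil => simp [growG]
  | cons w l ih =>
    simp only [growG]
    refine Finset.Subset.trans (ih _) ?_
    split_ifs <;> intro x <;> simp <;> tauto

lemma span_growG (ω : Ω) (C : Finset α) (l : List α) (hl : l.Nodup) (hC : ∀ w ∈ l, w ∉ C)
    (h : SpanG X ω C) : SpanG X ω (growG X ω C l) := by
  classical
  induction l generalizing C with
  | nil => simpa [growG]
  | cons w l ih =>
    simp only [growG]
    rw [List.nodup_cons] at hl
    split_ifs with hadj
    · refine ih _ hl.2 ?_ (SpanG.step C w h (hC w (by simp)) hadj)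
      intro v hv
      simp only [Finset.mem_insert, not_or]
      exact ⟨by rintro rfl; exact hl.1 hv, hC v (by simp [hv])⟩
    · exact ih _ hl.2 (fun v hv => hC v (by simp [hv])) h

/-- dependence of growth on coordinates touching the list -/
lemma growG_congr_list {ω ω' : Ω} (l : List α) (C : Finset α)
    (h : ∀ i z, (∃ w ∈ l, w ∈ z) → (X (i, z) ω ↔ X (i, z) ω')) :
    growG X ω C l = growG X ω' C l := by
  classical
  induction l generalizing C with
  | nil => simp [growG]
  | cons w l ih =>
    simp only [growG]
    have : AdjG X ω C w ↔ AdjG X ω' C w :=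
      adj_congr fun i u _ => h i _ ⟨w, by simp, by simp⟩
    simp only [this]
    exact ih _ fun i z ⟨v, hv, hz⟩ => h i z ⟨v, by simp [hv], hz⟩

lemma growG_congr_out {ω ω' : Ω} (l : List α) (C S : Finset α)
    (h : ∀ i z, (∃ w ∈ S, w ∈ z) → (X (i, z) ω ↔ X (i, z) ω'))
    (hS : growG X ω C l = S) : growG X ω' C l = S := by
  classical
  induction l generalizing C with
  | nil => simpa [growG] using hS
  | cons w l ih =>
    simp only [growG] at hS ⊢
    have hCS : C ⊆ S := by
      refine Finset.Subset.trans ?_ (hS ▸ subset_growG ω _ l)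
      split_ifs
      · exact Finset.subset_insert _ _
      · exact Finset.Subset.refl _
    have : AdjG X ω C w ↔ AdjG X ω' C w :=
      adj_congr fun i u hu => h i _ ⟨u, hCS hu, by simp⟩
    simp only [this] at hS
    exact ih _ hS

lemma span_congr {ω ω' : Ω} (S : Finset α)
    (h : ∀ i z, (∀ w ∈ z, w ∈ S) → (X (i, z) ω ↔ X (i, z) ω'))
    (hS : SpanG X ω S) : SpanG X ω' S := by
  induction hS with
  | single v => exact SpanG.single v
  | step S w hS hw hadj ih =>
    refine SpanG.step S w (ih fun i z hz => h i z fun v hv => by simp [hz v hv]) hw ?_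
    refine (adj_congr fun i u hu => h i _ ?_).1 hadj
    intro v hv
    simp only [Sym2.mem_iff] at hv
    rcases hv with rfl | rfl <;> simp [hu]

variable [MeasurableSpace Ω] {μ : Measure Ω} [IsProbabilityMeasure μ]

lemma compl_real (hm : ∀ A : Set Ω, MeasurableSet A) (A : Set Ω) :
    μ.real Aᶜ = 1 - μ.real A := by
  rw [measureReal_compl (hm A)]; simp

/-- adjacency probability -/
lemma prob_adj (hm : ∀ A : Set Ω, MeasurableSet A) (hX : IndepFam μ X) (q : Fin s → ℝ)
    (hq0 : ∀ i, 0 ≤ q i) 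
    (hq : ∀ i u v, u ≠ v → q i ≤ μ.real {ω | X (i, s(u, v)) ω}) (C : Finset α) (w : α)
    (hw : w ∉ C) :
    ∏ i, (1 - (1 - q i) ^ C.card) ≤ μ.real {ω | AdjG X ω C w} := by
  have h1 : {ω | AdjG X ω C w} = ⋂ i ∈ (Finset.univ : Finset (Fin s)),
      (⋂ u ∈ C, {ω | X (i, s(u, w)) ω}ᶜ)ᶜ := by
    ext ω; simp [AdjG]
  have hinj : ∀ a ∈ C, ∀ b ∈ C, s(a, w) = s(b, w) → a = b := by
    intro a ha b hb h
    rw [Sym2.eq_iff] at h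
    rcases h with ⟨h, _⟩ | ⟨h, _⟩
    · exact h
    · exact absurd (h ▸ ha) hw
  have hD : ∀ i, ∀ u ∈ C, Det X {(i, s(u, w))} {ω | X (i, s(u, w)) ω}ᶜ := fun i u _ =>
    (Det.coord (X := X) (S := {(i, s(u, w))}) (i, s(u, w)) rfl).compl
  rw [h1, hX.prod Finset.univ (fun i => {z | z.1 = i})]
  · refine Finset.prod_le_prod ?_ ?_
    · intro i _
      by_cases hC : C.Nonempty
      · obtain ⟨u, hu⟩ := hC
        have h1 := (hq i u w (by rintro rfl; exact hw hu)).trans measureReal_le_one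
        have := pow_le_one₀ (n := C.card) (sub_nonneg.2 h1) (by linarith [hq0 i])
        linarith
      · rw [Finset.not_nonempty_iff_eq_empty] at hC
        simp [hC]
    · intro i _
      rw [compl_real hm, hX.prod C (fun u => {(i, s(u, w))})]
      · have : ∏ u ∈ C, μ.real {ω | X (i, s(u, w)) ω}ᶜ ≤ ∏ u ∈ C, (1 - q i) := by
          refine Finset.prod_le_prod (fun _ _ => measureReal_nonneg) fun u hu => ?_
          rw [compl_real hm]
          linarith [hq i u w (by rintro rfl; exact hw hu)]
        rw [Finset.prod_const] at this
        linarith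
      · intro a ha b hb hab
        simp only [Set.disjoint_singleton, ne_eq, Prod.mk.injEq, true_and]
        exact fun h => hab (hinj a ha b hb h)
      · exact hD i
  · intro a _ b _ hab
    rw [Set.disjoint_left]
    rintro z rfl h; exact hab h
  · intro i _
    refine Det.compl (Det.iInter fun u => Det.iInter fun hu => (hD i u hu).mono ?_)
    simp

lemma prob_grow (hm : ∀ A : Set Ω, MeasurableSet A) (hX : IndepFam μ X)
    (φ : ℕ → ℝ) (hφ : ∀ x, 0 ≤ φ x ∧ φ x ≤ 1)
    (hadj : ∀ (C : Finset α) (w : α), w ∉ C → φ C.card ≤ μ.real {ω | AdjG X ω C w}) (M : ℕ)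
    (l : List α) (C : Finset α) (hl : l.Nodup) (hC : ∀ w ∈ l, w ∉ C) :
    gRec φ M l.length C.card ≤ μ.real {ω | M ≤ (growG X ω C l).card} := by
  classical
  induction l generalizing C with
  | nil =>
    simp only [List.length_nil, gRec, growG]
    split_ifs with h <;> simp [h]
  | cons w l ih =>
    rw [List.nodup_cons] at hl
    have hwC : w ∉ C := hC w (by simp)
    have ih1 := ih (insert w C) hl.2 (by
      intro v hv
      simp only [Finset.mem_insert, not_or]
      exact ⟨by rintro rfl; exact hl.1 hv, hC v (by simp [hv])⟩)
    have ih2 := ih C hl.2 (fun v hv => hC v (by simp [hv]))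
    rw [Finset.card_insert_of_notMem hwC] at ih1
    have hsplit : {ω | M ≤ (growG X ω C (w :: l)).card} =
        ({ω | AdjG X ω C w} ∩ {ω | M ≤ (growG X ω (insert w C) l).card}) ∪
        ({ω | AdjG X ω C w}ᶜ ∩ {ω | M ≤ (growG X ω C l).card}) := by
      ext ω
      by_cases h : AdjG X ω C w <;> simp [growG, h]
    have hdis : Disjoint {z : Fin s × Sym2 α | ∃ u ∈ C, z.2 = s(u, w)}
        {z : Fin s × Sym2 α | ∃ v ∈ l, v ∈ z.2} := by
      rw [Set.disjoint_left]
      rintro ⟨i, z⟩ ⟨u, hu, rfl⟩ ⟨v, hv, hz⟩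
      simp only [Sym2.mem_iff] at hz
      rcases hz with rfl | rfl
      · exact hC v (by simp [hv]) hu
      · exact hl.1 hv
    have dA : Det X {z : Fin s × Sym2 α | ∃ u ∈ C, z.2 = s(u, w)} {ω | AdjG X ω C w} := by
      intro ω ω' h hA
      exact (adj_congr fun i u hu => h (i, s(u, w)) ⟨u, hu, rfl⟩).1 hA
    have dG : ∀ C' : Finset α, Det X {z : Fin s × Sym2 α | ∃ v ∈ l, v ∈ z.2}
        {ω | M ≤ (growG X ω C' l).card} := by
      intro C' ω ω' h hA
      simp only [Set.mem_ofPred_eq] at hA ⊢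
      rwa [← growG_congr_list l C' (ω := ω) (fun i z hz => h (i, z) hz)]
    rw [hsplit, measureReal_union _ (hm _), hX _ _ _ _ hdis dA (dG _),
      hX _ _ _ _ hdis dA.compl (dG _), compl_real hm]
    · simp only [List.length_cons, gRec]
      have ha := hadj C w hwC
      have ha1 : μ.real {ω | AdjG X ω C w} ≤ 1 := measureReal_le_one
      have b := gRec_bounds hφ M l.length C.card
      have b2 := hφ C.card
      nlinarith [mul_nonneg (sub_nonneg.2 ha) (sub_nonneg.2 b.2),
        mul_nonneg (b2.1.trans ha) (sub_nonneg.2 ih1),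
        mul_nonneg (sub_nonneg.2 ha1) (sub_nonneg.2 ih2)]
    · rw [Set.disjoint_left]
      rintro ω ⟨h1, _⟩ ⟨h2, _⟩; exact h2 h1

/-- good cluster inside W -/
def QG (X : Fin s × Sym2 α → Ω → Prop) (M : ℕ) (W : Finset α) : Set Ω :=
  {ω | ∃ S ⊆ W, M ≤ S.card ∧ SpanG X ω S}

lemma prob_trials (hm : ∀ A : Set Ω, MeasurableSet A) (hX : IndepFam μ X)
    (φ : ℕ → ℝ) (hφ : ∀ x, 0 ≤ φ x ∧ φ x ≤ 1)
    (hadj : ∀ (C : Finset α) (w : α), w ∉ C → φ C.card ≤ μ.real {ω | AdjG X ω C w}) (M N0 : ℕ)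
    (ρ : ℝ) (hρ1 : ρ ≤ 1) (hρ : ∀ N, N0 ≤ N → ρ ≤ gRec φ M N 1) (t : ℕ) :
    ∀ W : Finset α, N0 + 1 + t * M ≤ W.card → μ.real (QG X M W)ᶜ ≤ (1 - ρ) ^ t := by
  classical
  induction t with
  | zero => intro W _; simpa using measureReal_le_one
  | succ t ih =>
    intro W hW
    have hne : W.Nonempty := by
      rw [← Finset.card_pos]; omega
    obtain ⟨v, hv⟩ := hne
    set l := (W.erase v).toList with hl
    have hnd : l.Nodup := Finset.nodup_toList _
    have hlC : ∀ w ∈ l, w ∉ ({v} : Finset α) := by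
      intro w hw; simp [hl] at hw; simpa using hw.1
    have hlen : l.length = W.card - 1 := by simp [hl, Finset.card_erase_of_mem hv]
    have hout : ∀ ω, growG X ω {v} l ⊆ W := by
      intro ω
      refine (growG_subset ω _ l).trans ?_
      intro x; simp only [hl, Finset.mem_union, Finset.mem_singleton, Finset.toList_toFinset,
        Finset.mem_erase]
      rintro (rfl | h)
      · exact hv
      · exact h.2
    have h1 : (QG X M W)ᶜ ⊆ ⋃ S ∈ W.powerset.filter (fun S => S.card < M),
        ({ω | growG X ω {v} l = S} ∩ (QG X M (W \ S))ᶜ) := by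
      intro ω hω
      simp only [Set.mem_iUnion, Finset.mem_filter, Finset.mem_powerset, exists_prop]
      refine ⟨growG X ω {v} l, ⟨hout ω, ?_⟩, rfl, ?_⟩
      · by_contra hc
        exact hω ⟨_, hout ω, not_lt.1 hc, span_growG ω _ l hnd hlC (SpanG.single v)⟩
      · rintro ⟨S, hS, hS'⟩
        exact hω ⟨S, hS.trans Finset.sdiff_subset, hS'⟩
    have h2 : ∀ S ∈ W.powerset.filter (fun S => S.card < M),
        μ.real ({ω | growG X ω {v} l = S} ∩ (QG X M (W \ S))ᶜ) ≤
          μ.real {ω | growG X ω {v} l = S} * (1 - ρ) ^ t := by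
      intro S hS
      simp only [Finset.mem_filter, Finset.mem_powerset] at hS
      rw [hX {z | ∃ w ∈ S, w ∈ z.2} {z | ∀ w ∈ z.2, w ∈ W \ S}]
      · refine mul_le_mul_of_nonneg_left (ih _ ?_) measureReal_nonneg
        rw [Finset.card_sdiff_of_subset hS.1]
        have : (t + 1) * M = t * M + M := by ring
        omega
      · rw [Set.disjoint_left]
        rintro z ⟨w, hw, hz⟩ h
        have := h w hz
        simp [hw] at this
      · intro ω ω' h hA
        exact growG_congr_out l _ S (fun i z hz => h (i, z) hz) hA
      · refine Det.compl ?_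
        rintro ω ω' h ⟨S', hS', hM, hsp⟩
        exact ⟨S', hS', hM, span_congr S' (fun i z hz => h (i, z) fun w hw => hS' (hz w hw)) hsp⟩
    have h3 : ∑ S ∈ W.powerset.filter (fun S => S.card < M), μ.real {ω | growG X ω {v} l = S} =
        μ.real {ω | M ≤ (growG X ω {v} l).card}ᶜ := by
      rw [← measureReal_biUnion_finset]
      · congr 1
        ext ω
        simp only [Set.mem_iUnion, Finset.mem_filter, Finset.mem_powerset, exists_prop,
          Set.mem_ofPred_eq, Set.mem_compl_iff, not_le]
        constructor
        · rintro ⟨S, h, rfl⟩; exact h.2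
        · intro h; exact ⟨_, ⟨hout ω, h⟩, rfl⟩
      · intro a _ b _ hab
        simp only [Function.onFun]
        rw [Set.disjoint_left]
        rintro ω rfl h
        exact hab h
      · exact fun _ _ => hm _
    have h4 := prob_grow hm hX φ hφ hadj M l {v} hnd hlC
    rw [Finset.card_singleton, hlen] at h4
    have h5 := hρ (W.card - 1) (by
      have : (t + 1) * M = t * M + M := by ring
      omega)
    calc μ.real (QG X M W)ᶜ ≤ _ := measureReal_mono h1 (measure_ne_top _ _)
      _ ≤ ∑ S ∈ W.powerset.filter (fun S => S.card < M), _ := measureReal_biUnion_finset_le _ _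
      _ ≤ ∑ S ∈ W.powerset.filter (fun S => S.card < M),
          μ.real {ω | growG X ω {v} l = S} * (1 - ρ) ^ t := Finset.sum_le_sum h2
      _ = (1 - μ.real {ω | M ≤ (growG X ω {v} l).card}) * (1 - ρ) ^ t := by
          rw [← Finset.sum_mul, h3, compl_real hm]
      _ ≤ (1 - ρ) * (1 - ρ) ^ t := by
          refine mul_le_mul_of_nonneg_right (by linarith) (pow_nonneg (by linarith) _)
      _ = (1 - ρ) ^ (t + 1) := by ring

/-- closed sets -/
lemma prob_closed (hm : ∀ A : Set Ω, MeasurableSet A) (hX : IndepFam μ X) [Fintype α]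
    (φ : ℕ → ℝ) (hadj : ∀ (C : Finset α) (w : α), w ∉ C → φ C.card ≤ μ.real {ω | AdjG X ω C w})
    (C : Finset α) :
    μ.real {ω | ∀ w, w ∉ C → ¬ AdjG X ω C w} ≤ (1 - φ C.card) ^ (Fintype.card α - C.card) := by
  have h1 : {ω | ∀ w, w ∉ C → ¬ AdjG X ω C w} = ⋂ w ∈ Cᶜ, {ω | AdjG X ω C w}ᶜ := by
    ext ω; simp
  rw [h1, hX.prod Cᶜ (fun w => {z | ∃ u ∈ C, z.2 = s(u, w)})]
  · rw [← Finset.card_compl, ← Finset.prod_const]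
    refine Finset.prod_le_prod (fun _ _ => measureReal_nonneg) fun w hw => ?_
    rw [compl_real hm]
    linarith [hadj C w (by simpa using hw)]
  · intro a ha b hb hab
    rw [Set.disjoint_left]
    rintro z ⟨u, hu, h1⟩ ⟨v, hv, h2⟩
    rw [h1] at h2
    simp only [Finset.mem_compl] at ha hb
    rw [Sym2.eq_iff] at h2
    rcases h2 with ⟨_, h⟩ | ⟨h, h'⟩
    · exact hab h
    · exact hb (h ▸ hu)
  · intro w _
    refine Det.compl ?_
    intro ω ω' h hA
    exact (adj_congr fun i u hu => h (i, s(u, w)) ⟨u, hu, rfl⟩).1 hA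

lemma prob_span (hm : ∀ A : Set Ω, MeasurableSet A) (hX : IndepFam μ X) [Fintype α]
    (φ : ℕ → ℝ) (hφ : ∀ x, 0 ≤ φ x ∧ φ x ≤ 1)
    (hadj : ∀ (C : Finset α) (w : α), w ∉ C → φ C.card ≤ μ.real {ω | AdjG X ω C w}) (M N0 : ℕ)
    (ρ : ℝ) (hρ1 : ρ ≤ 1) (hρ : ∀ N, N0 ≤ N → ρ ≤ gRec φ M N 1) (t : ℕ)
    (hcard : N0 + 1 + t * M ≤ Fintype.card α) :
    μ.real {ω | ¬ SpanG X ω Finset.univ} ≤ (1 - ρ) ^ t +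
      ∑ x ∈ Finset.Ico M (Fintype.card α),
        ((Fintype.card α).choose x : ℝ) * (1 - φ x) ^ (Fintype.card α - x) := by
  classical
  have h1 : {ω | ¬ SpanG X ω Finset.univ} ⊆ (QG X M Finset.univ)ᶜ ∪
      ⋃ x ∈ Finset.Ico M (Fintype.card α), ⋃ C ∈ Finset.powersetCard x (Finset.univ : Finset α),
        {ω | ∀ w, w ∉ C → ¬ AdjG X ω C w} := by
    intro ω hω
    by_contra hc
    simp only [Set.mem_union, Set.mem_compl_iff, Set.mem_iUnion, not_or, not_not, not_exists] at hc
    obtain ⟨⟨S, -, hM, hS⟩, hc⟩ := hc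
    obtain ⟨S', hS', hmax⟩ := Finset.exists_max_image
      (Finset.univ.filter fun S : Finset α => M ≤ S.card ∧ SpanG X ω S) Finset.card
      ⟨S, by simp [hM, hS]⟩
    simp only [Finset.mem_filter, Finset.mem_univ, true_and] at hS' hmax
    have hne : S' ≠ Finset.univ := by rintro rfl; exact hω hS'.2
    have hlt : S'.card < Fintype.card α := by
      rw [Finset.card_lt_iff_ne_univ]; exact hne
    have := hc S'.card (by simp [hS'.1, hlt]) S' (by simp)
    simp only [Set.mem_ofPred_eq, not_forall, not_not] at this
    obtain ⟨w, hw, hadj⟩ := this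
    have h2 := hmax (insert w S') ⟨by rw [Finset.card_insert_of_notMem hw]; omega,
      SpanG.step S' w hS'.2 hw hadj⟩
    rw [Finset.card_insert_of_notMem hw] at h2
    omega
  refine (measureReal_mono h1 (measure_ne_top _ _)).trans ((measureReal_union_le _ _).trans (add_le_add ?_ ?_))
  · exact prob_trials hm hX φ hφ hadj M N0 ρ hρ1 hρ t _ (by simpa using hcard)
  · refine (measureReal_biUnion_finset_le _ _).trans (Finset.sum_le_sum fun x hx => ?_)
    refine (measureReal_biUnion_finset_le _ _).trans ?_
    refine (Finset.sum_le_sum (g := fun _ => (1 - φ x) ^ (Fintype.card α - x)) fun C hC => ?_).trans ?_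
    · rw [Finset.mem_powersetCard] at hC
      have := prob_closed hm hX φ hadj C
      rwa [hC.2] at this
    · simp

end GraphPart

section Numerics

lemma prod_le_of_subset_le_one {ι : Type*} [DecidableEq ι] {A B : Finset ι} (h : A ⊆ B) (f : ι → ℝ)
    (h0 : ∀ i ∈ B, 0 ≤ f i) (h1 : ∀ i ∈ B, f i ≤ 1) : ∏ i ∈ B, f i ≤ ∏ i ∈ A, f i := by
  rw [← Finset.prod_sdiff h]
  refine mul_le_of_le_one_left (Finset.prod_nonneg fun i hi => h0 i (h hi)) ?_
  exact Finset.prod_le_one (fun i hi => h0 i (Finset.mem_sdiff.1 hi).1)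
    (fun i hi => h1 i (Finset.mem_sdiff.1 hi).1)

lemma one_sub_exp_ge (z : ℝ) (hz : 0 ≤ z) : min 1 z / 2 ≤ 1 - Real.exp (-z) := by
  have h1 : Real.exp (-z) ≤ 1 / (1 + z) := by
    rw [Real.exp_neg, ← one_div]
    exact one_div_le_one_div_of_le (by linarith) (by linarith [Real.add_one_le_exp z])
  have h2 : min 1 z / 2 ≤ 1 - 1 / (1 + z) := by
    have : 1 - 1 / (1 + z) = z / (1 + z) := by field_simp; ring
    rw [this, le_div_iff₀ (by linarith)]
    rcases le_total 1 z with h | h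
    · rw [min_eq_left h]; linarith
    · rw [min_eq_right h]; nlinarith
  linarith

lemma one_sub_pow_ge (q : ℝ) (h0 : 0 ≤ q) (h1 : q ≤ 1) (x : ℕ) :
    min 1 (q * x) / 2 ≤ 1 - (1 - q) ^ x := by
  have h2 : (1 - q) ^ x ≤ Real.exp (-(q * x)) := by
    have : (1 - q) ^ x ≤ Real.exp (-q) ^ x :=
      pow_le_pow_left₀ (by linarith) (by linarith [Real.add_one_le_exp (-q)]) _
    rw [← Real.exp_nat_mul] at this
    convert this using 2; ring
  linarith [one_sub_exp_ge (q * x) (by positivity)]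

noncomputable def phiG {s : ℕ} (q : Fin s → ℝ) (x : ℕ) : ℝ := ∏ i, (1 - (1 - q i) ^ x)

lemma phiG_bounds {s : ℕ} (q : Fin s → ℝ) (h : ∀ i, 0 ≤ q i ∧ q i ≤ 1) (x : ℕ) :
    0 ≤ phiG q x ∧ phiG q x ≤ 1 := by
  have hb : ∀ i, 0 ≤ 1 - (1 - q i) ^ x ∧ 1 - (1 - q i) ^ x ≤ 1 := fun i => by
    have h1 := pow_le_one₀ (n := x) (sub_nonneg.2 (h i).2) (by linarith [(h i).1])
    have h2 := pow_nonneg (sub_nonneg.2 (h i).2) x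
    constructor <;> linarith
  exact ⟨Finset.prod_nonneg fun i _ => (hb i).1,
    Finset.prod_le_one (fun i _ => (hb i).1) fun i _ => (hb i).2⟩

lemma phiG_ge {s : ℕ} (q : Fin s → ℝ) (h : ∀ i, 0 ≤ q i ∧ q i ≤ 1) (x : ℕ) :
    (∏ i, min 1 (q i * x)) / 2 ^ s ≤ phiG q x := by
  have : (∏ i, min 1 (q i * x)) / 2 ^ s = ∏ i, (min 1 (q i * x) / 2) := by
    rw [Finset.prod_div_distrib]; simp
  rw [this]
  refine Finset.prod_le_prod (fun i _ => ?_) fun i _ => one_sub_pow_ge _ (h i).1 (h i).2 x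
  have := mul_nonneg (h i).1 (Nat.cast_nonneg (α := ℝ) x)
  positivity

lemma minprod_small {s : ℕ} (q : Fin s → ℝ) (L x : ℝ) (hL : 0 < L) (hx0 : 0 ≤ x)
    (h : ∀ i, 0 ≤ q i ∧ q i ≤ 1 / L) (hx : x ≤ L) :
    ∏ i, min 1 (q i * x) = x ^ s * ∏ i, q i := by
  have : ∀ i, min 1 (q i * x) = x * q i := fun i => by
    rw [min_eq_right, mul_comm]
    calc q i * x ≤ 1 / L * L := mul_le_mul (h i).2 hx hx0 (by positivity)
      _ = 1 := by field_simp
  simp only [this, Finset.prod_mul_distrib]; simp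

lemma minprod_large {s : ℕ} (q : Fin s → ℝ) (K L N x : ℝ) (hs : 1 ≤ s) (hL : 1 ≤ L) (hK : 0 < K) (hN : 0 < N)
    (h : ∀ i, K * L / N ≤ q i ∧ q i ≤ 1 / L) (hP : K / (N * L ^ (s - 1)) ≤ ∏ i, q i)
    (hx : L ≤ x) :
    1 ≤ ∏ i, min 1 (q i * x) ∨ K * L * x / N ≤ ∏ i, min 1 (q i * x) ∨
      (x / L) ^ 2 * (K * L / N) ≤ ∏ i, min 1 (q i * x) := by
  classical
  have hL0 : 0 < L := by linarith
  have hq0 : ∀ i, 0 ≤ q i := fun i => le_trans (by positivity) (h i).1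
  set I := Finset.univ.filter (fun i => q i * x < 1) with hI
  have hprod : ∏ i, min 1 (q i * x) = ∏ i ∈ I, q i * x := by
    rw [hI, Finset.prod_filter]
    refine Finset.prod_congr rfl fun i _ => ?_
    split_ifs with h
    · exact min_eq_right h.le
    · exact min_eq_left (not_lt.1 h)
  rw [hprod]
  have hy : 1 ≤ x / L := by rw [le_div_iff₀ hL0]; linarith
  rcases Nat.lt_or_ge 1 I.card with hc | hc
  · right; right
    have h1 : ∏ i ∈ I, q i * x = (x / L) ^ I.card * ∏ i ∈ I, (q i * L) := by
      rw [← Finset.prod_const, ← Finset.prod_mul_distrib]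
      refine Finset.prod_congr rfl fun i _ => ?_
      field_simp
    have hqL : ∀ i, q i * L ≤ 1 := fun i => by
      have := (h i).2
      rwa [le_div_iff₀ hL0] at this
    have h2 : ∏ i, (q i * L) ≤ ∏ i ∈ I, (q i * L) := by
      exact prod_le_of_subset_le_one (Finset.filter_subset _ _) _
        (fun i _ => mul_nonneg (hq0 i) hL0.le) fun i _ => hqL i
    have h3 : K * L / N ≤ ∏ i, (q i * L) := by
      rw [Finset.prod_mul_distrib, Finset.prod_const, Finset.card_univ, Fintype.card_fin]
      calc K * L / N = K / (N * L ^ (s - 1)) * L ^ s := by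
            obtain ⟨t, rfl⟩ : ∃ t, s = t + 1 := ⟨s - 1, by omega⟩
            rw [Nat.add_sub_cancel, pow_succ]; field_simp
        _ ≤ _ := mul_le_mul_of_nonneg_right hP (by positivity)
    rw [h1]
    exact mul_le_mul (pow_le_pow_right₀ hy hc) (h3.trans h2) (by positivity) (by positivity)
  · rcases Nat.lt_or_ge I.card 1 with hc' | hc'
    · left
      have hI0 : I = ∅ := Finset.card_eq_zero.1 (by omega)
      rw [hI0]; simp
    · right; left
      obtain ⟨i, hi⟩ := Finset.card_eq_one.1 (le_antisymm hc hc')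
      rw [hi, Finset.prod_singleton]
      have := mul_le_mul_of_nonneg_right (h i).1 (by linarith : (0:ℝ) ≤ x)
      calc K * L * x / N = K * L / N * x := by ring
        _ ≤ _ := this

/- recursion bounds -/
lemma gRec_mono {φ : ℕ → ℝ} (hφ : ∀ x, 0 ≤ φ x ∧ φ x ≤ 1) (M : ℕ) {N N' : ℕ} (h : N ≤ N') (x : ℕ) :
    gRec φ M N x ≤ gRec φ M N' x := by
  induction h with
  | refl => exact le_rfl
  | @step N' h ih =>
    refine ih.trans ?_
    simp only [gRec]
    nlinarith [mul_nonneg (hφ x).1 (sub_nonneg.2 (gRec_bounds hφ M N' x).2)]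

lemma gRec_top {φ : ℕ → ℝ} (M N : ℕ) : ∀ x, M ≤ x → gRec φ M N x = 1 := by
  induction N with
  | zero => intro x hx; simp [gRec, hx]
  | succ N ih => intro x hx; simp [gRec, ih x hx, ih (x+1) (by omega)]

lemma gRec_wait {φ : ℕ → ℝ} (hφ : ∀ x, 0 ≤ φ x ∧ φ x ≤ 1) (M N a x : ℕ) :
    (1 - (1 - φ x) ^ a) * gRec φ M N (x + 1) ≤ gRec φ M (N + a) x := by
  induction a with
  | zero => simpa using (gRec_bounds hφ M N x).1
  | succ a ih =>
    rw [← add_assoc]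
    simp only [gRec]
    have h1 := gRec_mono hφ M (Nat.le_add_right N a) (x + 1)
    have h2 := hφ x
    rw [pow_succ]
    nlinarith [mul_nonneg h2.1 (sub_nonneg.2 h1), mul_nonneg (sub_nonneg.2 h2.2) (sub_nonneg.2 ih)]

lemma gRec_phase1 {φ : ℕ → ℝ} (hφ : ∀ x, 0 ≤ φ x ∧ φ x ≤ 1) (M N a : ℕ) (β : ℕ → ℝ) (m y : ℕ)
    (hy : y ≤ m) (hβ : ∀ x, m - y ≤ x → x < m → 0 ≤ β x ∧ β x ≤ 1 - (1 - φ x) ^ a) :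
    (∏ x ∈ Finset.Ico (m - y) m, β x) * gRec φ M N m ≤ gRec φ M (N + a * y) (m - y) := by
  induction y with
  | zero => simp
  | succ y ih =>
    have ih := ih (by omega) fun x h1 h2 => hβ x (by omega) h2
    rw [Finset.prod_eq_prod_Ico_succ_bot (by omega)]
    have h1 : m - (y + 1) + 1 = m - y := by omega
    have h2 := gRec_wait hφ M (N + a * y) a (m - (y + 1))
    rw [h1] at h2 ⊢
    rw [mul_add, mul_one, ← add_assoc, mul_assoc]
    refine le_trans ?_ h2
    obtain ⟨b1, b2⟩ := hβ (m - (y + 1)) le_rfl (by omega)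
    exact mul_le_mul b2 ih (mul_nonneg (Finset.prod_nonneg fun x hx => by
      rw [Finset.mem_Ico] at hx; exact (hβ x (by omega) hx.2).1) (gRec_bounds hφ M _ _).1) (b1.trans b2)

lemma gRec_phase2 {φ : ℕ → ℝ} (hφ : ∀ x, 0 ≤ φ x ∧ φ x ≤ 1) (M H : ℕ) (hH : 0 < H) (m : ℕ)
    (hpos : ∀ x, m ≤ x → x < M → 0 < φ x) (H' : ℕ) (hH' : H' ≤ H) :
    ∀ x, m ≤ x → 1 - (((H : ℝ) - H') + ∑ l ∈ Finset.Ico x M, 1 / φ l) / H ≤ gRec φ M H' x := by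
  have hH0 : (0:ℝ) < H := by exact_mod_cast hH
  induction H' with
  | zero =>
    intro x hx
    by_cases hM : M ≤ x
    · simp [gRec, hM, hH0.ne']
    · simp only [gRec, hM, if_false]
      have : 0 ≤ ∑ l ∈ Finset.Ico x M, 1 / φ l := Finset.sum_nonneg fun l _ =>
        div_nonneg zero_le_one (hφ l).1
      rw [sub_nonpos, le_div_iff₀ hH0]
      push_cast; linarith
  | succ H' ih =>
    intro x hx
    have ih := ih (by omega)
    by_cases hM : M ≤ x
    · rw [gRec_top _ _ _ hM, Finset.Ico_eq_empty (by omega)]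
      have : ((H' + 1 : ℕ) : ℝ) ≤ H := by exact_mod_cast hH'
      have := div_nonneg (sub_nonneg.2 this) hH0.le
      simp only [Finset.sum_empty, add_zero]; linarith
    · simp only [gRec]
      have h1 := ih x hx
      have h2 := ih (x+1) (by omega)
      have hp := hpos x hx (by omega)
      rw [Finset.sum_eq_sum_Ico_succ_bot (by omega)] at h1 ⊢
      set T := ∑ l ∈ Finset.Ico (x+1) M, 1 / φ l
      have h3 := add_le_add (mul_le_mul_of_nonneg_left h2 (hφ x).1)
        (mul_le_mul_of_nonneg_left h1 (sub_nonneg.2 (hφ x).2))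
      refine le_trans (le_of_eq ?_) h3
      push_cast
      field_simp
      ring

end Numerics

section Numerics2

lemma sum_Ico_inv_sq_le (m M : ℕ) (hm : 1 ≤ m) : ∑ l ∈ Finset.Ico m M, 1 / (l : ℝ) ^ 2 ≤ 2 / (m : ℝ) := by
  have h := sum_Ioo_inv_sq_le (α := ℝ) (m - 1) M
  have h1 : Finset.Ioo (m - 1) M = Finset.Ico m M := by ext; simp; omega
  have h2 : ((m - 1 : ℕ) : ℝ) + 1 = m := by
    have : m - 1 + 1 = m := by omega
    exact_mod_cast this
  rw [h1, h2] at h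
  simpa [one_div] using h

lemma prod_beta_ge (s m : ℕ) (hm : 1 ≤ m) :
    Real.exp (-((s + 1 : ℝ) * m)) ≤ ∏ x ∈ Finset.Ico 1 m, (((x : ℝ) / m) ^ s / 2) := by
  have hm0 : (0:ℝ) < m := by exact_mod_cast hm
  have h1 : ∏ x ∈ Finset.Ico 1 m, ((x : ℝ) / m) = (m.factorial : ℝ) / (m:ℝ) ^ m := by
    have h2 : ∏ x ∈ Finset.Ico 1 (m+1), (x:ℝ) = m.factorial := by
      rw [← Finset.prod_Ico_id_eq_factorial]; push_cast; rfl
    rw [Finset.prod_Ico_succ_top hm] at h2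
    rw [Finset.prod_div_distrib, ← h2, Finset.prod_const, Nat.card_Ico]
    obtain ⟨t, rfl⟩ : ∃ t, m = t + 1 := ⟨m - 1, by omega⟩
    rw [Nat.add_sub_cancel, pow_succ]; field_simp
  rw [Finset.prod_div_distrib, Finset.prod_pow, h1, Finset.prod_const, Nat.card_Ico]
  have h3 : Real.exp (-(m:ℝ)) ≤ (m.factorial : ℝ) / (m:ℝ) ^ m := by
    have := Real.pow_div_factorial_le_exp (m:ℝ) hm0.le m
    rw [Real.exp_neg, ← one_div, div_le_div_iff₀ (Real.exp_pos _) (by positivity)]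
    rw [div_le_iff₀ (by positivity)] at this
    linarith
  have h4 : (2:ℝ) ^ (m - 1) ≤ Real.exp m := by
    calc (2:ℝ) ^ (m - 1) ≤ 2 ^ m := pow_le_pow_right₀ (by norm_num) (by omega)
      _ ≤ Real.exp 1 ^ m := pow_le_pow_left₀ (by norm_num) (by linarith [Real.add_one_le_exp 1]) _
      _ = Real.exp m := by rw [← Real.exp_nat_mul]; simp
  rw [le_div_iff₀ (by positivity)]
  calc Real.exp (-((s + 1 : ℝ) * m)) * 2 ^ (m-1) ≤ Real.exp (-((s + 1 : ℝ) * m)) * Real.exp m :=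
        mul_le_mul_of_nonneg_left h4 (Real.exp_pos _).le
    _ = Real.exp (-(m:ℝ)) ^ s := by rw [← Real.exp_add, ← Real.exp_nat_mul]; congr 1; ring
    _ ≤ _ := pow_le_pow_left₀ (Real.exp_pos _).le h3 _

lemma phiG_mid {s : ℕ} (hs : 2 ≤ s) (q : Fin s → ℝ) (K L N δ : ℝ) (hL : 1 ≤ L) (hK : 0 < K) (hN : 0 < N)
    (hKN : K * L ^ 3 ≤ N) (hδ : 0 < δ) (hδ1 : δ ≤ 1)
    (h : ∀ i, K * L / N ≤ q i ∧ q i ≤ 1 / L) (hP : K / (N * L ^ (s - 1)) ≤ ∏ i, q i) (x : ℕ)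
    (hx1 : δ * L ≤ x) (hx2 : (x : ℝ) ≤ L ^ 2) :
    K * δ ^ s / 2 ^ s * x ^ 2 / (L * N) ≤ phiG q x := by
  have hL0 : 0 < L := by linarith
  have hq : ∀ i, 0 ≤ q i ∧ q i ≤ 1 := fun i => ⟨le_trans (by positivity) (h i).1,
    (h i).2.trans (by rw [div_le_one hL0]; exact hL)⟩
  refine le_trans ?_ (phiG_ge q hq x)
  have hx0 : (0:ℝ) < x := lt_of_lt_of_le (by positivity) hx1
  have hδs : δ ^ s ≤ 1 := pow_le_one₀ hδ.le hδ1
  suffices h : K * δ ^ s * x ^ 2 / (L * N) ≤ ∏ i, min 1 (q i * x) by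
    calc _ = K * δ ^ s * x ^ 2 / (L * N) / 2 ^ s := by ring
      _ ≤ _ := by gcongr
  have hred : K * δ ^ s * x ^ 2 / (L * N) ≤ K * x ^ 2 / (L * N) := by
    gcongr; nlinarith
  rcases le_total (x:ℝ) L with hxL | hxL
  · rw [minprod_small q L x hL0 hx0.le (fun i => ⟨(hq i).1, (h i).2⟩) hxL]
    refine le_trans ?_ (mul_le_mul_of_nonneg_left hP (by positivity))
    obtain ⟨t, rfl⟩ : ∃ t, s = t + 2 := ⟨s - 2, by omega⟩
    have e1 : t + 2 - 1 = t + 1 := rfl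
    have h1 : (δ * L) ^ t ≤ (x:ℝ) ^ t := pow_le_pow_left₀ (by positivity) hx1 _
    have h2 : δ ^ (t + 2) ≤ δ ^ t := pow_le_pow_of_le_one hδ.le hδ1 (by omega)
    rw [e1, ← mul_div_assoc, div_le_div_iff₀ (by positivity) (by positivity)]
    have h3 : δ ^ (t+2) * L ^ t ≤ x ^ t := by
      refine le_trans ?_ h1
      rw [mul_pow]; gcongr
    calc K * δ ^ (t + 2) * ↑x ^ 2 * (N * L ^ (t + 1)) = (K * x ^ 2 * N * L) * (δ ^ (t+2) * L ^ t) := by ring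
      _ ≤ (K * x ^ 2 * N * L) * x ^ t := by gcongr
      _ = _ := by ring
  · refine hred.trans ?_
    rcases minprod_large q K L N x (by omega) hL hK hN h hP hxL with h1 | h1 | h1
    · refine le_trans ?_ h1
      rw [div_le_one (by positivity)]
      calc K * (x:ℝ) ^ 2 ≤ K * (L ^ 2) ^ 2 := by gcongr
        _ = L * (K * L ^ 3) := by ring
        _ ≤ L * N := by gcongr
    · refine le_trans ?_ h1
      rw [div_le_div_iff₀ (by positivity) (by positivity)]
      calc K * (x:ℝ) ^ 2 * N = K * x * N * x := by ring
        _ ≤ K * x * N * L ^ 2 := by gcongr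
        _ = _ := by ring
    · refine le_trans (le_of_eq ?_) h1
      field_simp

lemma seed_bound {s : ℕ} (hs : 2 ≤ s) (q : Fin s → ℝ) (K L : ℝ) (N M : ℕ) (hL : 8 * (s + 1) ≤ L) (hK : 0 < K)
    (hKN : K * L ^ 3 ≤ N) (hLN : L ≤ N)
    (h : ∀ i, K * L / N ≤ q i ∧ q i ≤ 1 / L) (hP : K / (N * L ^ (s - 1)) ≤ ∏ i, q i)
    (hM : (M : ℝ) < L ^ 2 + 1)
    (hK1 : 2 ^ (s + 3) * (8 * (s + 1)) ^ (s - 1) ≤ K)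
    (hK2 : 128 * (s + 1) * (2 ^ s * (8 * (s + 1)) ^ s) ≤ K) :
    ∀ N', N / 4 + (N / 4 + 1) ≤ N' → Real.exp (-(L / 4)) / 2 ≤ gRec (phiG q) M N' 1 := by
  intro N' hN'
  have hs0 : (0:ℝ) < s + 1 := by positivity
  have hs1 : (1:ℝ) ≤ s + 1 := by linarith [Nat.cast_nonneg (α := ℝ) s]
  have hL1 : 1 ≤ L := by linarith
  have hL0 : 0 < L := by linarith
  have hN0 : (0:ℝ) < N := by linarith
  have hq : ∀ i, 0 ≤ q i ∧ q i ≤ 1 := fun i => ⟨le_trans (by positivity) (h i).1,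
    (h i).2.trans (by rw [div_le_one hL0]; exact hL1)⟩
  have hφ := phiG_bounds q hq
  set m := ⌊L / (4 * (s + 1))⌋₊ with hm
  have hm1 : (m : ℝ) ≤ L / (4 * (s + 1)) := Nat.floor_le (by positivity)
  have hm2 : L / (8 * (s + 1)) ≤ m := by
    have h1 := Nat.lt_floor_add_one (L / (4 * (s + 1)))
    rw [← hm] at h1
    have h2 : 1 ≤ L / (8 * (s + 1)) := by rw [le_div_iff₀ (by positivity)]; linarith
    have h3 : L / (4 * (s + 1)) = 2 * (L / (8 * (s + 1))) := by field_simp; ring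
    linarith
  have hm3 : 1 ≤ m := by
    have h2 : 1 ≤ L / (8 * (s + 1)) := by rw [le_div_iff₀ (by positivity)]; linarith
    exact_mod_cast h2.trans hm2
  have hm0 : (0:ℝ) < m := by exact_mod_cast hm3
  have hmL : (m:ℝ) ≤ L / 4 := hm1.trans (by gcongr; linarith)
  have hLm : L ≤ 8 * (s + 1) * m := by rw [div_le_iff₀ (by positivity)] at hm2; linarith
  set a := N / (4 * m) with ha
  have ha1 : a * m ≤ N / 4 := by
    rw [ha, ← Nat.div_div_eq_div_mul]; exact Nat.div_mul_le_self _ _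
  have ha2 : (N : ℝ) / (8 * m) ≤ a := by
    have h1 : 4 * m ≤ N := by
      have : (4 * m : ℝ) ≤ N := by linarith
      exact_mod_cast this
    have h2 : 1 ≤ a := (Nat.one_le_div_iff (by omega)).2 h1
    have h3 : N < 4 * m * (a + 1) := by
      rw [ha]; exact Nat.lt_mul_div_succ N (by omega)
    have h3' : (N:ℝ) < 4 * m * (a + 1) := by exact_mod_cast h3
    have h2' : (1:ℝ) ≤ a := by exact_mod_cast h2
    rw [div_le_iff₀ (by positivity)]
    nlinarith
  -- phase 2
  have hphase2 : 1 / 2 ≤ gRec (phiG q) M (N / 4 + 1) m := by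
    set δ : ℝ := 1 / (8 * (s + 1)) with hδ
    have hδ0 : 0 < δ := by positivity
    have hδ1 : δ ≤ 1 := by rw [hδ, div_le_one (by positivity)]; linarith
    set K1 := K * δ ^ s / 2 ^ s with hK1
    have hK10 : 0 < K1 := by positivity
    have hmid : ∀ x, m ≤ x → x < M → K1 * x ^ 2 / (L * N) ≤ phiG q x := by
      intro x hx1 hx2
      refine phiG_mid hs q K L N δ hL1 hK hN0 hKN hδ0 hδ1 h hP x ?_ ?_
      · have : (m:ℝ) ≤ x := by exact_mod_cast hx1
        refine le_trans ?_ this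
        rw [hδ]; refine le_trans (le_of_eq ?_) hm2; ring
      · have : (x:ℝ) + 1 ≤ M := by exact_mod_cast hx2
        linarith
    have hpos : ∀ x, m ≤ x → x < M → 0 < phiG q x := fun x h1 h2 =>
      lt_of_lt_of_le (by have : (0:ℝ) < x := by exact_mod_cast (by omega : 0 < x)
                         positivity) (hmid x h1 h2)
    have := gRec_phase2 hφ M (N / 4 + 1) (by omega) m hpos (N/4 + 1) le_rfl m le_rfl
    refine le_trans ?_ this
    have hT : ∑ l ∈ Finset.Ico m M, 1 / phiG q l ≤ N / 8 := by
      calc ∑ l ∈ Finset.Ico m M, 1 / phiG q l ≤ ∑ l ∈ Finset.Ico m M, (L * N / K1) * (1 / (l:ℝ) ^ 2) := by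
            refine Finset.sum_le_sum fun l hl => ?_
            rw [Finset.mem_Ico] at hl
            have hl0 : (0:ℝ) < l := by exact_mod_cast (by omega : 0 < l)
            calc 1 / phiG q l ≤ 1 / (K1 * l ^ 2 / (L * N)) :=
                  one_div_le_one_div_of_le (by positivity) (hmid l hl.1 hl.2)
              _ = _ := by field_simp
        _ = (L * N / K1) * ∑ l ∈ Finset.Ico m M, (1 / (l:ℝ) ^ 2) := by rw [Finset.mul_sum]
        _ ≤ (L * N / K1) * (2 / m) := by gcongr; exact sum_Ico_inv_sq_le m M hm3
        _ = (L * 2 * N) / (K1 * m) := by field_simp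
        _ ≤ (8 * (s + 1) * m * 2 * N) / (K1 * m) := by gcongr
        _ = (16 * (s + 1) / K1) * N := by field_simp; ring
        _ ≤ (1 / 8) * N := by
            refine mul_le_mul_of_nonneg_right ?_ hN0.le
            rw [div_le_div_iff₀ hK10 (by norm_num), one_mul, hK1, hδ, one_div, inv_pow]
            rw [le_div_iff₀ (by positivity), le_mul_inv_iff₀ (by positivity)]
            refine le_trans (le_of_eq ?_) hK2; ring
        _ = N / 8 := by ring
    have hH : (N : ℝ) / 4 ≤ ((N / 4 + 1 : ℕ) : ℝ) := by
      have : N ≤ 4 * (N / 4 + 1) := by omega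
      have : (N:ℝ) ≤ 4 * ((N / 4 + 1 : ℕ) : ℝ) := by exact_mod_cast this
      linarith
    have hH0 : (0:ℝ) < ((N / 4 + 1 : ℕ) : ℝ) := by positivity
    have : (((N / 4 + 1 : ℕ) : ℝ) - ((N / 4 + 1 : ℕ) : ℝ) + ∑ l ∈ Finset.Ico m M, 1 / phiG q l) / ((N / 4 + 1 : ℕ) : ℝ) ≤ 1 / 2 := by
      rw [div_le_iff₀ hH0]; linarith
    linarith
  -- phase 1
  have hβ : ∀ x, m - (m - 1) ≤ x → x < m →
      0 ≤ ((x : ℝ) / m) ^ s / 2 ∧ ((x : ℝ) / m) ^ s / 2 ≤ 1 - (1 - phiG q x) ^ a := by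
    intro x _ hx
    refine ⟨by positivity, le_trans ?_ (one_sub_pow_ge (phiG q x) (hφ x).1 (hφ x).2 a)⟩
    have hxm : (x:ℝ) ≤ m := by exact_mod_cast hx.le
    have hz1 : ((x : ℝ) / m) ^ s ≤ 1 := pow_le_one₀ (by positivity) (by rw [div_le_one hm0]; exact hxm)
    have hz2 : ((x : ℝ) / m) ^ s ≤ phiG q x * a := by
      have h1 := phiG_ge q hq x
      rw [minprod_small q L x hL0 (by positivity) (fun i => ⟨(hq i).1, (h i).2⟩) (by linarith)] at h1
      have h2 : (x:ℝ) ^ s * (K / (N * L ^ (s - 1))) / 2 ^ s ≤ phiG q x := by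
        refine le_trans ?_ h1; gcongr
      calc ((x : ℝ) / m) ^ s ≤ ((x:ℝ) ^ s * (K / (N * L ^ (s - 1))) / 2 ^ s) * (N / (8 * m)) := by
            have e : ((x:ℝ) ^ s * (K / (N * L ^ (s - 1))) / 2 ^ s) * (N / (8 * m))
              = x ^ s * K / (2 ^ (s+3) * (L ^ (s-1) * m)) := by
              rw [pow_add]; field_simp; ring
            rw [e, div_pow, div_le_div_iff₀ (by positivity) (by positivity)]
            have h3 : L ^ (s-1) ≤ (8 * (s + 1)) ^ (s-1) * (m:ℝ) ^ (s-1) := by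
              rw [← mul_pow]; exact pow_le_pow_left₀ hL0.le hLm _
            have h4 : (m:ℝ) ^ (s - 1) * m = m ^ s := by
              rw [← pow_succ]; congr 1; omega
            calc (x:ℝ) ^ s * (2 ^ (s + 3) * (L ^ (s - 1) * m)) ≤
                x ^ s * (2 ^ (s+3) * ((8 * (s + 1)) ^ (s-1) * (m:ℝ) ^ (s-1) * m)) := by gcongr
              _ = x ^ s * (2 ^ (s+3) * (8 * (s + 1)) ^ (s-1)) * m ^ s := by rw [mul_assoc _ _ (m:ℝ), h4]; ring
              _ ≤ x ^ s * K * m ^ s := by gcongr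
        _ ≤ _ := by gcongr; exact (hφ x).1
    have := le_min hz1 hz2
    linarith
  have hp1 := gRec_phase1 hφ M (N / 4 + 1) a (fun x => ((x : ℝ) / m) ^ s / 2) m (m - 1) (by omega) hβ
  have e1 : m - (m - 1) = 1 := by omega
  rw [e1] at hp1
  have hle : N / 4 + 1 + a * (m - 1) ≤ N' := by
    have : a * (m - 1) ≤ a * m := Nat.mul_le_mul_left _ (by omega)
    omega
  refine le_trans ?_ (hp1.trans (gRec_mono hφ M hle 1))
  have h1 := prod_beta_ge s m hm3
  have h2 : Real.exp (-(L/4)) ≤ Real.exp (-((s + 1 : ℝ) * m)) := by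
    rw [Real.exp_le_exp]
    rw [le_div_iff₀ (by positivity)] at hm1
    linarith
  calc Real.exp (-(L / 4)) / 2 = Real.exp (-(L / 4)) * (1 / 2) := by ring
    _ ≤ _ := mul_le_mul (h2.trans h1) hphase2 (by norm_num) ((Real.exp_pos _).le.trans h1)

end Numerics2

section Numerics3

lemma one_sub_sum_le_prod' {ι : Type*} (F : Finset ι) (a : ι → ℝ) (h : ∀ i ∈ F, 0 ≤ a i ∧ a i ≤ 1) :
    1 - ∑ i ∈ F, a i ≤ ∏ i ∈ F, (1 - a i) := by
  classical
  induction F using Finset.induction_on with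
  | empty => simp
  | insert x F hx ih =>
    rw [Finset.sum_insert hx, Finset.prod_insert hx]
    have ih := ih fun i hi => h i (by simp [hi])
    have hx1 := h x (by simp)
    have hS : 0 ≤ ∑ i ∈ F, a i := Finset.sum_nonneg fun i hi => (h i (by simp [hi])).1
    nlinarith [mul_le_mul_of_nonneg_left ih (sub_nonneg.2 hx1.2)]

lemma one_sub_phi_le {s : ℕ} (hs : 2 ≤ s) (q : Fin s → ℝ) (K L N : ℝ) (hL : 1 ≤ L) (hK : 0 < K) (hN : 0 < N)
    (h : ∀ i, K * L / N ≤ q i ∧ q i ≤ 1 / L) (hP : K / (N * L ^ (s - 1)) ≤ ∏ i, q i) (x : ℕ)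
    (hx : L ^ 2 ≤ x) :
    1 - phiG q x ≤ Real.exp (-(1 / (2 ^ s * (2 * s)) * (K * L * x / N))) := by
  have hL0 : 0 < L := by linarith
  have hq : ∀ i, 0 ≤ q i ∧ q i ≤ 1 := fun i => ⟨le_trans (by positivity) (h i).1,
    (h i).2.trans (by rw [div_le_one hL0]; exact hL)⟩
  set z := K * L * x / N with hz
  have hxL : L ≤ x := by nlinarith
  have hx0 : (0:ℝ) < x := by linarith
  have hz0 : 0 ≤ z := by positivity
  have hs0 : (2:ℝ) ≤ s := by exact_mod_cast hs
  have h2s : (1:ℝ) ≤ 2 ^ s := one_le_pow₀ (by norm_num)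
  rcases le_total z (2 * s) with hzs | hzs
  · have hmin : min 1 z ≤ ∏ i, min 1 (q i * x) := by
      rcases minprod_large q K L N x (by omega) hL hK hN h hP hxL with h1 | h1 | h1
      · exact (min_le_left _ _).trans h1
      · exact (min_le_right _ _).trans h1
      · refine (min_le_right _ _).trans (le_trans ?_ h1)
        rw [hz, div_pow, div_mul_div_comm, div_le_div_iff₀ hN (by positivity)]
        calc K * L * x * (L ^ 2 * N) = (K * L * x * N) * L ^ 2 := by ring
          _ ≤ (K * L * x * N) * x := by gcongr
          _ = _ := by ring
    have h1 := phiG_ge q hq x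
    have h2 : z / (2 * s) ≤ min 1 z := by
      refine le_min ?_ ?_
      · rw [div_le_one (by positivity)]; exact hzs
      · exact div_le_self hz0 (by linarith)
    have h3 : z / (2 * s) / 2 ^ s ≤ phiG q x := le_trans (by gcongr; exact h2.trans hmin) h1
    have h4 := Real.add_one_le_exp (-(1 / (2 ^ s * (2 * s)) * z))
    have h5 : 1 / (2 ^ s * (2 * s)) * z = z / (2 * s) / 2 ^ s := by field_simp
    rw [h5] at h4 ⊢
    linarith
  · have h1 : 1 - phiG q x ≤ ∑ i : Fin s, (1 - q i) ^ x := by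
      have := one_sub_sum_le_prod' Finset.univ (fun i : Fin s => (1 - q i) ^ x) fun i _ =>
        ⟨pow_nonneg (sub_nonneg.2 (hq i).2) _, pow_le_one₀ (sub_nonneg.2 (hq i).2) (by linarith [(hq i).1])⟩
      unfold phiG; linarith
    have h2 : ∀ i, (1 - q i) ^ x ≤ Real.exp (-z) := by
      intro i
      have h3 : (1 - q i) ^ x ≤ Real.exp (-q i) ^ x :=
        pow_le_pow_left₀ (by linarith [(hq i).2]) (by linarith [Real.add_one_le_exp (-q i)]) _
      rw [← Real.exp_nat_mul] at h3
      refine h3.trans (Real.exp_le_exp.2 ?_)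
      have := mul_le_mul_of_nonneg_left (h i).1 hx0.le
      have e : z = x * (K * L / N) := by rw [hz]; ring
      rw [e]; linarith
    have h3 : 1 - phiG q x ≤ s * Real.exp (-z) := by
      refine h1.trans ((Finset.sum_le_sum fun i _ => h2 i).trans ?_)
      simp
    refine h3.trans ?_
    have h4 : (s:ℝ) ≤ Real.exp (z / 2) := by
      have := Real.add_one_le_exp (z / 2); linarith
    calc s * Real.exp (-z) ≤ Real.exp (z / 2) * Real.exp (-z) := by gcongr
      _ = Real.exp (-(z/2)) := by rw [← Real.exp_add]; congr 1; ring
      _ ≤ _ := by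
        rw [Real.exp_le_exp]
        have : 1 / (2 ^ s * (2 * s)) * z ≤ 1 / 2 * z := by
          refine mul_le_mul_of_nonneg_right ?_ hz0
          refine one_div_le_one_div_of_le (by norm_num) ?_
          nlinarith
        linarith

lemma closed_term {s : ℕ} (hs : 2 ≤ s) (q : Fin s → ℝ) (K : ℝ) (N E : ℕ) (hL : 1 ≤ Real.log N) (hK : 0 < K)
    (hN : 1 ≤ N)
    (h : ∀ i, K * Real.log N / N ≤ q i ∧ q i ≤ 1 / Real.log N) (hP : K / (N * Real.log N ^ (s - 1)) ≤ ∏ i, q i) (x : ℕ)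
    (hx : Real.log N ^ 2 ≤ x) (hxN : x < N) (hKE : (E + 3) * (2 ^ s * (4 * s)) ≤ K) :
    (N.choose x : ℝ) * (1 - phiG q x) ^ (N - x) ≤ ((N:ℝ) ^ (E + 2))⁻¹ := by
  set L := Real.log N with hLdef
  have hN0 : (0:ℝ) < N := by exact_mod_cast hN
  have hx0 : (0:ℝ) < x := by nlinarith
  have hx0' : 0 < x := by exact_mod_cast hx0
  set μ := min x (N - x) with hμ
  have hμ1 : 1 ≤ μ := by omega
  have hμ1' : (1:ℝ) ≤ μ := by exact_mod_cast hμ1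
  have hch : (N.choose x : ℝ) ≤ Real.exp (L * μ) := by
    have h1 : N.choose x ≤ N ^ μ := by
      rcases le_total x (N - x) with h | h
      · rw [hμ, min_eq_left h]; exact Nat.choose_le_pow _ _
      · rw [hμ, min_eq_right h, ← Nat.choose_symm hxN.le]; exact Nat.choose_le_pow _ _
    have h2 : (N.choose x : ℝ) ≤ (N:ℝ) ^ μ := by exact_mod_cast h1
    refine h2.trans (le_of_eq ?_)
    rw [mul_comm, Real.exp_nat_mul, hLdef, Real.exp_log hN0]
  have h1 := one_sub_phi_le hs q K L N hL hK hN0 h hP x hx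
  have hq : ∀ i, 0 ≤ q i ∧ q i ≤ 1 := fun i => ⟨le_trans (by positivity) (h i).1,
    (h i).2.trans (by rw [div_le_one (by linarith)]; exact hL)⟩
  have h2 := pow_le_pow_left₀ (sub_nonneg.2 (phiG_bounds q hq x).2) h1 (N - x)
  rw [← Real.exp_nat_mul] at h2
  have hmain : (μ:ℝ) / 2 ≤ x * (N - x : ℕ) / N := by
    rw [div_le_div_iff₀ (by norm_num) hN0]
    have e : (N:ℝ) = x + (N - x : ℕ) := by
      have : N = x + (N - x) := by omega
      exact_mod_cast this
    rw [e]
    have hy : (0:ℝ) ≤ ((N - x : ℕ) : ℝ) := by positivity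
    have hμx : (μ:ℝ) ≤ x := by exact_mod_cast min_le_left _ _
    have hμy : (μ:ℝ) ≤ ((N - x : ℕ) : ℝ) := by exact_mod_cast min_le_right _ _
    nlinarith [mul_le_mul_of_nonneg_left hμx hy, mul_le_mul_of_nonneg_left hμy hx0.le]
  have hs0 : (2:ℝ) ≤ s := by exact_mod_cast hs
  calc (N.choose x : ℝ) * (1 - phiG q x) ^ (N - x) ≤ Real.exp (L * μ) * _ :=
        mul_le_mul hch h2 (pow_nonneg (sub_nonneg.2 (phiG_bounds q hq x).2) _) (Real.exp_pos _).le
    _ = Real.exp (L * μ - K / (2 ^ s * (2 * s)) * L * (x * (N - x : ℕ) / N)) := by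
        rw [← Real.exp_add]; congr 1; ring
    _ ≤ Real.exp (-((E + 2 : ℕ) * L)) := by
        rw [Real.exp_le_exp]
        have h3 : (E + 3 : ℝ) * 2 ≤ K / (2 ^ s * (2 * s)) := by
          rw [le_div_iff₀ (by positivity)]; linarith
        have h4 : (E + 3 : ℝ) * 2 * L * (μ / 2) ≤ K / (2 ^ s * (2 * s)) * L * (x * (N - x : ℕ) / N) := by
          gcongr
        push_cast
        nlinarith [mul_le_mul_of_nonneg_left hμ1' (by linarith : (0:ℝ) ≤ L), Nat.cast_nonneg (α := ℝ) E,
          mul_nonneg (mul_nonneg (Nat.cast_nonneg (α := ℝ) E) (by linarith : (0:ℝ) ≤ L)) (sub_nonneg.2 hμ1')]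
    _ = _ := by
        rw [Real.exp_neg, Real.exp_nat_mul, hLdef, Real.exp_log hN0]

lemma ev_log_pow (c : ℝ) (d : ℕ) (hc : 0 < c) : ∀ᶠ N : ℕ in atTop, c * Real.log N ^ d ≤ N := by
  have hcast : Tendsto (fun N : ℕ => (N:ℝ)) atTop atTop := tendsto_natCast_atTop_atTop
  have h := (Real.isLittleO_pow_log_id_atTop (n := d)).comp_tendsto hcast
  have := h.bound (c := 1 / c) (by positivity)
  filter_upwards [this, eventually_ge_atTop 1] with N h1 h2
  have hl : 0 ≤ Real.log N := Real.log_natCast_nonneg N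
  simp only [Function.comp, id, Real.norm_eq_abs, abs_of_nonneg (pow_nonneg hl d), Nat.abs_cast] at h1
  calc c * Real.log N ^ d ≤ c * (1 / c * N) := by gcongr
    _ = N := by field_simp

set_option maxHeartbeats 1000000 in
open MeasureTheory in
theorem graph_whp (s : ℕ) (hs : 2 ≤ s) (E : ℕ) : ∃ K : ℝ, 1 ≤ K ∧ ∀ᶠ N : ℕ in atTop,
    ∀ (Ω α : Type) [MeasurableSpace Ω] [DecidableEq α] [Fintype α] (μ : Measure Ω) [IsProbabilityMeasure μ]
      (X : Fin s × Sym2 α → Ω → Prop) (q : Fin s → ℝ),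
      (∀ A : Set Ω, MeasurableSet A) → IndepFam μ X → Fintype.card α = N →
      (∀ i, K * Real.log N / N ≤ q i ∧ q i ≤ 1 / Real.log N) →
      K / (N * Real.log N ^ (s - 1)) ≤ ∏ i, q i →
      (∀ i u v, u ≠ v → q i ≤ μ.real {ω | X (i, s(u, v)) ω}) →
      μ.real {ω | ¬ SpanG X ω Finset.univ} ≤ ((N:ℝ) ^ E)⁻¹ := by
  set K : ℝ := 1 + 2 ^ (s + 3) * (8 * (s + 1)) ^ (s - 1) + 128 * (s + 1) * (2 ^ s * (8 * (s + 1)) ^ s)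
    + (E + 3) * (2 ^ s * (4 * s)) with hKdef
  have k1 : (0:ℝ) ≤ 2 ^ (s + 3) * (8 * (s + 1)) ^ (s - 1) := by positivity
  have k2 : (0:ℝ) ≤ 128 * (s + 1) * (2 ^ s * (8 * (s + 1)) ^ s) := by positivity
  have k3 : (0:ℝ) ≤ (E + 3) * (2 ^ s * (4 * s)) := by positivity
  have hK : 1 ≤ K := by linarith
  refine ⟨K, hK, ?_⟩
  have hlog : Tendsto (fun N : ℕ => Real.log N) atTop atTop :=
    Real.tendsto_log_atTop.comp tendsto_natCast_atTop_atTop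
  have ev1 : ∀ᶠ N : ℕ in atTop, (8 * (s + 1) : ℝ) ≤ Real.log N := hlog.eventually_ge_atTop _
  have ev2 := ev_log_pow K 3 (by linarith)
  have ev3 := ev_log_pow 64 4 (by norm_num)
  have ev4 := ev_log_pow ((4 * (E + 1)) ^ 4) 4 (by positivity)
  filter_upwards [ev1, ev2, ev3, ev4, eventually_ge_atTop 100] with N h1 h2 h3 h4 h5
  intro Ω α _ _ _ μ _ X q hm hX hcard hq hP hprob
  set L := Real.log N with hL
  have hs0 : (0:ℝ) ≤ s := by positivity
  have hL8 : 8 ≤ L := by linarith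
  have hN0 : (100:ℝ) ≤ N := by exact_mod_cast h5
  have hLN : L ≤ N := by
    have : L ≤ 64 * L ^ 4 := by nlinarith [pow_le_pow_right₀ (by linarith : (1:ℝ) ≤ L) (show 1 ≤ 4 by norm_num)]
    linarith
  have hq01 : ∀ i, 0 ≤ q i ∧ q i ≤ 1 := fun i => ⟨le_trans (by positivity) (hq i).1,
    (hq i).2.trans (by rw [div_le_one (by linarith)]; linarith)⟩
  have hφ := phiG_bounds q hq01
  set M := ⌈L ^ 2⌉₊ with hM
  have hM1 : (M:ℝ) < L ^ 2 + 1 := Nat.ceil_lt_add_one (by positivity)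
  have hM2 : L ^ 2 ≤ M := Nat.le_ceil _
  have hseed := seed_bound hs q K L N M h1 (by linarith) h2 hLN hq hP hM1 (by linarith) (by linarith)
  have hadj : ∀ (C : Finset α) (w : α), w ∉ C → phiG q C.card ≤ μ.real {ω | AdjG X ω C w} :=
    fun C w hw => prob_adj hm hX q (fun i => (hq01 i).1) hprob C w hw
  set t := N.sqrt with ht
  have ht1 : t * t ≤ N := Nat.sqrt_le N
  have ht2 : N < (t + 1) * (t + 1) := Nat.lt_succ_sqrt N
  have ht2' : (N:ℝ) < (t + 1) * (t + 1) := by exact_mod_cast ht2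
  have ht1' : (t:ℝ) * t ≤ N := by exact_mod_cast ht1
  have ht10 : (10:ℝ) ≤ t := by
    have : 10 ≤ t := by rw [ht, Nat.le_sqrt]; omega
    exact_mod_cast this
  have htM : N / 4 + (N / 4 + 1) + 1 + t * M ≤ N := by
    have h6 : 8 * L ^ 2 ≤ t + 1 := by nlinarith
    have h7 : 4 * (t * M + 2) ≤ N := by
      have : (4 * (t * M + 2) : ℝ) ≤ N := by nlinarith
      exact_mod_cast this
    omega
  have hmain := prob_span hm hX (phiG q) hφ hadj M (N / 4 + (N / 4 + 1)) (Real.exp (-(L / 4)) / 2)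
    (by have : Real.exp (-(L/4)) ≤ 1 := Real.exp_le_one_iff.2 (by linarith)
        linarith) hseed t (by rw [hcard]; exact htM)
  rw [hcard] at hmain
  refine hmain.trans ?_
  have hA : (1 - Real.exp (-(L / 4)) / 2) ^ t ≤ ((N:ℝ) ^ (E + 1))⁻¹ := by
    set r := Real.exp (L / 4) with hr
    have hr4 : r ^ 4 = N := by
      rw [hr, ← Real.exp_nat_mul]; push_cast
      rw [show (4:ℝ) * (L / 4) = L by ring, hL, Real.exp_log (by linarith)]
    have hr0 : 0 < r := Real.exp_pos _
    have hrE : 4 * (E + 1) * L ≤ r := by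
      rw [← hr4, ← mul_pow] at h4
      exact le_of_pow_le_pow_left₀ (by norm_num) hr0.le h4
    have htr : r ^ 2 ≤ 2 * t := by nlinarith
    have e1 : Real.exp (-(L/4)) = 1 / r := by rw [hr, Real.exp_neg, one_div]
    have hr1 : 1 / r ≤ 1 := by rw [← e1]; exact Real.exp_le_one_iff.2 (by linarith)
    rw [e1]
    calc (1 - 1 / r / 2) ^ t ≤ Real.exp (-(1 / r / 2)) ^ t :=
          pow_le_pow_left₀ (by linarith) (by linarith [Real.add_one_le_exp (-(1 / r / 2))]) _
      _ = Real.exp (-(t / (2 * r))) := by rw [← Real.exp_nat_mul]; congr 1; field_simp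
      _ ≤ Real.exp (-((E + 1 : ℕ) * L)) := by
          rw [Real.exp_le_exp, neg_le_neg_iff, le_div_iff₀ (by positivity)]
          push_cast
          nlinarith
      _ = _ := by rw [Real.exp_neg, Real.exp_nat_mul, hL, Real.exp_log (by linarith)]
  have hB : ∑ x ∈ Finset.Ico M N, (N.choose x : ℝ) * (1 - phiG q x) ^ (N - x) ≤ ((N:ℝ) ^ (E + 1))⁻¹ := by
    calc _ ≤ ∑ x ∈ Finset.Ico M N, ((N:ℝ) ^ (E + 2))⁻¹ := by
          refine Finset.sum_le_sum fun x hx => ?_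
          rw [Finset.mem_Ico] at hx
          have hMx : (M:ℝ) ≤ x := by exact_mod_cast hx.1
          exact closed_term hs q K N E (by linarith) (by linarith) (by omega) hq hP x (by linarith) hx.2 (by linarith)
      _ ≤ N * ((N:ℝ) ^ (E + 2))⁻¹ := by
          rw [Finset.sum_const, nsmul_eq_mul, Nat.card_Ico]
          gcongr; exact_mod_cast Nat.sub_le _ _
      _ = _ := by rw [pow_succ _ (E+1)]; field_simp
  calc _ ≤ ((N:ℝ) ^ (E + 1))⁻¹ + ((N:ℝ) ^ (E + 1))⁻¹ := add_le_add hA hB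
    _ = 2 / N * ((N:ℝ) ^ E)⁻¹ := by rw [pow_succ]; field_simp; norm_num
    _ ≤ 1 * ((N:ℝ) ^ E)⁻¹ := by
        gcongr; rw [div_le_one (by linarith)]; linarith
    _ = _ := one_mul _

end Numerics3

section Determ
variable {V : Type*} [DecidableEq V] {s : ℕ}

structure PartInv (J0 : Finset (Finset V)) (P : Finset (Finset (Finset V))) : Prop where
  cover : ∀ J ∈ J0, ∃ C ∈ P, J ∈ C
  sub : ∀ C ∈ P, C ⊆ J0
  disj : ∀ C ∈ P, ∀ C' ∈ P, C ≠ C' → Disjoint C C'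
  ne : ∀ C ∈ P, C.Nonempty

lemma partInv_init (J0 : Finset (Finset V)) :
    PartInv J0 (J0.image fun J => ({J} : Finset (Finset V))) := by
  constructor
  · intro J hJ; exact ⟨{J}, Finset.mem_image_of_mem _ hJ, by simp⟩
  · intro C hC
    obtain ⟨J, hJ, rfl⟩ := Finset.mem_image.1 hC
    simpa using hJ
  · intro C hC C' hC' hne
    obtain ⟨J, hJ, rfl⟩ := Finset.mem_image.1 hC
    obtain ⟨J', hJ', rfl⟩ := Finset.mem_image.1 hC'
    rw [Finset.disjoint_singleton]
    rintro rfl; exact hne rfl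
  · intro C hC
    obtain ⟨J, hJ, rfl⟩ := Finset.mem_image.1 hC
    simp

lemma partInv_step {E : Fin s → Finset (Finset V)} {J0 : Finset (Finset V)}
    {P P' : Finset (Finset (Finset V))} (h : PartInv J0 P) (hs : MergeStepS E P P') :
    PartInv J0 P' := by
  obtain ⟨C, hC, C', hC', hne, -, rfl⟩ := hs
  constructor
  · intro J hJ
    obtain ⟨D, hD, hJD⟩ := h.cover J hJ
    by_cases h1 : D = C
    · exact ⟨C ∪ C', by simp, by simp [← h1, hJD]⟩
    by_cases h2 : D = C'
    · exact ⟨C ∪ C', by simp, by simp [← h2, hJD]⟩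
    exact ⟨D, by simp [h1, h2, hD], hJD⟩
  · intro D hD
    simp only [Finset.mem_insert, Finset.mem_erase] at hD
    rcases hD with rfl | ⟨_, _, hD⟩
    · exact Finset.union_subset (h.sub _ hC) (h.sub _ hC')
    · exact h.sub _ hD
  · have key : ∀ D ∈ P, D ≠ C → D ≠ C' → Disjoint (C ∪ C') D := fun D hD h1 h2 =>
      Finset.disjoint_union_left.2 ⟨h.disj _ hC _ hD h1.symm, h.disj _ hC' _ hD h2.symm⟩
    intro D hD D' hD' hne
    simp only [Finset.mem_insert, Finset.mem_erase] at hD hD'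
    rcases hD with rfl | ⟨h2, h1, hD⟩
    · rcases hD' with rfl | ⟨h2', h1', hD'⟩
      · exact absurd rfl hne
      · exact key D' hD' h1' h2'
    · rcases hD' with rfl | ⟨h2', h1', hD'⟩
      · exact (key D hD h1 h2).symm
      · exact h.disj _ hD _ hD' hne
  · intro D hD
    simp only [Finset.mem_insert, Finset.mem_erase] at hD
    rcases hD with rfl | ⟨_, _, hD⟩
    · exact (h.ne _ hC).mono Finset.subset_union_left
    · exact h.ne _ hD

lemma step_card {E : Fin s → Finset (Finset V)} {P P' : Finset (Finset (Finset V))}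
    (hs : MergeStepS E P P') : P'.card < P.card := by
  obtain ⟨C, hC, C', hC', hne, -, rfl⟩ := hs
  have h1 := Finset.card_erase_of_mem hC
  have h2 : C' ∈ P.erase C := Finset.mem_erase.2 ⟨hne.symm, hC'⟩
  have h3 := Finset.card_erase_of_mem h2
  have h4 := Finset.card_insert_le (C ∪ C') ((P.erase C).erase C')
  have h5 := Finset.card_pos.2 ⟨_, h2⟩
  omega

lemma exists_stuck (E : Fin s → Finset (Finset V)) (P : Finset (Finset (Finset V))) :
    ∃ P', Relation.ReflTransGen (MergeStepS E) P P' ∧ ∀ P'', ¬ MergeStepS E P' P'' := by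
  induction hc : P.card using Nat.strong_induction_on generalizing P with
  | _ n ih =>
    by_cases h : ∃ P1, MergeStepS E P P1
    · obtain ⟨P1, h1⟩ := h
      obtain ⟨P', h2, h3⟩ := ih P1.card (hc ▸ step_card h1) P1 rfl
      exact ⟨P', Relation.ReflTransGen.head h1 h2, h3⟩
    · exact ⟨P, Relation.ReflTransGen.refl, fun P'' hP => h ⟨P'', hP⟩⟩

lemma partInv_reach {E : Fin s → Finset (Finset V)} {J0 : Finset (Finset V)}
    {P P' : Finset (Finset (Finset V))} (h : PartInv J0 P)
    (hr : Relation.ReflTransGen (MergeStepS E) P P') : PartInv J0 P' := by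
  induction hr with
  | refl => exact h
  | tail _ hs ih => exact partInv_step ih hs

/-- one-vertex exchanges -/
lemma johnson {j : ℕ} (R : Finset V → Prop)
    (h : ∀ (L0 : Finset V) (u v : V), L0.card + 1 = j → u ∉ L0 → v ∉ L0 → R (insert u L0) → R (insert v L0))
    (J J' : Finset V) (hJ : J.card = j) (hJ' : J'.card = j) (hR : R J) : R J' := by
  induction hc : (J \ J').card generalizing J with
  | zero =>
    rw [Finset.card_eq_zero, Finset.sdiff_eq_empty_iff_subset] at hc
    rwa [← Finset.eq_of_subset_of_card_le hc (by omega)]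
  | succ m ih =>
    have h1 : (J \ J').Nonempty := by rw [← Finset.card_pos]; omega
    have h2 : (J' \ J).Nonempty := by
      rw [← Finset.card_pos]
      have := Finset.card_sdiff_add_card_inter J J'
      have := Finset.card_sdiff_add_card_inter J' J
      rw [Finset.inter_comm] at this
      omega
    obtain ⟨x, hx⟩ := h1
    obtain ⟨y, hy⟩ := h2
    rw [Finset.mem_sdiff] at hx hy
    have hyx : y ∉ J.erase x := fun hh => hy.2 (Finset.mem_of_mem_erase hh)
    have hpos : 0 < J.card := Finset.card_pos.2 ⟨x, hx.1⟩
    have hcE := Finset.card_erase_of_mem hx.1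
    refine ih (insert y (J.erase x)) ?_ ?_ ?_
    · rw [Finset.card_insert_of_notMem hyx]; omega
    · refine h (J.erase x) x y (by omega) (Finset.notMem_erase _ _) hyx ?_
      rwa [Finset.insert_erase hx.1]
    · have : insert y (J.erase x) \ J' = (J \ J').erase x := by
        ext z
        simp only [Finset.mem_sdiff, Finset.mem_insert, Finset.mem_erase]
        constructor
        · rintro ⟨rfl | ⟨h1, h2⟩, h3⟩
          · exact absurd hy.1 h3
          · exact ⟨h1, h2, h3⟩
        · rintro ⟨h1, h2, h3⟩; exact ⟨Or.inr ⟨h1, h2⟩, h3⟩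
      rw [this, Finset.card_erase_of_mem (by simp [hx]), hc]; rfl

/-- deterministic percolation criterion -/
lemma percolates_of_span [Fintype V] {j : ℕ} (hj : 1 ≤ j) (hn : j ≤ Fintype.card V) (E : Fin s → Finset (Finset V))
    (h : ∀ (L0 : Finset V) (u v : V), L0.card + 1 = j → u ∉ L0 → v ∉ L0 → u ≠ v →
      ∃ (A : Finset V), u ∈ A ∧ v ∈ A ∧ Disjoint L0 A ∧
        SpanG (fun (z : Fin s × Sym2 {x // x ∈ A}) (_ : Unit) =>
          ∃ e ∈ E z.1, L0 ⊆ e ∧ ∀ x : {x // x ∈ A}, x.1 ∈ e ↔ x ∈ z.2) () Finset.univ) :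
    JPercolatesS j E := by
  set J0 := (Finset.univ : Finset V).powersetCard j with hJ0
  obtain ⟨P, hP1, hP2⟩ := exists_stuck E (J0.image fun J => ({J} : Finset (Finset V)))
  have inv := partInv_reach (partInv_init J0) hP1
  have hstuck : ∀ C ∈ P, ∀ C' ∈ P, MergeableS E C C' → C = C' := by
    intro C hC C' hC' hm
    by_contra hne
    exact hP2 _ ⟨C, hC, C', hC', hne, hm, rfl⟩
  have hmem : ∀ J : Finset V, J ∈ J0 ↔ J.card = j := fun J => by simp [hJ0, Finset.mem_powersetCard]
  have hex : ∀ C ∈ P, ∀ (L0 : Finset V) (u v : V), L0.card + 1 = j → u ∉ L0 → v ∉ L0 →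
      insert u L0 ∈ C → insert v L0 ∈ C := by
    intro C hC L0 u v hL hu hv huC
    by_cases huv : u = v
    · exact huv ▸ huC
    obtain ⟨A, huA, hvA, hLA, hspan⟩ := h L0 u v hL hu hv huv
    have key : ∀ S : Finset {x // x ∈ A}, SpanG (fun (z : Fin s × Sym2 {x // x ∈ A}) (_ : Unit) =>
          ∃ e ∈ E z.1, L0 ⊆ e ∧ ∀ x : {x // x ∈ A}, x.1 ∈ e ↔ x ∈ z.2) () S →
        ∃ D ∈ P, ∀ x ∈ S, insert x.1 L0 ∈ D := by
      intro S hS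
      have hcl : ∀ x : {x // x ∈ A}, ∃ D ∈ P, insert x.1 L0 ∈ D := fun x => by
        refine inv.cover _ ((hmem _).2 ?_)
        rw [Finset.card_insert_of_notMem (Finset.disjoint_right.1 hLA x.2), hL]
      induction hS with
      | single v =>
        obtain ⟨D, hD, h1⟩ := hcl v
        exact ⟨D, hD, by simpa using h1⟩
      | step S w hS hw hadj ih =>
        obtain ⟨D, hD, h1⟩ := ih
        obtain ⟨D', hD', h2⟩ := hcl w
        have : D = D' := by
          refine hstuck D hD D' hD' fun i => ?_
          obtain ⟨u, hu, e, he, hLe, hx⟩ := hadj i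
          refine ⟨_, h1 u hu, _, h2, e, he, ?_⟩
          refine Finset.union_subset (Finset.insert_subset ?_ hLe) (Finset.insert_subset ?_ hLe)
          · exact (hx u).2 (by simp)
          · exact (hx w).2 (by simp)
        refine ⟨D, hD, fun x hx => ?_⟩
        rcases Finset.mem_insert.1 hx with rfl | hx
        · exact this ▸ h2
        · exact h1 x hx
    obtain ⟨D, hD, h1⟩ := key _ hspan
    have hD1 := h1 ⟨u, huA⟩ (by simp)
    have hD2 := h1 ⟨v, hvA⟩ (by simp)
    have : C = D := by
      by_contra hne
      exact Finset.disjoint_left.1 (inv.disj C hC D hD hne) huC hD1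
    exact this ▸ hD2
  have hall : ∀ C ∈ P, C = J0 := by
    intro C hC
    refine Finset.Subset.antisymm (inv.sub C hC) fun J hJ => ?_
    obtain ⟨J1, hJ1⟩ := inv.ne C hC
    exact johnson (· ∈ C) (hex C hC) J1 J ((hmem _).1 (inv.sub C hC hJ1)) ((hmem _).1 hJ) hJ1
  have hPne : P = {J0} := by
    obtain ⟨J, hJ⟩ : J0.Nonempty := by
      rw [hJ0, Finset.powersetCard_nonempty]; simpa using hn
    obtain ⟨C, hC, -⟩ := inv.cover J hJ
    ext D
    rw [Finset.mem_singleton]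
    exact ⟨hall D, fun h => h ▸ (hall C hC) ▸ hC⟩
  unfold JPercolatesS PercolatesOnS
  rw [← hPne]
  exact hP1

end Determ

section Red

lemma card_filter_lt (s r : ℕ) (h : r ≤ s) : (Finset.univ.filter (fun i : Fin s => (i : ℕ) < r)).card = r := by
  rw [Fin.card_filter_val_lt]; exact min_eq_right h

lemma q_cond {s : ℕ} (hs : 2 ≤ s) (d : ℕ) (p : Fin s → ℝ) (hp0 : ∀ i, 0 ≤ p i)
    (hmono : ∀ i i', i ≤ i' → p i ≤ p i') (η K c n N l L : ℝ) (hη : 0 < η) (hη1 : η ≤ 1) (hK : 1 ≤ K)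
    (hn : 0 < n) (hnN : n ≤ 3 * N) (hL : 1 ≤ L) (hLl : L ≤ l) (hlL : l ≤ 2 * L) (hKN : K * L ^ 2 ≤ N)
    (hc : K * 3 * (4 / η) ^ s ≤ c)
    (h1 : c * l / n ^ (d + 1) ≤ p ⟨0, lt_of_lt_of_le Nat.zero_lt_two hs⟩)
    (h2 : ∀ r, 2 ≤ r → r ≤ s → c / (n ^ (r * d + 1) * l ^ (r - 1)) ≤
      ∏ i ∈ Finset.univ.filter (fun i : Fin s => (i : ℕ) < r), p i) :
    (∀ i, K * L / N ≤ min (η * p i * n ^ d / 2) (1 / L) ∧ min (η * p i * n ^ d / 2) (1 / L) ≤ 1 / L) ∧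
      K / (N * L ^ (s - 1)) ≤ ∏ i, min (η * p i * n ^ d / 2) (1 / L) := by
  set ζ : Fin s → ℝ := fun i => η * p i * n ^ d / 2 with hζ
  have hL0 : 0 < L := by linarith
  have hN0 : 0 < N := by linarith
  have hl0 : 0 < l := by linarith
  have hη4 : 1 ≤ 4 / η := by rw [le_div_iff₀ hη]; linarith
  have hcr : ∀ r, r ≤ s → K * 3 * (4 / η) ^ r ≤ c := fun r hr =>
    le_trans (by gcongr) hc
  have hc0 : 0 < c := lt_of_lt_of_le (by positivity) hc
  have hζmono : ∀ i i', i ≤ i' → ζ i ≤ ζ i' := fun i i' h => by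
    have := hmono i i' h; simp only [hζ]; gcongr
  have hζ0 : ∀ i, K * L / N ≤ ζ i := by
    intro i
    refine le_trans ?_ (hζmono ⟨0, lt_of_lt_of_le Nat.zero_lt_two hs⟩ i (Fin.mk_le_of_le_val (Nat.zero_le _)))
    have h3 : η * (c * l / n ^ (d+1)) * n ^ d / 2 ≤ ζ ⟨0, lt_of_lt_of_le Nat.zero_lt_two hs⟩ := by simp only [hζ]; gcongr
    refine le_trans ?_ h3
    have e : η * (c * l / n ^ (d+1)) * n ^ d / 2 = (η * c / 2) * l / n := by rw [pow_succ]; field_simp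
    rw [e, div_le_div_iff₀ hN0 hn]
    have h4 := hcr 1 (by omega)
    rw [pow_one] at h4
    have h5 : 3 * K ≤ η * c / 2 := by
      have : η * (K * 3 * (4 / η)) = 12 * K := by field_simp; norm_num
      have := mul_le_mul_of_nonneg_left h4 hη.le
      linarith
    calc K * L * n ≤ K * l * (3 * N) := by gcongr
      _ = (3 * K) * l * N := by ring
      _ ≤ _ := by gcongr
  have hKL1 : K * L / N ≤ 1 / L := by
    rw [div_le_div_iff₀ hN0 hL0]; linarith
  refine ⟨fun i => ⟨le_min (hζ0 i) hKL1, min_le_right _ _⟩, ?_⟩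
  -- find r
  have hex : ∃ r, ∀ i : Fin s, r ≤ (i : ℕ) → 1 / L ≤ ζ i := ⟨s, fun i hi => absurd i.2 (by omega)⟩
  classical
  obtain ⟨r, hr1, hr2⟩ : ∃ r, (∀ i : Fin s, r ≤ (i : ℕ) → 1 / L ≤ ζ i) ∧
      ∀ i : Fin s, (i : ℕ) < r → ζ i < 1 / L := by
    refine ⟨Nat.find hex, Nat.find_spec hex, fun i hi => ?_⟩
    have := Nat.find_min hex hi
    push Not at this
    obtain ⟨i', h3, h4⟩ := this
    exact lt_of_le_of_lt (hζmono i i' h3) h4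
  obtain ⟨r, hrs, hr1, hr2⟩ : ∃ r ≤ s, (∀ i : Fin s, r ≤ (i : ℕ) → 1 / L ≤ ζ i) ∧
      ∀ i : Fin s, (i : ℕ) < r → ζ i < 1 / L :=
    ⟨min r s, min_le_right _ _, fun i hi => hr1 i (by have := i.2; omega), fun i hi => hr2 i (by omega)⟩
  set F := Finset.univ.filter (fun i : Fin s => (i : ℕ) < r) with hF
  have hprod : L ^ s * ∏ i, min (ζ i) (1 / L) = L ^ r * ∏ i ∈ F, ζ i := by
    have e1 : L ^ s * ∏ i, min (ζ i) (1 / L) = ∏ i, (L * min (ζ i) (1/L)) := by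
      rw [Finset.prod_mul_distrib]; simp
    have e2 : L ^ r * ∏ i ∈ F, ζ i = ∏ i ∈ F, (L * ζ i) := by
      rw [Finset.prod_mul_distrib, Finset.prod_const, hF, card_filter_lt s r hrs]
    rw [e1, e2, hF, Finset.prod_filter]
    refine Finset.prod_congr rfl fun i _ => ?_
    split_ifs with h
    · rw [min_eq_left (hr2 i h).le]
    · rw [min_eq_right (hr1 i (not_lt.1 h))]; field_simp
  have hgoal : K * L / N ≤ L ^ r * ∏ i ∈ F, ζ i := by
    rcases Nat.lt_or_ge r 2 with hr | hr
    · interval_cases r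
      · simp [hF]
        rw [div_le_one hN0]; nlinarith
      · have : F = {⟨0, lt_of_lt_of_le Nat.zero_lt_two hs⟩} := by
          ext i; simp [hF, Fin.ext_iff]
        rw [this, Finset.prod_singleton, pow_one]
        have := hζ0 ⟨0, lt_of_lt_of_le Nat.zero_lt_two hs⟩
        have h0 : 0 ≤ K * L / N := by positivity
        nlinarith
    · have h3 : ∏ i ∈ F, ζ i = (η / 2) ^ r * n ^ (r * d) * ∏ i ∈ F, p i := by
        have : ∀ i, ζ i = (η / 2 * n ^ d) * p i := fun i => by simp only [hζ]; ring
        simp only [this]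
        rw [Finset.prod_mul_distrib, Finset.prod_const, hF, card_filter_lt s r hrs, mul_pow, ← pow_mul,
          mul_comm d r]
      have h4 := h2 r hr hrs
      have h5 : l ^ (r - 1) ≤ 2 ^ (r - 1) * L ^ (r - 1) := by rw [← mul_pow]; gcongr
      have h6 : (2:ℝ) ^ (r - 1) ≤ 2 ^ r := pow_le_pow_right₀ (by norm_num) (by omega)
      calc K * L / N ≤ L ^ r * ((η / 2) ^ r * n ^ (r * d) * (c / (n ^ (r * d + 1) * (2 ^ r * L ^ (r - 1))))) := by
            obtain ⟨t, rfl⟩ : ∃ t, r = t + 1 := ⟨r - 1, by omega⟩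
            have e : L ^ (t+1) * ((η / 2) ^ (t+1) * n ^ ((t+1) * d) * (c / (n ^ ((t+1) * d + 1) * (2 ^ (t+1) * L ^ (t + 1 - 1))))) = L * c * (η / 4) ^ (t+1) / n := by
              have e4 : (η / 4) ^ (t+1) = (η/2) ^ (t+1) / 2 ^ (t+1) := by rw [← div_pow]; congr 1; ring
              rw [e4, Nat.add_sub_cancel, pow_succ n, pow_succ L]; field_simp
            rw [e, div_le_div_iff₀ hN0 hn]
            have h7 := hcr (t+1) hrs
            have h8 : K * 3 ≤ c * (η / 4) ^ (t+1) := by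
              have : (4 / η) ^ (t+1) * (η / 4) ^ (t+1) = 1 := by
                rw [← mul_pow]; field_simp; simp
              calc K * 3 = K * 3 * (4 / η) ^ (t+1) * (η / 4) ^ (t+1) := by rw [mul_assoc, this, mul_one]
                _ ≤ _ := by gcongr
            calc K * L * n ≤ K * L * (3 * N) := by gcongr
              _ = L * (K * 3) * N := by ring
              _ ≤ L * (c * (η / 4) ^ (t+1)) * N := by gcongr
              _ = _ := by ring
        _ ≤ L ^ r * ((η / 2) ^ r * n ^ (r * d) * (c / (n ^ (r * d + 1) * l ^ (r - 1)))) := by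
            gcongr; exact h5.trans (by gcongr)
        _ ≤ L ^ r * ((η / 2) ^ r * n ^ (r * d) * ∏ i ∈ F, p i) := by gcongr
        _ = _ := by rw [h3]
  rw [← hprod] at hgoal
  rw [div_le_iff₀ (by positivity)]
  rw [div_le_iff₀ (by positivity)] at hgoal
  have e : L ^ s = L ^ (s - 1) * L := by rw [← pow_succ]; congr 1; omega
  rw [e] at hgoal
  have : K * L ≤ (∏ i, min (ζ i) (1 / L)) * (N * L ^ (s - 1)) * L := by linarith
  exact le_of_mul_le_mul_right this hL0

end Red

section Red2
open MeasureTheory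

lemma IndepFam.blocks {Ω ι κ : Type*} [MeasurableSpace Ω] {μ : Measure Ω} {X : ι → Ω → Prop}
    (hX : IndepFam μ X) {X' : κ → Ω → Prop} (B : κ → Set ι)
    (hB : ∀ a b, a ≠ b → Disjoint (B a) (B b))
    (h : ∀ a ω ω', (∀ i ∈ B a, (X i ω ↔ X i ω')) → (X' a ω ↔ X' a ω')) : IndepFam μ X' := by
  intro S T A A' hST hA hA'
  refine hX (⋃ a ∈ S, B a) (⋃ a ∈ T, B a) A A' ?_ ?_ ?_
  · rw [Set.disjoint_left]
    intro i hi hi'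
    simp only [Set.mem_iUnion, exists_prop] at hi hi'
    obtain ⟨a, ha, hia⟩ := hi
    obtain ⟨b, hb, hib⟩ := hi'
    have hab : a ≠ b := by rintro rfl; exact Set.disjoint_left.1 hST ha hb
    exact Set.disjoint_left.1 (hB a b hab) hia hib
  · intro ω ω' hω
    refine hA ω ω' fun a ha => h a ω ω' fun i hi => hω i ?_
    simp only [Set.mem_iUnion, exists_prop]; exact ⟨a, ha, hi⟩
  · intro ω ω' hω
    refine hA' ω ω' fun a ha => h a ω ω' fun i hi => hω i ?_
    simp only [Set.mem_iUnion, exists_prop]; exact ⟨a, ha, hi⟩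

lemma span_transfer {Ω Ω' α : Type*} [DecidableEq α] {s : ℕ} {X : Fin s × Sym2 α → Ω → Prop}
    {Y : Fin s × Sym2 α → Ω' → Prop} {ω : Ω} {ω' : Ω'} (h : ∀ z, X z ω → Y z ω') {S : Finset α}
    (hS : SpanG X ω S) : SpanG Y ω' S := by
  induction hS with
  | single v => exact SpanG.single v
  | step S w hS hw hadj ih =>
    refine SpanG.step S w ih hw fun i => ?_
    obtain ⟨u, hu, h1⟩ := hadj i
    exact ⟨u, hu, h _ h1⟩

lemma block_card {n k j : ℕ} (hjk : j < k) (L0 A : Finset (Fin n)) (hL : L0.card + 1 = j)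
    (hLA : Disjoint L0 A) (u v : {x // x ∈ A}) (huv : u ≠ v) :
    (n - (L0.card + A.card)).choose (k - j - 1) ≤
      (((Finset.univ : Finset (Fin n)).powersetCard k).filter
        (fun e => L0 ⊆ e ∧ ∀ x : {x // x ∈ A}, x.1 ∈ e ↔ x ∈ s(u, v))).card := by
  classical
  have h1 : (n - (L0.card + A.card)) = (L0 ∪ A)ᶜ.card := by
    rw [Finset.card_compl, Fintype.card_fin, Finset.card_union_of_disjoint hLA]
  rw [h1, ← Finset.card_powersetCard]
  have huL : u.1 ∉ L0 := Finset.disjoint_right.1 hLA u.2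
  have hvL : v.1 ∉ L0 := Finset.disjoint_right.1 hLA v.2
  have huv' : u.1 ≠ v.1 := fun h => huv (Subtype.ext h)
  set B := insert u.1 (insert v.1 L0) with hB
  have hBc : B.card = j + 1 := by
    rw [hB, Finset.card_insert_of_notMem (by simp [huL, huv']), Finset.card_insert_of_notMem hvL]; omega
  have hBs : B ⊆ L0 ∪ A := by
    intro x hx
    simp only [hB, Finset.mem_insert] at hx
    rcases hx with rfl | rfl | hx
    · simp [u.2]
    · simp [v.2]
    · simp [hx]
  have hdis : ∀ R ∈ Finset.powersetCard (k - j - 1) (L0 ∪ A)ᶜ, Disjoint B R := by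
    intro R hR
    rw [Finset.mem_powersetCard] at hR
    rw [Finset.disjoint_left]
    intro x hx hxR
    exact (Finset.mem_compl.1 (hR.1 hxR)) (hBs hx)
  refine Finset.card_le_card_of_injOn (fun R => B ∪ R) ?_ ?_
  · intro R hR
    have hd := hdis R hR
    have hR' := Finset.mem_powersetCard.1 hR
    simp only [Finset.coe_filter, Finset.mem_powersetCard, Finset.subset_univ, true_and, Set.mem_ofPred_eq]
    refine ⟨?_, ?_, ?_⟩
    · rw [Finset.card_union_of_disjoint hd, hBc, hR'.2]; omega
    · intro x hx; simp [hB, hx]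
    · intro x
      have hxR : x.1 ∉ R := fun h => (Finset.mem_compl.1 (hR'.1 h)) (by simp [x.2])
      have hxL : x.1 ∉ L0 := Finset.disjoint_right.1 hLA x.2
      simp only [Sym2.mem_iff, hB, Finset.mem_union, Finset.mem_insert, hxR, hxL, or_false]
      rw [Subtype.ext_iff, Subtype.ext_iff]
  · intro R hR R' hR' h
    have hd := hdis R hR
    have hd' := hdis R' hR'
    simp only at h
    calc R = (B ∪ R) \ B := by rw [Finset.union_sdiff_cancel_left hd]
      _ = (B ∪ R') \ B := by rw [h]
      _ = R' := by rw [Finset.union_sdiff_cancel_left hd']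

lemma one_local {n k j s : ℕ} (hjk : j < k) (p : Fin s → ℝ)
    (μ : Measure (Fin s × Finset (Fin n) → Bool)) [IsProbabilityMeasure μ]
    (hμ : IndepFam μ (fun i (ω : Fin s × Finset (Fin n) → Bool) => ω i = true))
    (hp : ∀ i, μ.real {ω | ω i = true} = p i.1) (hp01 : ∀ i, 0 ≤ p i ∧ p i ≤ 1)
    (L0 A : Finset (Fin n)) (hL : L0.card + 1 = j) (hLA : Disjoint L0 A) 
    (X : Fin s × Sym2 {x // x ∈ A} → (Fin s × Finset (Fin n) → Bool) → Prop)
    (hXdef : X = fun z ω => ∃ e ∈ ((Finset.univ : Finset (Fin n)).powersetCard k).filter (fun e => ω (z.1, e) = true),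
      L0 ⊆ e ∧ ∀ x : {x // x ∈ A}, x.1 ∈ e ↔ x ∈ z.2) :
    IndepFam μ X ∧ ∀ i u v, u ≠ v →
      min 1 (p i * ((n - (L0.card + A.card)).choose (k - j - 1) : ℕ)) / 2 ≤ μ.real {ω | X (i, s(u, v)) ω} := by
  classical
  constructor
  · refine hμ.blocks (fun z => {y | y.1 = z.1 ∧ ∀ x : {x // x ∈ A}, x.1 ∈ y.2 ↔ x ∈ z.2}) ?_ ?_
    · rintro ⟨i, z⟩ ⟨i', z'⟩ hne
      rw [Set.disjoint_left]
      rintro ⟨i'', e⟩ ⟨h1, h2⟩ ⟨h3, h4⟩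
      simp only at h1 h2 h3 h4
      apply hne
      rw [← h1, ← h3]
      congr 1
      exact Sym2.ext fun x => (h2 x).symm.trans (h4 x)
    · rintro ⟨i, z⟩ ω ω' h
      simp only [hXdef, Finset.mem_filter]
      refine exists_congr fun e => ?_
      constructor
      · rintro ⟨⟨h1, h2⟩, h3, h4⟩; exact ⟨⟨h1, (h (i, e) ⟨rfl, h4⟩).1 h2⟩, h3, h4⟩
      · rintro ⟨⟨h1, h2⟩, h3, h4⟩; exact ⟨⟨h1, (h (i, e) ⟨rfl, h4⟩).2 h2⟩, h3, h4⟩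
  · intro i u v huv
    have hm : ∀ A : Set (Fin s × Finset (Fin n) → Bool), MeasurableSet A := fun A => A.toFinite.measurableSet
    set F := ((Finset.univ : Finset (Fin n)).powersetCard k).filter
        (fun e => L0 ⊆ e ∧ ∀ x : {x // x ∈ A}, x.1 ∈ e ↔ x ∈ s(u, v)) with hF
    have hc := block_card hjk L0 A hL hLA u v huv
    have e1 : {ω | X (i, s(u, v)) ω} = (⋂ e ∈ F, {ω : Fin s × Finset (Fin n) → Bool | ω (i, e) = true}ᶜ)ᶜ := by
      ext ω
      simp only [hXdef, hF, Finset.mem_filter, Set.mem_ofPred_eq, Set.mem_compl_iff, Set.mem_iInter, not_forall, not_not, exists_prop]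
      refine exists_congr fun e => ?_
      tauto
    rw [e1, compl_real hm, hμ.prod F (fun e => {(i, e)})]
    · have e2 : ∏ e ∈ F, μ.real {ω : Fin s × Finset (Fin n) → Bool | ω (i, e) = true}ᶜ = (1 - p i) ^ F.card := by
        rw [← Finset.prod_const]
        refine Finset.prod_congr rfl fun e _ => ?_
        rw [compl_real hm, hp]
      rw [e2]
      refine le_trans ?_ (one_sub_pow_ge (p i) (hp01 i).1 (hp01 i).2 F.card)
      have := (hp01 i).1
      gcongr
    · intro a _ b _ hab
      simpa using hab
    · intro e _
      exact (Det.coord (X := fun i (ω : Fin s × Finset (Fin n) → Bool) => ω i = true) (S := {(i, e)})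
        (i, e) rfl).compl

end Red2

section Red3
open MeasureTheory

lemma choose_lower (n j d : ℕ) (hn : 4 * (j + d) + 4 ≤ n) :
    1 / (4 ^ d * (d.factorial : ℝ)) * (n:ℝ) ^ d ≤ ((n - (j - 1 + n / 2)).choose d : ℕ) := by
  have h1 := Nat.pow_le_choose (α := ℝ) d (n - (j - 1 + n / 2))
  refine le_trans ?_ h1
  have h2 : n ≤ 4 * (n - (j - 1 + n / 2) + 1 - d) := by omega
  have h2' : (n:ℝ) / 4 ≤ ((n - (j - 1 + n / 2) + 1 - d : ℕ) : ℝ) := by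
    have : (n:ℝ) ≤ 4 * ((n - (j - 1 + n / 2) + 1 - d : ℕ) : ℝ) := by exact_mod_cast h2
    linarith
  calc 1 / (4 ^ d * (d.factorial : ℝ)) * (n:ℝ) ^ d = ((n:ℝ) / 4) ^ d / d.factorial := by
        rw [div_pow]; field_simp
    _ ≤ _ := by gcongr

lemma exists_A {n : ℕ} (j : ℕ) (hn : 4 * j + 8 ≤ n) (L0 : Finset (Fin n)) (u v : Fin n) (hL : L0.card + 1 = j)
    (hu : u ∉ L0) (hv : v ∉ L0) : ∃ A : Finset (Fin n), u ∈ A ∧ v ∈ A ∧ Disjoint L0 A ∧ A.card = n / 2 := by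
  have h1 : ({u, v} : Finset (Fin n)) ⊆ L0ᶜ := by
    intro x hx; simp only [Finset.mem_insert, Finset.mem_singleton] at hx
    rcases hx with rfl | rfl <;> simpa
  have h2 : ({u, v} : Finset (Fin n)).card ≤ n / 2 := Finset.card_le_two.trans (by omega)
  obtain ⟨A, hA1, hA2, hA3⟩ := Finset.exists_subsuperset_card_eq (n := n / 2) h1 h2
    (by rw [Finset.card_compl, Fintype.card_fin]; omega)
  refine ⟨A, hA1 (by simp), hA1 (by simp), ?_, hA3⟩
  rw [Finset.disjoint_right]
  intro x hx; exact Finset.mem_compl.1 (hA2 hx)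

theorem part2_bound (k j s : ℕ) (hj : 1 ≤ j) (hjk : j < k) (hs : 2 ≤ s) :
    ∃ c : ℝ, 0 < c ∧ ∀ᶠ n : ℕ in atTop, ∀ p : Fin s → ℝ, (∀ i, 0 ≤ p i ∧ p i ≤ 1) →
      (∀ i i' : Fin s, i ≤ i' → p i ≤ p i') →
      c * Real.log n / (n : ℝ) ^ (k - j) ≤ p ⟨0, lt_of_lt_of_le Nat.zero_lt_two hs⟩ →
      (∀ r : ℕ, 2 ≤ r → r ≤ s → c / ((n : ℝ) ^ (r * (k - j - 1) + 1) * (Real.log n) ^ (r - 1)) ≤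
                ∏ i ∈ Finset.univ.filter (fun i : Fin s => (i : ℕ) < r), p i) →
      1 - 3 ^ (j + 2) / (n:ℝ) ≤ probHkS n k p fun E => JPercolatesS j E := by
  obtain ⟨K, hK, hgraph⟩ := graph_whp s hs (j + 2)
  set d := k - j - 1 with hd
  set η : ℝ := 1 / (4 ^ d * (d.factorial : ℝ)) with hη
  have hη0 : 0 < η := by positivity
  have hη1 : η ≤ 1 := by
    rw [hη, div_le_one (by positivity)]
    have h1 : (1:ℝ) ≤ 4 ^ d := one_le_pow₀ (by norm_num)
    have h2 : (1:ℝ) ≤ d.factorial := by exact_mod_cast Nat.one_le_iff_ne_zero.2 (Nat.factorial_ne_zero d)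
    nlinarith
  refine ⟨K * 3 * (4 / η) ^ s, by positivity, ?_⟩
  have hhalf : Tendsto (fun n : ℕ => n / 2) atTop atTop := Nat.tendsto_div_const_atTop (by norm_num)
  have hlog : Tendsto (fun N : ℕ => Real.log N) atTop atTop :=
    Real.tendsto_log_atTop.comp tendsto_natCast_atTop_atTop
  have ev1 := hhalf.eventually hgraph
  have ev2 := hhalf.eventually (hlog.eventually_ge_atTop 2)
  have ev3 := hhalf.eventually (ev_log_pow K 2 (by linarith))
  filter_upwards [ev1, ev2, ev3, eventually_ge_atTop (4 * (j + d) + 20)] with n g1 hL2 hKN hn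
  intro p hp01 hmono h1 h2
  set N := n / 2 with hN
  have hN3 : n ≤ 3 * N := by omega
  have hN3' : (n:ℝ) ≤ 3 * N := by exact_mod_cast hN3
  have hn0 : (0:ℝ) < n := by exact_mod_cast (by omega : 0 < n)
  have hNpos : (3:ℝ) ≤ N := by exact_mod_cast (by omega : 3 ≤ N)
  have hNn : (N:ℝ) ≤ n := by exact_mod_cast Nat.div_le_self _ _
  have hLl : Real.log N ≤ Real.log n := Real.log_le_log (by linarith) hNn
  have hlL : Real.log n ≤ 2 * Real.log N := by
    rw [two_mul, ← Real.log_mul (by linarith) (by linarith)]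
    exact Real.log_le_log hn0 (by nlinarith)
  have hkj : k - j = d + 1 := by omega
  rw [hkj] at h1
  obtain ⟨hq1, hq2⟩ := q_cond hs d p (fun i => (hp01 i).1) hmono η K _ n N (Real.log n) (Real.log N) hη0 hη1 hK hn0 hN3'
    (by linarith) hLl hlL hKN le_rfl h1 h2
  obtain ⟨μ, hμP, hμ, hp⟩ := exists_space (Fin s × Finset (Fin n)) (fun i => p i.1) (fun i => hp01 i.1)
  have hm : ∀ A : Set (Fin s × Finset (Fin n) → Bool), MeasurableSet A := fun A => A.toFinite.measurableSet
  unfold probHkS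
  rw [probMulti_eq _ p μ hμ hp]
  classical
  -- choice of A
  have hAex : ∀ y : Finset (Fin n) × Fin n × Fin n, ∃ A : Finset (Fin n),
      (y.1.card + 1 = j → y.2.1 ∉ y.1 → y.2.2 ∉ y.1 → y.2.1 ∈ A ∧ y.2.2 ∈ A ∧ Disjoint y.1 A ∧ A.card = N) := by
    intro y
    by_cases hy : y.1.card + 1 = j ∧ y.2.1 ∉ y.1 ∧ y.2.2 ∉ y.1
    · obtain ⟨A, hA⟩ := exists_A j (by omega) y.1 y.2.1 y.2.2 hy.1 hy.2.1 hy.2.2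
      exact ⟨A, fun _ _ _ => hA⟩
    · exact ⟨∅, fun h1 h2 h3 => absurd ⟨h1, h2, h3⟩ hy⟩
  choose A hA using hAex
  set X : ∀ y : Finset (Fin n) × Fin n × Fin n, Fin s × Sym2 {x // x ∈ A y} → (Fin s × Finset (Fin n) → Bool) → Prop :=
    fun y z ω => ∃ e ∈ ((Finset.univ : Finset (Fin n)).powersetCard k).filter (fun e => ω (z.1, e) = true),
      y.1 ⊆ e ∧ ∀ x : {x // x ∈ A y}, x.1 ∈ e ↔ x ∈ z.2 with hX
  set Y := ((Finset.univ : Finset (Fin n)).powersetCard (j - 1) ×ˢ (Finset.univ : Finset (Fin n × Fin n))).filter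
    (fun y => y.2.1 ∉ y.1 ∧ y.2.2 ∉ y.1) with hY
  have hYc : Y.card ≤ n ^ (j + 1) := by
    refine (Finset.card_filter_le _ _).trans ?_
    rw [Finset.card_product, Finset.card_powersetCard, Finset.card_univ, Finset.card_univ, Fintype.card_prod, Fintype.card_fin]
    calc n.choose (j - 1) * (n * n) ≤ n ^ (j - 1) * (n * n) := Nat.mul_le_mul_right _ (Nat.choose_le_pow _ _)
      _ = n ^ (j - 1 + 2) := by ring
      _ = n ^ (j + 1) := by congr 1; omega
  have hbad : ∀ y ∈ Y, μ.real {ω | ¬ SpanG (X y) ω Finset.univ} ≤ ((N:ℝ) ^ (j + 2))⁻¹ := by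
    intro y hy
    simp only [hY, Finset.mem_filter, Finset.mem_product, Finset.mem_powersetCard, Finset.subset_univ, true_and,
      Finset.mem_univ, and_true] at hy
    obtain ⟨hy1, hy2, hy3⟩ := hy
    have hyj : y.1.card + 1 = j := by omega
    obtain ⟨-, -, hd1, hcA⟩ := hA y hyj hy2 hy3
    obtain ⟨hind, hpr⟩ := one_local hjk p μ hμ hp hp01 y.1 (A y) hyj hd1 (X y) rfl
    refine g1 _ _ μ (X y) (fun i => min (η * p i * (n:ℝ) ^ d / 2) (1 / Real.log N)) hm hind (by simp [hcA]) hq1 hq2 ?_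
    intro i u v huv
    refine le_trans ?_ (hpr i u v huv)
    rw [hy1, hcA]
    have hD := choose_lower n j d (by omega)
    have h5 : 1 / Real.log N ≤ 1 / 2 := one_div_le_one_div_of_le (by norm_num) hL2
    have h6 : η * (n:ℝ) ^ d * p i ≤ ((n - (j - 1 + N)).choose d : ℕ) * p i :=
      mul_le_mul_of_nonneg_right hD (hp01 i).1
    rcases le_total (1:ℝ) (p i * ((n - (j - 1 + N)).choose (k - j - 1) : ℕ)) with h7 | h7
    · rw [min_eq_left h7]; exact (min_le_right _ _).trans h5
    · rw [min_eq_right h7]; refine (min_le_left _ _).trans ?_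
      linarith
  set G : Set (Fin s × Finset (Fin n) → Bool) := {ω | JPercolatesS j fun i =>
    ((Finset.univ : Finset (Fin n)).powersetCard k).filter fun e => ω (i, e) = true} with hG
  have hsub : Gᶜ ⊆ ⋃ y ∈ Y, {ω | ¬ SpanG (X y) ω Finset.univ} := by
    intro ω hω
    by_contra hc
    apply hω
    simp only [Set.mem_iUnion, not_exists, exists_prop, not_and, Set.mem_ofPred_eq, not_not] at hc
    refine percolates_of_span hj (by simp; omega) _ ?_
    intro L0 u v hL hu hv huv
    have hy := hc (L0, u, v) (by simp [hY, Finset.mem_powersetCard, hu, hv]; omega)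
    obtain ⟨a1, a2, a3, -⟩ := hA (L0, u, v) hL hu hv
    refine ⟨A (L0, u, v), a1, a2, a3, ?_⟩
    refine span_transfer (X := X (L0, u, v)) (ω := ω) (fun z hz => ?_) ?_
    · exact hz
    · convert hy
  have hfin : μ.real Gᶜ ≤ 3 ^ (j + 2) / (n:ℝ) := by
    calc μ.real Gᶜ ≤ μ.real (⋃ y ∈ Y, {ω | ¬ SpanG (X y) ω Finset.univ}) :=
          measureReal_mono hsub (measure_ne_top _ _)
      _ ≤ ∑ y ∈ Y, μ.real {ω | ¬ SpanG (X y) ω Finset.univ} := measureReal_biUnion_finset_le _ _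
      _ ≤ ∑ y ∈ Y, ((N:ℝ) ^ (j + 2))⁻¹ := Finset.sum_le_sum hbad
      _ = Y.card * ((N:ℝ) ^ (j + 2))⁻¹ := by simp
      _ ≤ (n:ℝ) ^ (j + 1) * (((n:ℝ) / 3) ^ (j + 2))⁻¹ := by
          have : (Y.card : ℝ) ≤ (n:ℝ) ^ (j+1) := by exact_mod_cast hYc
          gcongr; linarith
      _ = _ := by rw [div_pow, pow_succ (n:ℝ) (j+1)]; field_simp
  rw [compl_real hm] at hfin
  linarith

end Red3

section Sub
variable {V : Type*} [DecidableEq V]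

def CutC (E : Finset (Finset V)) (C : Finset (Finset V)) : Prop :=
  ∀ S ⊆ C, S.Nonempty → S ≠ C → ∃ J ∈ S, ∃ J' ∈ C, J' ∉ S ∧ ∃ e ∈ E, J ∪ J' ⊆ e

lemma CutC.single (E : Finset (Finset V)) (J : Finset V) : CutC E {J} := by
  intro S hS hne hn
  exact absurd ((Finset.subset_singleton_iff.1 hS).resolve_left hne.ne_empty) hn

lemma CutC.union {E : Finset (Finset V)} {C C' : Finset (Finset V)} (h : CutC E C) (h' : CutC E C')
    (hm : ∃ J1 ∈ C, ∃ J1' ∈ C', ∃ e ∈ E, J1 ∪ J1' ⊆ e) : CutC E (C ∪ C') := by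
  intro S hS hne hn
  by_cases h1 : (S ∩ C).Nonempty ∧ S ∩ C ≠ C
  · obtain ⟨J, hJ, J', hJ', hJS, e, he, hee⟩ := h (S ∩ C) Finset.inter_subset_right h1.1 h1.2
    rw [Finset.mem_inter] at hJ hJS
    exact ⟨J, hJ.1, J', Finset.mem_union_left _ hJ', fun hh => hJS ⟨hh, hJ'⟩, e, he, hee⟩
  by_cases h2 : (S ∩ C').Nonempty ∧ S ∩ C' ≠ C'
  · obtain ⟨J, hJ, J', hJ', hJS, e, he, hee⟩ := h' (S ∩ C') Finset.inter_subset_right h2.1 h2.2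
    rw [Finset.mem_inter] at hJ hJS
    exact ⟨J, hJ.1, J', Finset.mem_union_right _ hJ', fun hh => hJS ⟨hh, hJ'⟩, e, he, hee⟩
  have d1 : S ∩ C = ∅ ∨ S ∩ C = C := by
    by_cases hh : S ∩ C = ∅
    · exact Or.inl hh
    · right; by_contra hc; exact h1 ⟨Finset.nonempty_iff_ne_empty.2 hh, hc⟩
  have d2 : S ∩ C' = ∅ ∨ S ∩ C' = C' := by
    by_cases hh : S ∩ C' = ∅
    · exact Or.inl hh
    · right; by_contra hc; exact h2 ⟨Finset.nonempty_iff_ne_empty.2 hh, hc⟩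
  obtain ⟨J1, hJ1, J1', hJ1', e, he, hee⟩ := hm
  have hSu : S = (S ∩ C) ∪ (S ∩ C') := by
    rw [← Finset.inter_union_distrib_left]; exact (Finset.inter_eq_left.2 hS).symm
  rcases d1 with d1 | d1 <;> rcases d2 with d2 | d2
  · rw [d1, d2] at hSu; simp at hSu; exact absurd hSu hne.ne_empty
  · have a1 : J1' ∈ S := (Finset.inter_eq_right.1 d2) hJ1'
    have a2 : J1 ∉ S := fun hh => by
      have : J1 ∈ S ∩ C := Finset.mem_inter.2 ⟨hh, hJ1⟩
      rw [d1] at this; simp at this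
    exact ⟨J1', a1, J1, Finset.mem_union_left _ hJ1, a2, e, he, by rwa [Finset.union_comm]⟩
  · have a1 : J1 ∈ S := (Finset.inter_eq_right.1 d1) hJ1
    have a2 : J1' ∉ S := fun hh => by
      have : J1' ∈ S ∩ C' := Finset.mem_inter.2 ⟨hh, hJ1'⟩
      rw [d2] at this; simp at this
    exact ⟨J1, a1, J1', Finset.mem_union_right _ hJ1', a2, e, he, hee⟩
  · rw [d1, d2] at hSu; exact absurd hSu hn

lemma reach_good {s : ℕ} {E : Fin s → Finset (Finset V)} {J0 : Finset (Finset V)} {t : ℕ} (ht : 2 ≤ t)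
    {P : Finset (Finset (Finset V))}
    (h : Relation.ReflTransGen (MergeStepS E) (J0.image fun J => ({J} : Finset (Finset V))) P) :
    (∃ C ⊆ J0, t ≤ C.card ∧ C.card ≤ 2 * t ∧ ∀ i, CutC (E i) C) ∨
      ∀ D ∈ P, D ⊆ J0 ∧ D.card < t ∧ ∀ i, CutC (E i) D := by
  induction h with
  | refl =>
    right
    intro D hD
    obtain ⟨J, hJ, rfl⟩ := Finset.mem_image.1 hD
    exact ⟨by simpa using hJ, by simp; omega, fun i => CutC.single _ _⟩
  | tail h1 h2 ih =>
    rcases ih with ih | ih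
    · exact Or.inl ih
    obtain ⟨C, hC, C', hC', hne, hm, rfl⟩ := h2
    obtain ⟨a1, a2, a3⟩ := ih C hC
    obtain ⟨b1, b2, b3⟩ := ih C' hC'
    have hg : ∀ i, CutC (E i) (C ∪ C') := fun i => (a3 i).union (b3 i) (hm i)
    have hcard := Finset.card_union_le C C'
    by_cases hc : t ≤ (C ∪ C').card
    · left; exact ⟨C ∪ C', Finset.union_subset a1 b1, hc, by omega, hg⟩
    · right
      intro D hD
      rw [Finset.mem_insert] at hD
      rcases hD with rfl | hD
      · exact ⟨Finset.union_subset a1 b1, by omega, hg⟩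
      · exact ih D (Finset.mem_of_mem_erase (Finset.mem_of_mem_erase hD))

lemma perc_good {s : ℕ} {E : Fin s → Finset (Finset V)} {J0 : Finset (Finset V)} {t : ℕ} (ht : 2 ≤ t)
    (htJ : t ≤ J0.card) (h : PercolatesOnS J0 E) :
    ∃ C ⊆ J0, t ≤ C.card ∧ C.card ≤ 2 * t ∧ ∀ i, CutC (E i) C := by
  rcases reach_good ht h with h | h
  · exact h
  · have := (h J0 (by simp)).2.1; omega

/-- inductive connectivity of an edge family -/
inductive ConnI (j : ℕ) : Finset (Finset V) → Prop
  | single (e : Finset V) : ConnI j {e}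
  | step (F : Finset (Finset V)) (e f : Finset V) : ConnI j F → f ∈ F → j ≤ (e ∩ f).card →
      ConnI j (insert e F)

lemma ConnI.nonempty {j : ℕ} {F : Finset (Finset V)} (h : ConnI j F) : F.Nonempty := by
  cases h <;> simp

lemma ConnI.cut {j : ℕ} {F : Finset (Finset V)} (h : ConnI j F) :
    ∀ S ⊆ F, S.Nonempty → S ≠ F → ∃ f ∈ S, ∃ u ∈ F, u ∉ S ∧ j ≤ (f ∩ u).card := by
  induction h with
  | single e =>
    intro S hS hne hn
    exact absurd ((Finset.subset_singleton_iff.1 hS).resolve_left hne.ne_empty) hn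
  | step F e f hF hf hj ih =>
    intro S hS hne hn
    by_cases h0 : (S ∩ F).Nonempty
    · by_cases h1 : S ∩ F = F
      · have hFS : F ⊆ S := Finset.inter_eq_right.1 h1
        have he : e ∉ S := fun hh => hn (Finset.Subset.antisymm hS (Finset.insert_subset hh hFS))
        exact ⟨f, hFS hf, e, by simp, he, by rwa [Finset.inter_comm]⟩
      · obtain ⟨g, hg, u, hu, huS, hgu⟩ := ih (S ∩ F) Finset.inter_subset_right h0 h1
        rw [Finset.mem_inter] at hg huS
        exact ⟨g, hg.1, u, by simp [hu], fun hh => huS ⟨hh, hu⟩, hgu⟩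
    · have hd : ∀ x ∈ S, x ∉ F := fun x hx hxF => h0 ⟨x, Finset.mem_inter.2 ⟨hx, hxF⟩⟩
      obtain ⟨x, hx⟩ := hne
      have hxe : x = e := by
        have := hS hx; rw [Finset.mem_insert] at this
        exact this.resolve_right (hd x hx)
      subst hxe
      exact ⟨x, hx, f, by simp [hf], fun hh => hd f hh hf, hj⟩

/-- structure extracted from one colour -/
def Struct (E C F : Finset (Finset V)) (ψ par : Finset V → Finset V) : Prop :=
  F ⊆ E ∧ Set.InjOn ψ F ∧ ∀ f ∈ F, ψ f ∈ C ∧ par f ∈ C ∧ ψ f ≠ par f ∧ ψ f ∪ par f ⊆ f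

lemma struct_step {j : ℕ} {E C F : Finset (Finset V)} {ψ par : Finset V → Finset V}
    (hCj : ∀ J ∈ C, J.card = j)
    (h : Struct E C F ψ par) {J J' e : Finset V} (hJ : J ∈ C) (hJ' : J' ∈ C) (hne : J ≠ J')
    (hnew : ∀ f ∈ F, ¬ J' ⊆ f) (he : e ∈ E) (hee : J ∪ J' ⊆ e) :
    ∃ ψ' par', Struct E C (insert e F) ψ' par' := by
  have heF : e ∉ F := fun hh => hnew e hh (Finset.union_subset_right hee)
  refine ⟨Function.update ψ e J', Function.update par e J, Finset.insert_subset he h.1, ?_, ?_⟩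
  · intro x hx y hy hxy
    rw [Finset.mem_coe, Finset.mem_insert] at hx hy
    have key : ∀ z ∈ F, ψ z ≠ J' := by
      intro z hz hh
      exact hnew z hz (hh ▸ Finset.union_subset_left (h.2.2 z hz).2.2.2)
    have hF : ∀ z ∈ F, z ≠ e := fun z hz hh => heF (hh ▸ hz)
    rcases hx with rfl | hx <;> rcases hy with rfl | hy
    · rfl
    · rw [Function.update_self, Function.update_of_ne (hF y hy)] at hxy
      exact absurd hxy.symm (key y hy)
    · rw [Function.update_self, Function.update_of_ne (hF x hx)] at hxy
      exact absurd hxy (key x hx)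
    · rw [Function.update_of_ne (hF x hx), Function.update_of_ne (hF y hy)] at hxy
      exact h.2.1 hx hy hxy
  · intro f hf
    rw [Finset.mem_insert] at hf
    rcases hf with rfl | hf
    · rw [Function.update_self, Function.update_self]
      exact ⟨hJ', hJ, hne.symm, by rwa [Finset.union_comm]⟩
    · have : f ≠ e := fun hh => heF (hh ▸ hf)
      rw [Function.update_of_ne this, Function.update_of_ne this]
      exact h.2.2 f hf

lemma exists_struct {j : ℕ} {E C : Finset (Finset V)} (hCj : ∀ J ∈ C, J.card = j) (hC2 : 2 ≤ C.card)
    (hcut : CutC E C) :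
    ∃ F ψ par, Struct E C F ψ par ∧ ConnI j F ∧ ∀ J ∈ C, ∃ f ∈ F, J ⊆ f := by
  -- m steps
  have key : ∀ m : ℕ, m ≤ C.card → ∃ F ψ par, Struct E C F ψ par ∧ ConnI j F ∧
      m ≤ (C.filter fun J => ∃ f ∈ F, J ⊆ f).card := by
    intro m
    induction m with
    | zero =>
      intro _
      obtain ⟨J, hJ⟩ : C.Nonempty := Finset.card_pos.1 (by omega)
      obtain ⟨J1, hJ1, J', hJ', hn, e, he, hee⟩ := hcut {J} (by simpa using hJ) (by simp) (by
        intro hh; rw [← hh] at hC2; simp at hC2)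
      rw [Finset.mem_singleton] at hJ1 hn
      subst hJ1
      obtain ⟨ψ, par, h⟩ := struct_step (F := ∅) (ψ := id) (par := id) hCj
        ⟨by simp, by simp, by simp⟩ hJ hJ' (Ne.symm hn) (by simp) he hee
      exact ⟨insert e ∅, ψ, par, h, ConnI.single e, by simp⟩
    | succ m ih =>
      intro hm
      obtain ⟨F, ψ, par, h1, h2, h3⟩ := ih (by omega)
      set D := C.filter fun J => ∃ f ∈ F, J ⊆ f with hD
      by_cases hDC : D = C
      · exact ⟨F, ψ, par, h1, h2, by rw [← hD, hDC]; exact hm⟩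
      have hDne : D.Nonempty := by
        obtain ⟨f, hf⟩ := h2.nonempty
        obtain ⟨a1, a2, a3, a4⟩ := h1.2.2 f hf
        exact ⟨ψ f, Finset.mem_filter.2 ⟨a1, f, hf, Finset.union_subset_left a4⟩⟩
      obtain ⟨J, hJ, J', hJ', hn, e, he, hee⟩ := hcut D (Finset.filter_subset _ _) hDne hDC
      have hJ2 := Finset.mem_filter.1 hJ
      obtain ⟨hJC, f, hf, hJf⟩ := hJ2
      have hnew : ∀ f ∈ F, ¬ J' ⊆ f := fun g hg hh => hn (Finset.mem_filter.2 ⟨hJ', g, hg, hh⟩)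
      obtain ⟨ψ', par', h⟩ := struct_step hCj h1 hJC hJ' (fun hh => hn (hh ▸ hJ)) hnew he hee
      refine ⟨insert e F, ψ', par', h, ConnI.step F e f h2 hf ?_, ?_⟩
      · rw [← hCj J hJC]
        exact Finset.card_le_card (Finset.subset_inter (Finset.union_subset_left hee) hJf)
      · have hsub : insert J' D ⊆ C.filter fun J => ∃ f ∈ insert e F, J ⊆ f := by
          intro x hx
          rw [Finset.mem_insert] at hx
          rcases hx with rfl | hx
          · exact Finset.mem_filter.2 ⟨hJ', e, by simp, Finset.union_subset_right hee⟩
          · obtain ⟨q1, g, q2, q3⟩ := Finset.mem_filter.1 hx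
            exact Finset.mem_filter.2 ⟨q1, g, by simp [q2], q3⟩
        have := Finset.card_le_card hsub
        rw [Finset.card_insert_of_notMem hn] at this
        omega
  obtain ⟨F, ψ, par, h1, h2, h3⟩ := key C.card le_rfl
  refine ⟨F, ψ, par, h1, h2, ?_⟩
  have : C.filter (fun J => ∃ f ∈ F, J ⊆ f) = C := Finset.eq_of_subset_of_card_le (Finset.filter_subset _ _) h3
  intro J hJ
  rw [← this] at hJ
  exact (Finset.mem_filter.1 hJ).2

/-- partial structure with exactly `a` edges -/
def QS (E C : Finset (Finset V)) (a : ℕ) : Prop :=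
  ∃ C' ∈ C.powersetCard a, ∃ h : {J // J ∈ C'} → Finset V × Finset V,
    Function.Injective (fun J => (h J).2) ∧
    ∀ J, (h J).1 ∈ C ∧ J.1 ≠ (h J).1 ∧ J.1 ∪ (h J).1 ⊆ (h J).2 ∧ (h J).2 ∈ E

lemma Struct.qs {E C F : Finset (Finset V)} {ψ par : Finset V → Finset V}
    (h : Struct E C F ψ par) {a : ℕ} (ha : a ≤ F.card) : QS E C a := by
  obtain ⟨F', hF', hc⟩ := Finset.exists_subset_card_eq ha
  have hinj : Set.InjOn ψ F' := h.2.1.mono (by exact_mod_cast hF')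
  have hex : ∀ J : {J // J ∈ F'.image ψ}, ∃ f ∈ F', ψ f = J.1 := fun J => Finset.mem_image.1 J.2
  choose g hg1 hg2 using hex
  refine ⟨F'.image ψ, ?_, fun J => (par (g J), g J), ?_, ?_⟩
  · rw [Finset.mem_powersetCard, Finset.card_image_of_injOn hinj]
    refine ⟨?_, hc⟩
    intro x hx
    obtain ⟨f, hf, rfl⟩ := Finset.mem_image.1 hx
    exact (h.2.2 f (hF' hf)).1
  · intro x y hxy
    simp only at hxy
    apply Subtype.ext
    rw [← hg2 x, ← hg2 y, hxy]
  · intro J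
    obtain ⟨a1, a2, a3, a4⟩ := h.2.2 (g J) (hF' (hg1 J))
    rw [hg2 J] at a1 a3 a4
    exact ⟨a2, a3, a4, h.1 (hF' (hg1 J))⟩

lemma Struct.card_le {E C F : Finset (Finset V)} {ψ par : Finset V → Finset V}
    (h : Struct E C F ψ par) : F.card ≤ C.card :=
  Finset.card_le_card_of_injOn ψ (fun f hf => (h.2.2 f hf).1) h.2.1

lemma shadow_card {F C : Finset (Finset V)} {j k : ℕ} (hF : ∀ f ∈ F, f.card = k) (hCj : ∀ J ∈ C, J.card = j)
    (hsh : ∀ J ∈ C, ∃ f ∈ F, J ⊆ f) :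
    C ⊆ F.biUnion (fun f => f.powersetCard j) ∧ (F.biUnion (fun f => f.powersetCard j)).card ≤ k.choose j * F.card := by
  constructor
  · intro J hJ
    obtain ⟨f, hf, hJf⟩ := hsh J hJ
    exact Finset.mem_biUnion.2 ⟨f, hf, Finset.mem_powersetCard.2 ⟨hJf, hCj J hJ⟩⟩
  · rw [mul_comm]
    refine Finset.card_biUnion_le_card_mul _ _ _ fun f hf => ?_
    rw [Finset.card_powersetCard, hF f hf]

/-- deterministic summary -/
lemma perc_struct [Fintype V] {s : ℕ} {k j t r : ℕ} (hr : 1 ≤ r) (hrs : r ≤ s) (ht : 2 ≤ t)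
    (htJ : t ≤ (Fintype.card V).choose j)
    {E : Fin s → Finset (Finset V)} (hE : ∀ i, ∀ e ∈ E i, e.card = k) (h : JPercolatesS j E) :
    ∃ b : Fin s, (b:ℕ) < r ∧ ∃ a, a ≤ 2 * t ∧ t ≤ k.choose j * a ∧
      ∃ F, F.card = a ∧ (∀ f ∈ F, f.card = k) ∧ ConnI j F ∧ F ⊆ E b ∧
      ∃ C ⊆ F.biUnion (fun f => f.powersetCard j), C.card ≤ 2 * t ∧
        ∀ i : Fin s, (i:ℕ) < r → i ≠ b → QS (E i) C a := by
  obtain ⟨C, hC, h1, h2, h3⟩ := perc_good ht (by simpa using htJ) h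
  have hCj : ∀ J ∈ C, J.card = j := fun J hJ => (Finset.mem_powersetCard.1 (hC hJ)).2
  choose F ψ par g1 g2 g3 using fun i => exists_struct hCj (by omega) (h3 i)
  obtain ⟨b, hb, hmin⟩ := Finset.exists_min_image (Finset.univ.filter fun i : Fin s => (i:ℕ) < r) (fun i => (F i).card)
    ⟨⟨0, by omega⟩, by simp; omega⟩
  simp only [Finset.mem_filter, Finset.mem_univ, true_and] at hb hmin
  have hFk : ∀ f ∈ F b, f.card = k := fun f hf => hE b f ((g1 b).1 hf)
  obtain ⟨s1, s2⟩ := shadow_card hFk hCj (g3 b)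
  refine ⟨b, hb, (F b).card, (g1 b).card_le.trans h2, ?_, F b, rfl, hFk, g2 b, (g1 b).1, C, s1, h2, ?_⟩
  · exact (h1.trans (Finset.card_le_card s1)).trans s2
  · intro i hi _
    exact (g1 i).qs (hmin i hi)

end Sub

section Cnt
variable {W : Type*} [DecidableEq W] [Fintype W]

open scoped Classical in
/-- branching count of connected sets -/
lemma conn_count (R : W → W → Prop) (Δ a : ℕ) (hΔ : ∀ v, (Finset.univ.filter fun u => R v u).card ≤ Δ)
    (q : ℝ) (hq0 : 0 ≤ q) (hq1 : q ≤ 1) (Fam : Finset (Finset W)) (hcard : ∀ F ∈ Fam, F.card = a)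
    (hcut : ∀ F ∈ Fam, ∀ S ⊆ F, S.Nonempty → S ≠ F → ∃ f ∈ S, ∃ u ∈ F, u ∉ S ∧ R f u) :
    ∀ (m : ℕ) (S X : Finset W), (a - S.card) + (Δ * a - X.card) = m → S.Nonempty → S.card ≤ a →
      X ⊆ (S.biUnion fun v => Finset.univ.filter fun u => R v u) →
      ((Fam.filter fun F => S ⊆ F ∧ Disjoint X F).card : ℝ) * (q ^ (a - S.card) * (1 - q) ^ (Δ * a - X.card)) ≤ 1 := by
  intro m
  induction m using Nat.strong_induction_on with
  | _ m ih =>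
  intro S X hm hS hSa hX
  have hq' : 0 ≤ 1 - q := by linarith
  have hXc : ∀ (S X : Finset W), S.card ≤ a → X ⊆ (S.biUnion fun v => Finset.univ.filter fun u => R v u) →
      X.card ≤ Δ * a := by
    intro S X hSa hX
    calc X.card ≤ _ := Finset.card_le_card hX
      _ ≤ S.card * Δ := Finset.card_biUnion_le_card_mul _ _ _ fun v _ => hΔ v
      _ ≤ Δ * a := by rw [mul_comm]; exact Nat.mul_le_mul_left _ hSa
  have hw1 : ∀ x y : ℕ, q ^ x * (1 - q) ^ y ≤ 1 := fun x y =>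
    mul_le_one₀ (pow_le_one₀ hq0 hq1) (pow_nonneg hq' _) (pow_le_one₀ hq' (by linarith))
  by_cases hex : ∃ F ∈ Fam, (S ⊆ F ∧ Disjoint X F) ∧ S ≠ F
  · obtain ⟨F, hF, ⟨hSF, hXF⟩, hne⟩ := hex
    obtain ⟨f, hf, u, hu, huS, hR⟩ := hcut F hF S hSF hS hne
    have huX : u ∉ X := fun hh => Finset.disjoint_left.1 hXF hh hu
    have hlt : S.card < a := by
      rw [← hcard F hF]; exact Finset.card_lt_card (Finset.ssubset_iff_subset_ne.2 ⟨hSF, hne⟩)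
    have hX2 : insert u X ⊆ (S.biUnion fun v => Finset.univ.filter fun u => R v u) := by
      refine Finset.insert_subset (Finset.mem_biUnion.2 ⟨f, hf, by simpa using hR⟩) hX
    have c1 : (insert u S).card = S.card + 1 := Finset.card_insert_of_notMem huS
    have c2 : (insert u X).card = X.card + 1 := Finset.card_insert_of_notMem huX
    have c3 := hXc S _ hSa hX2
    have i1 := ih _ (by rw [← hm, c1]; omega) (insert u S) X rfl (by simp) (by omega)
      (hX.trans (Finset.biUnion_subset_biUnion_of_subset_left _ (Finset.subset_insert _ _)))
    have i2 := ih _ (by rw [← hm, c2]; omega) S (insert u X) rfl hS hSa hX2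
    have hsplit : (Fam.filter fun F => S ⊆ F ∧ Disjoint X F).card ≤
        (Fam.filter fun F => insert u S ⊆ F ∧ Disjoint X F).card +
        (Fam.filter fun F => S ⊆ F ∧ Disjoint (insert u X) F).card := by
      refine le_trans (Finset.card_le_card ?_) (Finset.card_union_le _ _)
      intro G hG
      simp only [Finset.mem_filter, Finset.mem_union] at hG ⊢
      obtain ⟨g1, g2, g3⟩ := hG
      by_cases huG : u ∈ G
      · left; exact ⟨g1, Finset.insert_subset huG g2, g3⟩
      · right; exact ⟨g1, g2, Finset.disjoint_insert_left.2 ⟨huG, g3⟩⟩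
    have hsplit' : ((Fam.filter fun F => S ⊆ F ∧ Disjoint X F).card : ℝ) ≤
        (Fam.filter fun F => insert u S ⊆ F ∧ Disjoint X F).card +
        (Fam.filter fun F => S ⊆ F ∧ Disjoint (insert u X) F).card := by exact_mod_cast hsplit
    have e1 : a - S.card = (a - (insert u S).card) + 1 := by omega
    have e2 : Δ * a - X.card = (Δ * a - (insert u X).card) + 1 := by omega
    have hw0 : 0 ≤ q ^ (a - S.card) * (1 - q) ^ (Δ * a - X.card) := by positivity
    calc _ ≤ _ := mul_le_mul_of_nonneg_right hsplit' hw0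
      _ = q * (((Fam.filter fun F => insert u S ⊆ F ∧ Disjoint X F).card : ℝ) * (q ^ (a - (insert u S).card) * (1 - q) ^ (Δ * a - X.card)))
        + (1 - q) * (((Fam.filter fun F => S ⊆ F ∧ Disjoint (insert u X) F).card : ℝ) * (q ^ (a - S.card) * (1 - q) ^ (Δ * a - (insert u X).card))) := by
          rw [add_mul]
          congr 1
          · rw [e1, pow_succ]; ring
          · rw [e2, pow_succ]; ring
      _ ≤ q * 1 + (1 - q) * 1 := by gcongr
      _ = 1 := by ring
  · have : (Fam.filter fun F => S ⊆ F ∧ Disjoint X F).card ≤ 1 := by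
      rw [Finset.card_le_one]
      intro F hF G hG
      push Not at hex
      rw [Finset.mem_filter] at hF hG
      rw [← hex F hF.1 hF.2, hex G hG.1 hG.2]
    have h' : ((Fam.filter fun F => S ⊆ F ∧ Disjoint X F).card : ℝ) ≤ 1 := by exact_mod_cast this
    exact mul_le_one₀ h' (mul_nonneg (pow_nonneg hq0 _) (pow_nonneg hq' _)) (hw1 _ _)

open scoped Classical in
lemma conn_count' (R : W → W → Prop) (Δ a : ℕ) (hΔ1 : 1 ≤ Δ) (ha : 1 ≤ a) (hΔ : ∀ v, (Finset.univ.filter fun u => R v u).card ≤ Δ)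
    (Fam : Finset (Finset W)) (hcard : ∀ F ∈ Fam, F.card = a)
    (hcut : ∀ F ∈ Fam, ∀ S ⊆ F, S.Nonempty → S ≠ F → ∃ f ∈ S, ∃ u ∈ F, u ∉ S ∧ R f u) (v : W) :
    ((Fam.filter fun F => v ∈ F).card : ℝ) ≤ (2 * Δ : ℝ) ^ (a - 1) * 3 ^ a := by
  have hD : (1:ℝ) ≤ Δ := by exact_mod_cast hΔ1
  have h := conn_count R Δ a hΔ (1 / (Δ + 1 : ℝ)) (by positivity) (by rw [div_le_one (by positivity)]; linarith) Fam hcard hcut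
    _ {v} ∅ rfl (by simp) (by simpa using ha) (by simp)
  have e : (Fam.filter fun F => ({v} : Finset W) ⊆ F ∧ Disjoint ∅ F) = Fam.filter fun F => v ∈ F := by
    apply Finset.filter_congr; intro F _; simp
  rw [e] at h
  simp only [Finset.card_singleton, Finset.card_empty, Nat.sub_zero] at h
  have e2 : (1 - 1 / (Δ + 1 : ℝ)) = (1 + 1 / (Δ:ℝ))⁻¹ := by field_simp; ring
  rw [e2, one_div, inv_pow, inv_pow, ← mul_inv, mul_inv_le_iff₀ (by positivity), one_mul] at h
  refine h.trans ?_
  have h3 : (1 + 1 / (Δ:ℝ)) ^ (Δ * a) ≤ 3 ^ a := by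
    rw [pow_mul]
    refine pow_le_pow_left₀ (by positivity) ?_ a
    have h4 : 1 + 1 / (Δ:ℝ) ≤ Real.exp (1 / (Δ:ℝ)) := by linarith [Real.add_one_le_exp (1 / (Δ:ℝ))]
    calc (1 + 1 / (Δ:ℝ)) ^ Δ ≤ (Real.exp (1 / (Δ:ℝ))) ^ Δ := pow_le_pow_left₀ (by positivity) h4 _
      _ = Real.exp 1 := by rw [← Real.exp_nat_mul]; congr 1; field_simp
      _ ≤ 3 := by linarith [Real.exp_one_lt_d9]
  have h5 : (Δ + 1 : ℝ) ≤ 2 * Δ := by linarith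
  gcongr

lemma card_super {n : ℕ} (k m : ℕ) (U : Finset (Fin n)) (hU : m ≤ U.card) :
    ((Finset.univ.powersetCard k).filter fun e : Finset (Fin n) => U ⊆ e).card ≤ n ^ (k - m) := by
  obtain ⟨U', hU', hc⟩ := Finset.exists_subset_card_eq hU
  calc _ ≤ ((Finset.univ : Finset (Fin n)).powersetCard (k - m)).card := by
        refine Finset.card_le_card_of_injOn (fun e => e \ U') ?_ ?_
        · intro e he
          rw [Finset.mem_coe, Finset.mem_filter, Finset.mem_powersetCard] at he
          rw [Finset.mem_coe, Finset.mem_powersetCard, Finset.card_sdiff_of_subset (hU'.trans he.2), he.1.2, hc]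
          exact ⟨Finset.subset_univ _, rfl⟩
        · intro e he f hf hef
          rw [Finset.mem_coe, Finset.mem_filter] at he hf
          simp only at hef
          rw [← Finset.sdiff_union_of_subset (hU'.trans he.2), hef, Finset.sdiff_union_of_subset (hU'.trans hf.2)]
    _ ≤ n ^ (k - m) := by
        rw [Finset.card_powersetCard, Finset.card_univ, Fintype.card_fin]; exact Nat.choose_le_pow _ _

open scoped Classical in
/-- number of connected families of k-sets -/
lemma fam_count {n k j a : ℕ} (hn : 1 ≤ n) (hjk : j < k) (ha : 1 ≤ a) :
    ((((Finset.univ : Finset (Fin n)).powersetCard k).powersetCard a).filter (fun F => ConnI j F)).card ≤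
      (n:ℝ) ^ j * (6 * k.choose j * (n:ℝ) ^ (k - j)) ^ a := by
  set K := (Finset.univ : Finset (Fin n)).powersetCard k with hK
  set Fam := (K.powersetCard a).filter (fun F => ConnI j F) with hFam
  set R : Finset (Fin n) → Finset (Fin n) → Prop := fun f u => f ∈ K ∧ u ∈ K ∧ j ≤ (f ∩ u).card with hR
  have hκ : 1 ≤ k.choose j := Nat.choose_pos hjk.le
  have hΔ : ∀ v, (Finset.univ.filter fun u => R v u).card ≤ k.choose j * n ^ (k - j) := by
    intro v
    by_cases hv : v ∈ K
    · have hvc : v.card = k := (Finset.mem_powersetCard.1 hv).2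
      calc _ ≤ ((v.powersetCard j).biUnion fun J => K.filter fun e => J ⊆ e).card := by
            apply Finset.card_le_card
            intro u hu
            simp only [hR, Finset.mem_filter, Finset.mem_univ, true_and] at hu
            obtain ⟨J, hJ, hJc⟩ := Finset.exists_subset_card_eq hu.2.2
            refine Finset.mem_biUnion.2 ⟨J, Finset.mem_powersetCard.2 ⟨hJ.trans Finset.inter_subset_left, hJc⟩, ?_⟩
            exact Finset.mem_filter.2 ⟨hu.2.1, hJ.trans Finset.inter_subset_right⟩
        _ ≤ (v.powersetCard j).card * n ^ (k - j) := by
            refine Finset.card_biUnion_le_card_mul _ _ _ fun J hJ => ?_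
            exact card_super k j J (Finset.mem_powersetCard.1 hJ).2.ge
        _ = _ := by rw [Finset.card_powersetCard, hvc]
    · have : (Finset.univ.filter fun u => R v u) = ∅ := by
        apply Finset.filter_eq_empty_iff.2; intro u _ h; exact hv h.1
      rw [this]; simp
  have hmem : ∀ F ∈ Fam, F ⊆ K ∧ F.card = a ∧ ConnI j F := by
    intro F hF
    rw [hFam, Finset.mem_filter, Finset.mem_powersetCard] at hF
    exact ⟨hF.1.1, hF.1.2, hF.2⟩
  have hcut : ∀ F ∈ Fam, ∀ S ⊆ F, S.Nonempty → S ≠ F → ∃ f ∈ S, ∃ u ∈ F, u ∉ S ∧ R f u := by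
    intro F hF S hS hne hn
    obtain ⟨g1, g2, g3⟩ := hmem F hF
    obtain ⟨f, hf, u, hu, huS, hh⟩ := g3.cut S hS hne hn
    exact ⟨f, hf, u, hu, huS, g1 (hS hf), g1 hu, hh⟩
  have hv : ∀ v, ((Fam.filter fun F => v ∈ F).card : ℝ) ≤
      (2 * ((k.choose j * n ^ (k - j) : ℕ) : ℝ)) ^ (a - 1) * 3 ^ a := by
    intro v
    have := conn_count' R (k.choose j * n ^ (k - j)) a (Nat.mul_pos hκ (pow_pos hn _)) ha
      (fun v => by convert hΔ v) Fam (fun F hF => (hmem F hF).2.1) hcut v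
    convert this
  have hcov : Fam ⊆ K.biUnion fun v => Fam.filter fun F => v ∈ F := by
    intro F hF
    obtain ⟨g1, g2, g3⟩ := hmem F hF
    obtain ⟨v, hvF⟩ := g3.nonempty
    exact Finset.mem_biUnion.2 ⟨v, g1 hvF, Finset.mem_filter.2 ⟨hF, hvF⟩⟩
  have h1 : (Fam.card : ℝ) ≤ ∑ v ∈ K, ((Fam.filter fun F => v ∈ F).card : ℝ) := by
    exact_mod_cast (Finset.card_le_card hcov).trans Finset.card_biUnion_le
  have hKc : (K.card : ℝ) ≤ (n:ℝ) ^ k := by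
    rw [hK, Finset.card_powersetCard, Finset.card_univ, Fintype.card_fin]; exact_mod_cast Nat.choose_le_pow _ _
  have hκ' : (1:ℝ) ≤ k.choose j := by exact_mod_cast hκ
  have hn' : (1:ℝ) ≤ n := by exact_mod_cast hn
  obtain ⟨b, rfl⟩ : ∃ b, a = b + 1 := ⟨a - 1, by omega⟩
  calc (Fam.card : ℝ) ≤ ∑ v ∈ K, (2 * ((k.choose j * n ^ (k - j) : ℕ) : ℝ)) ^ (b + 1 - 1) * 3 ^ (b + 1) :=
        h1.trans (Finset.sum_le_sum fun v _ => hv v)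
    _ = K.card * ((2 * ((k.choose j * n ^ (k - j) : ℕ) : ℝ)) ^ (b + 1 - 1) * 3 ^ (b + 1)) := by simp
    _ ≤ (n:ℝ) ^ k * ((2 * ((k.choose j * n ^ (k - j) : ℕ) : ℝ)) ^ (b + 1 - 1) * 3 ^ (b + 1)) := by gcongr
    _ = (n:ℝ) ^ j * (n:ℝ) ^ (k - j) * ((2 * (k.choose j * (n:ℝ) ^ (k - j))) ^ b * 3 ^ (b + 1)) := by
        rw [← pow_add, Nat.add_sub_cancel]; push_cast; congr 2; omega
    _ ≤ (n:ℝ) ^ j * (2 * (k.choose j * (n:ℝ) ^ (k - j))) * ((2 * (k.choose j * (n:ℝ) ^ (k - j))) ^ b * 3 ^ (b + 1)) := by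
        have : (0:ℝ) ≤ (n:ℝ) ^ (k - j) := by positivity
        gcongr; nlinarith
    _ = (n:ℝ) ^ j * ((2 * (k.choose j * (n:ℝ) ^ (k - j))) ^ (b + 1) * 3 ^ (b + 1)) := by ring
    _ = _ := by rw [← mul_pow]; ring
end Cnt

section PrS
open MeasureTheory
variable {n k j s : ℕ} {p : Fin s → ℝ} {μ : Measure (Fin s × Finset (Fin n) → Bool)} [IsProbabilityMeasure μ]

/-- the edges of colour `i` -/
def EdG (k : ℕ) (ω : Fin s × Finset (Fin n) → Bool) (i : Fin s) : Finset (Finset (Fin n)) :=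
  ((Finset.univ : Finset (Fin n)).powersetCard k).filter fun e => ω (i, e) = true

lemma prob_all (hμ : IndepFam μ (fun i (ω : Fin s × Finset (Fin n) → Bool) => ω i = true))
    (hp : ∀ i, μ.real {ω | ω i = true} = p i.1) (i : Fin s) (F : Finset (Finset (Fin n))) :
    μ.real {ω | ∀ e ∈ F, ω (i, e) = true} = p i ^ F.card := by
  have h := hμ.prod F (fun e => {(i, e)}) (fun e => {ω | ω (i, e) = true})
    (by intro a _ b _ hab; simpa using hab) (by intro a _; exact Det.coord (X := fun i (ω : Fin s × Finset (Fin n) → Bool) => ω i = true) (i, a) (by simp))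
  have e : {ω : Fin s × Finset (Fin n) → Bool | ∀ e ∈ F, ω (i, e) = true} = ⋂ e ∈ F, {ω | ω (i, e) = true} := by
    ext ω; simp
  rw [e, h]; simp [hp]

lemma EdG_congr {ω ω' : Fin s × Finset (Fin n) → Bool} {i : Fin s}
    (h : ∀ z ∈ {z : Fin s × Finset (Fin n) | z.1 = i}, (ω z = true ↔ ω' z = true)) : EdG k ω i = EdG k ω' i := by
  unfold EdG
  apply Finset.filter_congr
  intro e _
  exact h (i, e) rfl

lemma prob_QS (hjk : j < k) (hμ : IndepFam μ (fun i (ω : Fin s × Finset (Fin n) → Bool) => ω i = true))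
    (hp : ∀ i, μ.real {ω | ω i = true} = p i.1) (hp0 : ∀ i, 0 ≤ p i) (i : Fin s) (C : Finset (Finset (Fin n)))
    (hC : ∀ J ∈ C, J.card = j) (a : ℕ) :
    μ.real {ω | QS (EdG k ω i) C a} ≤ 2 ^ C.card * ((C.card * (n:ℝ) ^ (k - j - 1)) * p i) ^ a := by
  classical
  set K := (Finset.univ : Finset (Fin n)).powersetCard k with hK
  set opt : Finset (Fin n) → Finset (Finset (Fin n) × Finset (Fin n)) :=
    fun J => (C ×ˢ K).filter fun z => J ≠ z.1 ∧ J ∪ z.1 ⊆ z.2 with hopt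
  have hoc : ∀ J ∈ C, (opt J).card ≤ C.card * n ^ (k - j - 1) := by
    intro J hJ
    have hsub : opt J ⊆ (C.filter fun J' => J ≠ J').biUnion fun J' => (K.filter fun e => J ∪ J' ⊆ e).image fun e => (J', e) := by
      intro z hz
      simp only [hopt, Finset.mem_filter, Finset.mem_product] at hz
      refine Finset.mem_biUnion.2 ⟨z.1, Finset.mem_filter.2 ⟨hz.1.1, hz.2.1⟩, Finset.mem_image.2 ⟨z.2, ?_, rfl⟩⟩
      exact Finset.mem_filter.2 ⟨hz.1.2, hz.2.2⟩
    refine (Finset.card_le_card hsub).trans ?_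
    refine (Finset.card_biUnion_le_card_mul _ _ (n ^ (k - j - 1)) ?_).trans (Nat.mul_le_mul_right _ (Finset.card_filter_le _ _))
    intro J' hJ'
    rw [Finset.mem_filter] at hJ'
    refine Finset.card_image_le.trans ?_
    rw [Nat.sub_sub]
    refine card_super k (j + 1) _ ?_
    have h1 : J ⊂ J ∪ J' := by
      rw [Finset.ssubset_iff_subset_ne]
      refine ⟨Finset.subset_union_left, fun hh => hJ'.2 ?_⟩
      have : J' ⊆ J := by rw [hh]; exact Finset.subset_union_right
      exact (Finset.eq_of_subset_of_card_le this (by rw [hC J hJ, hC J' hJ'.1])).symm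
    have := Finset.card_lt_card h1
    rw [hC J hJ] at this; omega
  have hsub : {ω | QS (EdG k ω i) C a} ⊆ ⋃ C' ∈ C.powersetCard a,
      ⋃ h ∈ (Fintype.piFinset fun J : {J // J ∈ C'} => opt J.1).filter (fun h => Function.Injective fun J => (h J).2),
        {ω | ∀ e ∈ Finset.univ.image (fun J => (h J).2), ω (i, e) = true} := by
    rintro ω ⟨C', hC', h, hinj, hh⟩
    simp only [Set.mem_iUnion]
    have hE : ∀ J, (h J).2 ∈ K ∧ ω (i, (h J).2) = true := fun J => by
      have := (hh J).2.2.2; unfold EdG at this; exact Finset.mem_filter.1 this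
    refine ⟨C', hC', h, Finset.mem_filter.2 ⟨Fintype.mem_piFinset.2 fun J => ?_, hinj⟩, ?_⟩
    · simp only [hopt, Finset.mem_filter, Finset.mem_product]
      exact ⟨⟨(hh J).1, (hE J).1⟩, (hh J).2.1, (hh J).2.2.1⟩
    · intro e he
      obtain ⟨J, -, rfl⟩ := Finset.mem_image.1 he
      exact (hE J).2
  have hB : ∀ C' ∈ C.powersetCard a, μ.real (⋃ h ∈ (Fintype.piFinset fun J : {J // J ∈ C'} => opt J.1).filter (fun h => Function.Injective fun J => (h J).2),
        {ω : Fin s × Finset (Fin n) → Bool | ∀ e ∈ Finset.univ.image (fun J => (h J).2), ω (i, e) = true}) ≤ ((C.card * (n:ℝ) ^ (k - j - 1)) * p i) ^ a := by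
    intro C' hC'
    rw [Finset.mem_powersetCard] at hC'
    refine (measureReal_biUnion_finset_le _ _).trans ?_
    calc _ ≤ ∑ h ∈ (Fintype.piFinset fun J : {J // J ∈ C'} => opt J.1).filter (fun h => Function.Injective fun J => (h J).2), p i ^ a := by
          refine Finset.sum_le_sum fun h hh => ?_
          rw [Finset.mem_filter] at hh
          rw [prob_all hμ hp, Finset.card_image_of_injective _ hh.2, Finset.card_univ, Fintype.card_coe, hC'.2]
      _ = ((Fintype.piFinset fun J : {J // J ∈ C'} => opt J.1).filter (fun h => Function.Injective fun J => (h J).2)).card * p i ^ a := by simp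
      _ ≤ ((C.card * n ^ (k - j - 1)) ^ a : ℕ) * p i ^ a := by
          refine mul_le_mul_of_nonneg_right ?_ (pow_nonneg (hp0 i) _)
          rw [Nat.cast_le]
          refine (Finset.card_filter_le _ _).trans ?_
          rw [Fintype.card_piFinset]
          calc ∏ J : {J // J ∈ C'}, (opt J.1).card ≤ ∏ J : {J // J ∈ C'}, (C.card * n ^ (k - j - 1)) :=
                Finset.prod_le_prod' fun J _ => hoc J.1 (hC'.1 J.2)
            _ = _ := by simp [hC'.2]
      _ = _ := by push_cast; rw [← mul_pow]
  calc _ ≤ _ := measureReal_mono hsub (measure_ne_top _ _)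
    _ ≤ _ := measureReal_biUnion_finset_le _ _
    _ ≤ ∑ C' ∈ C.powersetCard a, ((C.card * (n:ℝ) ^ (k - j - 1)) * p i) ^ a := Finset.sum_le_sum hB
    _ = ((C.powersetCard a).card : ℝ) * ((C.card * (n:ℝ) ^ (k - j - 1)) * p i) ^ a := by simp
    _ ≤ _ := by
        refine mul_le_mul_of_nonneg_right ?_ (pow_nonneg (mul_nonneg (by positivity) (hp0 i)) _)
        rw [Finset.card_powersetCard]
        exact_mod_cast Nat.choose_le_two_pow _ _

open scoped Classical in
lemma term_bound (hjk : j < k) (hμ : IndepFam μ (fun i (ω : Fin s × Finset (Fin n) → Bool) => ω i = true))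
    (hp : ∀ i, μ.real {ω | ω i = true} = p i.1) (hp0 : ∀ i, 0 ≤ p i) (R : Finset (Fin s)) (b : Fin s) (hb : b ∈ R)
    (F C : Finset (Finset (Fin n))) (hC : ∀ J ∈ C, J.card = j) (a t : ℕ) (hF : F.card = a) (hCt : C.card ≤ 2 * t) :
    μ.real ({ω | F ⊆ EdG k ω b} ∩ ⋂ i ∈ R.erase b, {ω | QS (EdG k ω i) C a}) ≤
      2 ^ (2 * t * (R.card - 1)) * ((2 * t * (n:ℝ) ^ (k - j - 1)) ^ (R.card - 1) * ∏ i ∈ R, p i) ^ a := by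
  have hd : ∀ i, Det (fun i (ω : Fin s × Finset (Fin n) → Bool) => ω i = true) {z | z.1 = i} {ω | QS (EdG k ω i) C a} := by
    intro i ω ω' hh hq
    rw [Set.mem_ofPred_eq] at hq ⊢
    rwa [← EdG_congr (k := k) hh]
  have hdb : Det (fun i (ω : Fin s × Finset (Fin n) → Bool) => ω i = true) {z | z.1 = b} {ω | F ⊆ EdG k ω b} := by
    intro ω ω' hh hq
    rw [Set.mem_ofPred_eq] at hq ⊢
    rwa [← EdG_congr (k := k) hh]
  have hdisj : ∀ x y : Fin s, x ≠ y → Disjoint {z : Fin s × Finset (Fin n) | z.1 = x} {z | z.1 = y} := by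
    intro x y hxy
    rw [Set.disjoint_left]; intro z hz hz'
    exact hxy (hz.symm.trans hz')
  have hsplit := hμ.prod R (fun i => {z | z.1 = i}) (fun i => if i = b then {ω | F ⊆ EdG k ω b} else {ω | QS (EdG k ω i) C a})
    (fun x _ y _ hxy => hdisj x y hxy) (by
      intro i _
      by_cases hib : i = b
      · subst hib; simpa using hdb
      · simpa [hib] using hd i)
  have hset : ({ω | F ⊆ EdG k ω b} ∩ ⋂ i ∈ R.erase b, {ω | QS (EdG k ω i) C a}) =
      ⋂ i ∈ R, (if i = b then {ω | F ⊆ EdG k ω b} else {ω | QS (EdG k ω i) C a}) := by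
    ext ω
    simp only [Set.mem_inter_iff, Set.mem_iInter, Finset.mem_erase]
    constructor
    · rintro ⟨h1, h2⟩ i hi
      by_cases hib : i = b
      · subst hib; simpa using h1
      · simpa [hib] using h2 i ⟨hib, hi⟩
    · intro h
      refine ⟨by simpa using h b hb, fun i hi => by simpa [hi.1] using h i hi.2⟩
  rw [hset, hsplit, ← Finset.mul_prod_erase R _ hb, if_pos rfl]
  have h1 : μ.real {ω | F ⊆ EdG k ω b} ≤ p b ^ a := by
    rw [← hF, ← prob_all hμ hp b F]
    refine measureReal_mono ?_ (measure_ne_top _ _)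
    intro ω hω e he
    exact (Finset.mem_filter.1 (hω he)).2
  have h2 : ∏ x ∈ R.erase b, μ.real (if x = b then {ω | F ⊆ EdG k ω b} else {ω | QS (EdG k ω x) C a}) ≤
      ∏ x ∈ R.erase b, (2 ^ (2 * t) * ((2 * t * (n:ℝ) ^ (k - j - 1)) * p x) ^ a) := by
    refine Finset.prod_le_prod (fun _ _ => measureReal_nonneg) fun x hx => ?_
    rw [if_neg (Finset.ne_of_mem_erase hx)]
    refine (prob_QS hjk hμ hp hp0 x C hC a).trans ?_
    have hCt' : (C.card : ℝ) ≤ 2 * t := by exact_mod_cast hCt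
    have := hp0 x
    gcongr
    norm_num
  calc _ ≤ p b ^ a * ∏ x ∈ R.erase b, (2 ^ (2 * t) * ((2 * t * (n:ℝ) ^ (k - j - 1)) * p x) ^ a) :=
        mul_le_mul h1 h2 (Finset.prod_nonneg fun _ _ => measureReal_nonneg) (pow_nonneg (hp0 b) _)
    _ = _ := by
        rw [Finset.prod_mul_distrib, Finset.prod_const, Finset.prod_pow, Finset.prod_mul_distrib, Finset.prod_const,
          Finset.card_erase_of_mem hb, ← Finset.mul_prod_erase R p hb, mul_pow, mul_pow, mul_pow, ← pow_mul]
        ring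

open scoped Classical in
lemma sub_bound (hn : 1 ≤ n) (hjk : j < k) (hμ : IndepFam μ (fun i (ω : Fin s × Finset (Fin n) → Bool) => ω i = true))
    (hp : ∀ i, μ.real {ω | ω i = true} = p i.1) (hp0 : ∀ i, 0 ≤ p i) (r t : ℕ) (hr : 1 ≤ r) (hrs : r ≤ s) (ht : 2 ≤ t)
    (htJ : t ≤ n.choose j) :
    μ.real {ω | JPercolatesS j (EdG k ω)} ≤
      ∑ b ∈ Finset.univ.filter (fun i : Fin s => (i:ℕ) < r),
        ∑ a ∈ (Finset.range (2 * t + 1)).filter (fun a => t ≤ k.choose j * a),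
          (n:ℝ) ^ j * 2 ^ (2 * t * (r - 1)) * (6 * k.choose j * 2 ^ (k.choose j) * (n:ℝ) ^ (k - j) *
            ((2 * t * (n:ℝ) ^ (k - j - 1)) ^ (r - 1) * ∏ i ∈ Finset.univ.filter (fun i : Fin s => (i:ℕ) < r), p i)) ^ a := by
  set R := Finset.univ.filter (fun i : Fin s => (i:ℕ) < r) with hR
  have hRc : R.card = r := card_filter_lt s r hrs
  set K := (Finset.univ : Finset (Fin n)).powersetCard k with hK
  set Fam : ℕ → Finset (Finset (Finset (Fin n))) := fun a => (K.powersetCard a).filter (fun F => ConnI j F) with hFam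
  set Cs : Finset (Finset (Fin n)) → Finset (Finset (Finset (Fin n))) :=
    fun F => (F.biUnion (fun f => f.powersetCard j)).powerset.filter fun C => C.card ≤ 2 * t with hCs
  set κ := k.choose j with hκ
  set T : ℝ := (2 * t * (n:ℝ) ^ (k - j - 1)) ^ (r - 1) * ∏ i ∈ R, p i with hT
  have hT0 : 0 ≤ T := mul_nonneg (by positivity) (Finset.prod_nonneg fun i _ => hp0 i)
  have hsub : {ω | JPercolatesS j (EdG k ω)} ⊆ ⋃ b ∈ R, ⋃ a ∈ (Finset.range (2 * t + 1)).filter (fun a => t ≤ κ * a),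
      ⋃ F ∈ Fam a, ⋃ C ∈ Cs F, ({ω | F ⊆ EdG k ω b} ∩ ⋂ i ∈ R.erase b, {ω | QS (EdG k ω i) C a}) := by
    intro ω hω
    have hE : ∀ i, ∀ e ∈ EdG k ω i, e.card = k := fun i e he =>
      (Finset.mem_powersetCard.1 (Finset.mem_filter.1 he).1).2
    obtain ⟨b, hb, a, ha1, ha2, F, hF1, hF2, hF3, hF4, C, hC1, hC2, hC3⟩ :=
      perc_struct hr hrs ht (by simpa using htJ) hE hω
    simp only [Set.mem_iUnion]
    refine ⟨b, by simp [hR, hb], a, Finset.mem_filter.2 ⟨by simp; omega, ha2⟩, F, ?_, C, ?_, hF4, ?_⟩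
    · refine Finset.mem_filter.2 ⟨Finset.mem_powersetCard.2 ⟨fun f hf => ?_, hF1⟩, hF3⟩
      exact Finset.mem_powersetCard.2 ⟨Finset.subset_univ _, hF2 f hf⟩
    · exact Finset.mem_filter.2 ⟨Finset.mem_powerset.2 hC1, hC2⟩
    · simp only [Set.mem_iInter]
      intro i hi
      rw [Finset.mem_erase, hR, Finset.mem_filter] at hi
      exact hC3 i hi.2.2 hi.1
  refine (measureReal_mono hsub (measure_ne_top _ _)).trans ?_
  refine (measureReal_biUnion_finset_le _ _).trans (Finset.sum_le_sum fun b hb => ?_)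
  refine (measureReal_biUnion_finset_le _ _).trans (Finset.sum_le_sum fun a ha => ?_)
  rw [Finset.mem_filter] at ha
  have ha1 : 1 ≤ a := by
    rcases Nat.eq_zero_or_pos a with h0 | h0
    · rw [h0, mul_zero] at ha; omega
    · exact h0
  refine (measureReal_biUnion_finset_le _ _).trans ?_
  have hFb : ∀ F ∈ Fam a, μ.real (⋃ C ∈ Cs F, ({ω | F ⊆ EdG k ω b} ∩ ⋂ i ∈ R.erase b, {ω | QS (EdG k ω i) C a})) ≤
      (2 ^ κ) ^ a * (2 ^ (2 * t * (r - 1)) * T ^ a) := by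
    intro F hF
    rw [hFam, Finset.mem_filter, Finset.mem_powersetCard] at hF
    obtain ⟨⟨g1, g2⟩, g3⟩ := hF
    have hFk : ∀ f ∈ F, f.card = k := fun f hf => (Finset.mem_powersetCard.1 (g1 hf)).2
    refine (measureReal_biUnion_finset_le _ _).trans ?_
    calc _ ≤ ∑ C ∈ Cs F, (2 ^ (2 * t * (r - 1)) * T ^ a : ℝ) := by
          refine Finset.sum_le_sum fun C hC => ?_
          rw [hCs, Finset.mem_filter, Finset.mem_powerset] at hC
          have hCj : ∀ J ∈ C, J.card = j := by
            intro J hJ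
            obtain ⟨f, -, hf⟩ := Finset.mem_biUnion.1 (hC.1 hJ)
            exact (Finset.mem_powersetCard.1 hf).2
          have := term_bound hjk hμ hp hp0 R b hb F C hCj a t g2 hC.2
          rw [hRc] at this
          exact this
      _ = ((Cs F).card : ℝ) * (2 ^ (2 * t * (r - 1)) * T ^ a : ℝ) := by simp
      _ ≤ _ := by
          refine mul_le_mul_of_nonneg_right ?_ (by positivity)
          have h1 : (Cs F).card ≤ 2 ^ (κ * a) := by
            refine (Finset.card_filter_le _ _).trans ?_
            rw [Finset.card_powerset]
            refine Nat.pow_le_pow_right (by norm_num) ?_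
            rw [← g2]
            exact (shadow_card (C := ∅) hFk (by simp) (by simp)).2
          rw [← pow_mul]; exact_mod_cast h1
  calc _ ≤ ∑ F ∈ Fam a, ((2 ^ κ) ^ a * (2 ^ (2 * t * (r - 1)) * T ^ a) : ℝ) := Finset.sum_le_sum hFb
    _ = ((Fam a).card : ℝ) * ((2 ^ κ) ^ a * (2 ^ (2 * t * (r - 1)) * T ^ a)) := by simp
    _ ≤ ((n:ℝ) ^ j * (6 * κ * (n:ℝ) ^ (k - j)) ^ a) * ((2 ^ κ) ^ a * (2 ^ (2 * t * (r - 1)) * T ^ a)) := by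
        refine mul_le_mul_of_nonneg_right ?_ (by positivity)
        exact fam_count hn hjk ha1
    _ = _ := by
        rw [show (6 * (κ:ℝ) * 2 ^ κ * (n:ℝ) ^ (k - j) * T) = (6 * κ * (n:ℝ) ^ (k - j)) * 2 ^ κ * T by ring, mul_pow, mul_pow]
        ring
end PrS

section Num1b
open MeasureTheory

lemma choose_ge_lin (m j : ℕ) : m + 1 ≤ (m + (j + 1)).choose (j + 1) := by
  induction j with
  | zero => simp
  | succ j ih =>
    rw [show m + (j + 1 + 1) = (m + (j + 1)) + 1 by ring, Nat.choose_succ_succ]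
    omega

theorem part1b_bound (k j s : ℕ) (hj : 1 ≤ j) (hjk : j < k) :
    ∃ c : ℝ, 0 < c ∧ ∀ᶠ n : ℕ in atTop, ∀ p : Fin s → ℝ, (∀ i, 0 ≤ p i ∧ p i ≤ 1) →
      ∀ r : ℕ, 2 ≤ r → r ≤ s → (∏ i ∈ Finset.univ.filter (fun i : Fin s => (i : ℕ) < r), p i) ≤
                1 / (c * (n : ℝ) ^ (r * (k - j - 1) + 1) * (Real.log n) ^ (r - 1)) →
      probHkS n k p (fun E => JPercolatesS j E) ≤ 1 / n := by
  set κ := k.choose j with hκ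
  set θ : ℝ := Real.exp (-((κ:ℝ) * (j + 2 * s + 2))) with hθ
  have hθ0 : 0 < θ := Real.exp_pos _
  have hκ1 : 1 ≤ κ := Nat.choose_pos hjk.le
  have hκ' : (1:ℝ) ≤ κ := by exact_mod_cast hκ1
  refine ⟨6 * κ * 2 ^ κ * 4 ^ s / θ, by positivity, ?_⟩
  have hlog : Tendsto (fun N : ℕ => Real.log N) atTop atTop :=
    Real.tendsto_log_atTop.comp tendsto_natCast_atTop_atTop
  filter_upwards [hlog.eventually_ge_atTop 2, ev_log_pow (5 * s + 1) 1 (by positivity), ev_log_pow (2 * j + 4) 1 (by positivity),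
    eventually_ge_atTop (2 * j + 4)] with n hL hn1 hn2 hn
  intro p hp01 r hr hrs hprod
  rw [pow_one] at hn1 hn2
  set L := Real.log n with hLdef
  set t := ⌈L⌉₊ with ht
  have htL : L ≤ t := Nat.le_ceil L
  have htU : (t:ℝ) ≤ 2 * L := by
    have := Nat.ceil_lt_add_one (by linarith : 0 ≤ L); linarith
  have ht2 : 2 ≤ t := by exact_mod_cast hL.trans htL
  have hn0 : (0:ℝ) < n := by exact_mod_cast (by omega : 0 < n)
  have htJ : t ≤ n.choose j := by
    have h1 : t ≤ n - j + 1 := by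
      have h2 : (2 * t + 2 * j : ℝ) ≤ 2 * n := by
        have : (2 * (j:ℝ) + 4) ≤ n := by exact_mod_cast hn
        have hj0 : (0:ℝ) ≤ j := by positivity
        nlinarith
      have h3 : 2 * t + 2 * j ≤ 2 * n := by exact_mod_cast h2
      omega
    have h4 := choose_ge_lin (n - j) (j - 1)
    rw [show n - j + (j - 1 + 1) = n by omega, show j - 1 + 1 = j by omega] at h4
    omega
  obtain ⟨μ, hμP, hμ, hp⟩ := exists_space (Fin s × Finset (Fin n)) (fun i => p i.1) (fun i => hp01 i.1)
  unfold probHkS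
  rw [probMulti_eq _ p μ hμ hp]
  have hb := sub_bound (by omega : 1 ≤ n) hjk hμ hp (fun i => (hp01 i).1) r t (by omega) hrs ht2 htJ
  refine le_trans hb ?_
  set Pi0 := ∏ i ∈ Finset.univ.filter (fun i : Fin s => (i : ℕ) < r), p i with hPi
  have hPi0 : 0 ≤ Pi0 := Finset.prod_nonneg fun i _ => (hp01 i).1
  set d := k - j - 1 with hd
  have hkj : k - j = d + 1 := by omega
  have hL0 : 0 < L := by linarith
  have hbase : 6 * κ * 2 ^ κ * (n:ℝ) ^ (k - j) * ((2 * t * (n:ℝ) ^ d) ^ (r - 1) * Pi0) ≤ θ := by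
    obtain ⟨r', rfl⟩ : ∃ r', r = r' + 1 := ⟨r - 1, by omega⟩
    rw [hkj]
    simp only [Nat.add_sub_cancel] at hprod ⊢
    calc _ ≤ 6 * κ * 2 ^ κ * (n:ℝ) ^ (d + 1) * ((2 * (2 * L) * (n:ℝ) ^ d) ^ r' *
          (1 / ((6 * κ * 2 ^ κ * 4 ^ s / θ) * (n : ℝ) ^ ((r' + 1) * d + 1) * L ^ r'))) := by gcongr
      _ = (4:ℝ) ^ r' / 4 ^ s * θ := by
          rw [show 2 * (2 * L) * (n:ℝ) ^ d = 4 * L * (n:ℝ) ^ d by ring, mul_pow, mul_pow, ← pow_mul,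
            show (r' + 1) * d + 1 = (d + 1) + d * r' by ring, pow_add (n:ℝ) (d + 1)]
          field_simp
      _ ≤ 1 * θ := by
          refine mul_le_mul_of_nonneg_right ?_ hθ0.le
          rw [div_le_one (by positivity)]
          exact pow_le_pow_right₀ (by norm_num) (by omega)
      _ = θ := one_mul θ
  have hbase0 : 0 ≤ 6 * κ * 2 ^ κ * (n:ℝ) ^ (k - j) * ((2 * t * (n:ℝ) ^ d) ^ (r - 1) * Pi0) := by positivity
  have hterm : ∀ a ∈ (Finset.range (2 * t + 1)).filter (fun a => t ≤ κ * a),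
      (n:ℝ) ^ j * 2 ^ (2 * t * (r - 1)) * (6 * κ * 2 ^ κ * (n:ℝ) ^ (k - j) * ((2 * t * (n:ℝ) ^ d) ^ (r - 1) * Pi0)) ^ a
        ≤ ((n:ℝ) ^ 2)⁻¹ := by
    intro a ha
    rw [Finset.mem_filter] at ha
    have hat : (t:ℝ) ≤ κ * a := by exact_mod_cast ha.2
    have h1 : (6 * κ * 2 ^ κ * (n:ℝ) ^ (k - j) * ((2 * t * (n:ℝ) ^ d) ^ (r - 1) * Pi0)) ^ a ≤ Real.exp (-((j + 2 * s + 2) * t)) := by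
      calc _ ≤ θ ^ a := pow_le_pow_left₀ hbase0 hbase a
        _ = Real.exp (-((j + 2 * s + 2) * (κ * a))) := by
            rw [hθ, ← Real.exp_nat_mul]; congr 1; ring
        _ ≤ _ := by
            apply Real.exp_le_exp.2
            have : (0:ℝ) ≤ j + 2 * s + 2 := by positivity
            nlinarith
    have h2 : (2:ℝ) ^ (2 * t * (r - 1)) ≤ Real.exp (2 * s * t) := by
      calc (2:ℝ) ^ (2 * t * (r - 1)) ≤ 2 ^ (2 * s * t) := by
            apply pow_le_pow_right₀ (by norm_num)
            have : r - 1 ≤ s := by omega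
            nlinarith
        _ ≤ (Real.exp 1) ^ (2 * s * t) := pow_le_pow_left₀ (by norm_num) (by linarith [Real.exp_one_gt_d9]) _
        _ = _ := by rw [← Real.exp_nat_mul]; push_cast; simp
    have h3 : (n:ℝ) = Real.exp L := (Real.exp_log hn0).symm
    calc _ ≤ (n:ℝ) ^ j * Real.exp (2 * s * t) * Real.exp (-((j + 2 * s + 2) * t)) := by gcongr
      _ = Real.exp (j * L + (2 * s * t + -((j + 2 * s + 2) * t))) := by
          rw [mul_assoc, ← Real.exp_add, Real.exp_add (j * L), Real.exp_nat_mul, ← h3]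
      _ ≤ Real.exp (-(2 * L)) := by
          apply Real.exp_le_exp.2
          have hj0 : (0:ℝ) ≤ j := by positivity
          nlinarith
      _ = _ := by rw [Real.exp_neg]; congr 1; rw [show (2:ℝ) * L = (2:ℕ) * L by norm_num, Real.exp_nat_mul, ← h3]
  calc _ ≤ ∑ b ∈ Finset.univ.filter (fun i : Fin s => (i:ℕ) < r),
        ∑ a ∈ (Finset.range (2 * t + 1)).filter (fun a => t ≤ κ * a), ((n:ℝ) ^ 2)⁻¹ :=
        Finset.sum_le_sum fun b _ => Finset.sum_le_sum hterm
    _ = r * ((((Finset.range (2 * t + 1)).filter (fun a => t ≤ κ * a)).card : ℝ) * ((n:ℝ) ^ 2)⁻¹) := by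
        rw [Finset.sum_const, Finset.sum_const, card_filter_lt s r hrs, nsmul_eq_mul, nsmul_eq_mul]
    _ ≤ s * ((2 * t + 1) * ((n:ℝ) ^ 2)⁻¹) := by
        have h1 : (r:ℝ) ≤ s := by exact_mod_cast hrs
        have h2 : (((Finset.range (2 * t + 1)).filter (fun a => t ≤ κ * a)).card : ℝ) ≤ 2 * t + 1 := by
          have h3 : ((Finset.range (2 * t + 1)).filter (fun a => t ≤ κ * a)).card ≤ 2 * t + 1 :=
            (Finset.card_filter_le _ _).trans (by simp)
          calc _ ≤ ((2 * t + 1 : ℕ) : ℝ) := Nat.cast_le.2 h3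
            _ = _ := by push_cast; ring
        exact mul_le_mul h1 (mul_le_mul_of_nonneg_right h2 (by positivity)) (mul_nonneg (Nat.cast_nonneg _) (by positivity)) (by positivity)
    _ ≤ n * ((n:ℝ) ^ 2)⁻¹ := by
        rw [← mul_assoc]
        refine mul_le_mul_of_nonneg_right ?_ (by positivity)
        have hs0 : (0:ℝ) ≤ s := by positivity
        have h6 : (s:ℝ) * (2 * t + 1) ≤ s * (5 * L) := mul_le_mul_of_nonneg_left (by linarith) hs0
        linarith
    _ = 1 / n := by field_simp
end Num1b

section Iso
open MeasureTheory

lemma not_perc_of_iso {V : Type*} [DecidableEq V] {s : ℕ} {E : Fin s → Finset (Finset V)} {J0 : Finset (Finset V)}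
    (h2 : 2 ≤ J0.card) {J : Finset V} (hJ : J ∈ J0) (i : Fin s) (hiso : ∀ e ∈ E i, ¬ J ⊆ e) : ¬ PercolatesOnS J0 E := by
  intro h
  have key : ∀ P, Relation.ReflTransGen (MergeStepS E) (J0.image fun J => ({J} : Finset (Finset V))) P →
      ({J} : Finset (Finset V)) ∈ P := by
    intro P hP
    induction hP with
    | refl => exact Finset.mem_image.2 ⟨J, hJ, rfl⟩
    | tail h1 h2 ih =>
      obtain ⟨C, hC, C', hC', hne, hm, rfl⟩ := h2
      obtain ⟨J1, hJ1, J1', hJ1', e, he, hee⟩ := hm i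
      have n1 : ({J} : Finset (Finset V)) ≠ C := by
        rintro rfl
        rw [Finset.mem_singleton] at hJ1; subst hJ1
        exact hiso e he (Finset.union_subset_left hee)
      have n2 : ({J} : Finset (Finset V)) ≠ C' := by
        rintro rfl
        rw [Finset.mem_singleton] at hJ1'; subst hJ1'
        exact hiso e he (Finset.union_subset_right hee)
      exact Finset.mem_insert_of_mem (Finset.mem_erase.2 ⟨n2, Finset.mem_erase.2 ⟨n1, ih⟩⟩)
  have := key _ h
  rw [Finset.mem_singleton] at this
  rw [← this] at h2; simp at h2

lemma prob_none {n s : ℕ} {p : Fin s → ℝ} {μ : Measure (Fin s × Finset (Fin n) → Bool)} [IsProbabilityMeasure μ]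
    (hμ : IndepFam μ (fun i (ω : Fin s × Finset (Fin n) → Bool) => ω i = true))
    (hp : ∀ i, μ.real {ω | ω i = true} = p i.1) (i : Fin s) (F : Finset (Finset (Fin n))) :
    μ.real {ω | ∃ e ∈ F, ω (i, e) = true} = 1 - (1 - p i) ^ F.card := by
  have hm : ∀ A : Set (Fin s × Finset (Fin n) → Bool), MeasurableSet A := fun A => A.toFinite.measurableSet
  have h := hμ.prod F (fun e => {(i, e)}) (fun e => {ω | ω (i, e) = true}ᶜ)
    (by intro a _ b _ hab; simpa using hab) (by intro a _; exact (Det.coord (X := fun i (ω : Fin s × Finset (Fin n) → Bool) => ω i = true) (i, a) (by simp)).compl)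
  have e : {ω : Fin s × Finset (Fin n) → Bool | ∃ e ∈ F, ω (i, e) = true} = (⋂ e ∈ F, {ω | ω (i, e) = true}ᶜ)ᶜ := by
    ext ω; simp
  rw [e, compl_real hm, h]
  simp only [compl_real hm, hp, Finset.prod_const]

def Blk (n j a : ℕ) : Finset (Fin n) := Finset.univ.filter fun x : Fin n => (x:ℕ) / j = a

lemma Blk_card {n j a : ℕ} (hj : 1 ≤ j) (h : (a + 1) * j ≤ n) : (Blk n j a).card = j := by
  have : (Blk n j a).map Fin.valEmbedding = Finset.Ico (a * j) (a * j + j) := by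
    ext x
    simp only [Blk, Finset.mem_map, Finset.mem_filter, Finset.mem_univ, true_and, Fin.valEmbedding_apply, Finset.mem_Ico]
    constructor
    · rintro ⟨y, hy, rfl⟩
      rw [Nat.div_eq_iff (by omega)] at hy
      omega
    · rintro ⟨h1, h2⟩
      refine ⟨⟨x, by nlinarith⟩, ?_, rfl⟩
      rw [Nat.div_eq_iff (by omega)]
      simp only; omega
  rw [← Finset.card_map Fin.valEmbedding, this]; simp

lemma Blk_disj {n j a b : ℕ} (h : a ≠ b) : Disjoint (Blk n j a) (Blk n j b) := by
  rw [Finset.disjoint_left]; intro x hx hx'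
  simp only [Blk, Finset.mem_filter, Finset.mem_univ, true_and] at hx hx'
  exact h (hx.symm.trans hx')

lemma iso_bound {n k j s m : ℕ} (hj : 1 ≤ j) (hjk : j < k) (hjn : j < n) (hmj : m * j ≤ n) {p : Fin s → ℝ}
    {μ : Measure (Fin s × Finset (Fin n) → Bool)} [IsProbabilityMeasure μ]
    (hμ : IndepFam μ (fun i (ω : Fin s × Finset (Fin n) → Bool) => ω i = true))
    (hp : ∀ i, μ.real {ω | ω i = true} = p i.1) (i : Fin s) (hp0 : 0 ≤ p i) (hp1 : p i ≤ 1) :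
    μ.real {ω | JPercolatesS j (EdG k ω)} ≤ (m:ℝ) ^ 2 * ((n:ℝ) ^ (k - j - 1) * p i) +
      (1 - (1 - p i) ^ (n ^ (k - j))) ^ m := by
  classical
  set K := (Finset.univ : Finset (Fin n)).powersetCard k with hK
  have hBc : ∀ a, a < m → (Blk n j a).card = j := fun a ha => Blk_card hj (by nlinarith)
  set T : ℕ → Finset (Finset (Fin n)) := fun a => K.filter fun e => Blk n j a ⊆ e ∧ ∀ b < m, b ≠ a → ¬ Blk n j b ⊆ e with hT
  set U : ℕ × ℕ → Finset (Finset (Fin n)) := fun z => K.filter fun e => Blk n j z.1 ∪ Blk n j z.2 ⊆ e with hU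
  set D := (Finset.range m ×ˢ Finset.range m).filter fun z => z.1 ≠ z.2 with hD
  have hsub : {ω | JPercolatesS j (EdG k ω)} ⊆
      (⋃ z ∈ D, ⋃ e ∈ U z, {ω : Fin s × Finset (Fin n) → Bool | ω (i, e) = true}) ∪ ⋂ a ∈ Finset.range m, {ω | ∃ e ∈ T a, ω (i, e) = true} := by
    intro ω hω
    by_contra hc
    rw [Set.mem_union, not_or] at hc
    obtain ⟨hc1, hc2⟩ := hc
    simp only [Set.mem_iInter, not_forall] at hc2
    obtain ⟨a, ha, hna⟩ := hc2
    rw [Finset.mem_range] at ha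
    refine not_perc_of_iso (J := Blk n j a) ?_ ?_ i ?_ hω
    · rw [Finset.card_powersetCard, Finset.card_univ, Fintype.card_fin]
      have h4 := choose_ge_lin (n - j) (j - 1)
      rw [show n - j + (j - 1 + 1) = n by omega, show j - 1 + 1 = j by omega] at h4
      omega
    · exact Finset.mem_powersetCard.2 ⟨Finset.subset_univ _, hBc a ha⟩
    · intro e he hJe
      obtain ⟨heK, heω⟩ := Finset.mem_filter.1 he
      apply hna
      refine ⟨e, Finset.mem_filter.2 ⟨heK, hJe, ?_⟩, heω⟩
      intro b hb hba hbe
      apply hc1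
      simp only [Set.mem_iUnion]
      refine ⟨(a, b), ?_, e, ?_, heω⟩
      · simp only [hD, Finset.mem_filter, Finset.mem_product, Finset.mem_range]
        exact ⟨⟨ha, hb⟩, fun h => hba h.symm⟩
      · exact Finset.mem_filter.2 ⟨heK, Finset.union_subset hJe hbe⟩
  have h1 : μ.real (⋃ z ∈ D, ⋃ e ∈ U z, {ω : Fin s × Finset (Fin n) → Bool | ω (i, e) = true}) ≤ (m:ℝ) ^ 2 * ((n:ℝ) ^ (k - j - 1) * p i) := by
    calc _ ≤ _ := measureReal_biUnion_finset_le _ _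
      _ ≤ ∑ z ∈ D, ((n:ℝ) ^ (k - j - 1) * p i) := by
          refine Finset.sum_le_sum fun z hz => ?_
          refine (measureReal_biUnion_finset_le _ _).trans ?_
          simp only [hp, Finset.sum_const, nsmul_eq_mul]
          refine mul_le_mul_of_nonneg_right ?_ hp0
          simp only [hD, Finset.mem_filter, Finset.mem_product, Finset.mem_range] at hz
          have hc : (U z).card ≤ n ^ (k - (j + 1)) := by
            refine card_super k (j + 1) _ ?_
            rw [Finset.card_union_of_disjoint (Blk_disj hz.2), hBc _ hz.1.1, hBc _ hz.1.2]; omega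
          rw [Nat.sub_sub]; exact_mod_cast hc
      _ = D.card * ((n:ℝ) ^ (k - j - 1) * p i) := by rw [Finset.sum_const, nsmul_eq_mul]
      _ ≤ _ := by
          refine mul_le_mul_of_nonneg_right ?_ (by positivity)
          have : D.card ≤ m ^ 2 := by
            refine (Finset.card_filter_le _ _).trans ?_
            simp [sq]
          exact_mod_cast this
  have h2 : μ.real (⋂ a ∈ Finset.range m, {ω | ∃ e ∈ T a, ω (i, e) = true}) ≤ (1 - (1 - p i) ^ (n ^ (k - j))) ^ m := by
    rw [hμ.prod (Finset.range m) (fun a => {z | z.1 = i ∧ z.2 ∈ T a}) (fun a => {ω | ∃ e ∈ T a, ω (i, e) = true})]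
    · calc _ ≤ ∏ a ∈ Finset.range m, (1 - (1 - p i) ^ (n ^ (k - j))) := by
            refine Finset.prod_le_prod (fun _ _ => measureReal_nonneg) fun a ha => ?_
            rw [prob_none hμ hp]
            have hc : (T a).card ≤ n ^ (k - j) := by
              refine le_trans (Finset.card_le_card ?_) (card_super k j (Blk n j a) (hBc a (Finset.mem_range.1 ha)).ge)
              intro e he
              obtain ⟨q1, q2, -⟩ := Finset.mem_filter.1 he
              exact Finset.mem_filter.2 ⟨q1, q2⟩
            have := pow_le_pow_of_le_one (by linarith : 0 ≤ 1 - p i) (by linarith) hc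
            linarith
        _ = _ := by simp
    · intro a ha b hb hab
      rw [Set.disjoint_left]
      rintro z ⟨-, hz⟩ ⟨-, hz'⟩
      obtain ⟨-, -, q⟩ := Finset.mem_filter.1 hz
      obtain ⟨-, q2, -⟩ := Finset.mem_filter.1 hz'
      exact q b (Finset.mem_range.1 hb) hab.symm q2
    · intro a _ ω ω' hh hω
      obtain ⟨e, he, hee⟩ := hω
      exact ⟨e, he, (hh (i, e) ⟨rfl, he⟩).1 hee⟩
  calc _ ≤ _ := measureReal_mono hsub (measure_ne_top _ _)
    _ ≤ _ := measureReal_union_le _ _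
    _ ≤ _ := add_le_add h1 h2

theorem part1a_bound (k j s : ℕ) (hj : 1 ≤ j) (hjk : j < k) (hs : 0 < s) :
    ∀ᶠ n : ℕ in atTop, ∀ p : Fin s → ℝ, (∀ i, 0 ≤ p i ∧ p i ≤ 1) →
      p ⟨0, hs⟩ ≤ Real.log n / (16 * (n : ℝ) ^ (k - j)) →
      probHkS n k p (fun E => JPercolatesS j E) ≤ 9 * Real.exp (-(Real.log n / 8)) := by
  have hlog : Tendsto (fun N : ℕ => Real.log N) atTop atTop :=
    Real.tendsto_log_atTop.comp tendsto_natCast_atTop_atTop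
  filter_upwards [hlog.eventually_ge_atTop 2, ev_log_pow 1 1 (by positivity),
    eventually_ge_atTop (2 * j + 4), eventually_ge_atTop (j ^ 2)] with n hL hn1 hn hn2
  intro p hp01 hp0
  rw [pow_one, one_mul] at hn1
  obtain ⟨μ, hμP, hμ, hp⟩ := exists_space (Fin s × Finset (Fin n)) (fun i => p i.1) (fun i => hp01 i.1)
  unfold probHkS
  rw [probMulti_eq _ p μ hμ hp]
  set m := Nat.sqrt (Nat.sqrt n) with hm
  have m1 : m * m ≤ Nat.sqrt n := Nat.sqrt_le _
  have m2 : Nat.sqrt n * Nat.sqrt n ≤ n := Nat.sqrt_le _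
  have m3 : Nat.sqrt n < (m + 1) * (m + 1) := Nat.lt_succ_sqrt _
  have m4 : n < (Nat.sqrt n + 1) * (Nat.sqrt n + 1) := Nat.lt_succ_sqrt _
  have hmj : m * j ≤ n := by
    have : (m * j) ^ 2 ≤ n ^ 2 := by
      have : m * m ≤ n := m1.trans (Nat.sqrt_le_self n)
      calc (m * j) ^ 2 = (m * m) * j ^ 2 := by ring
        _ ≤ n * n := Nat.mul_le_mul this hn2
        _ = _ := by ring
    exact le_of_pow_le_pow_left₀ (by norm_num) (by positivity) this
  have hb := iso_bound hj hjk (by omega : j < n) hmj hμ hp ⟨0, hs⟩ (hp01 _).1 (hp01 _).2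
  refine le_trans hb ?_
  set q := p ⟨0, hs⟩ with hq
  have hq0 : 0 ≤ q := (hp01 _).1
  have hn0 : (0:ℝ) < n := by exact_mod_cast (by omega : 0 < n)
  set L := Real.log n with hLd
  set y := Real.exp (L / 8) with hy
  have hy0 : 0 < y := Real.exp_pos _
  have hy8 : y ^ 8 = n := by
    rw [hy, ← Real.exp_nat_mul, show ((8:ℕ):ℝ) * (L / 8) = L by push_cast; ring]; exact Real.exp_log hn0
  have hy1 : 1 ≤ y := Real.one_le_exp (by linarith)
  have hLy : L ≤ 8 * y := by
    have := Real.add_one_le_exp (L / 8); linarith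
  have hm4 : (m:ℝ) ^ 2 ≤ y ^ 4 := by
    have : m ^ 4 ≤ n := by nlinarith
    have h' : ((m:ℝ) ^ 2) ^ 2 ≤ (y ^ 4) ^ 2 := by
      calc ((m:ℝ) ^ 2) ^ 2 = ((m ^ 4 : ℕ) : ℝ) := by push_cast; ring
        _ ≤ n := by exact_mod_cast this
        _ = _ := by rw [← hy8]; ring
    exact le_of_pow_le_pow_left₀ (by norm_num) (by positivity) h'
  have hm5 : y ^ 2 ≤ m + 1 := by
    have : n ≤ (m + 1) ^ 4 := by nlinarith
    have h' : (y ^ 2) ^ 4 ≤ ((m:ℝ) + 1) ^ 4 := by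
      calc (y ^ 2) ^ 4 = n := by rw [← hy8]; ring
        _ ≤ ((m + 1) ^ 4 : ℕ) := by exact_mod_cast this
        _ = _ := by push_cast; ring
    exact le_of_pow_le_pow_left₀ (by norm_num) (by positivity) h'
  have hqN : q * (n:ℝ) ^ (k - j) ≤ L / 16 := by
    rw [le_div_iff₀ (by positivity)] at hp0
    linarith
  have hkj : k - j = (k - j - 1) + 1 := by omega
  have hqn : (n:ℝ) ^ (k - j - 1) * q ≤ L / 16 / n := by
    rw [le_div_iff₀ hn0]
    calc _ = q * (n:ℝ) ^ (k - j - 1 + 1) := by ring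
      _ ≤ _ := by rw [← hkj]; exact hqN
  have hqh : q ≤ 1 / 2 := by
    have h1 : q ≤ (n:ℝ) ^ (k - j - 1) * q := by
      have : (1:ℝ) ≤ (n:ℝ) ^ (k - j - 1) := one_le_pow₀ (by exact_mod_cast (by omega : 1 ≤ n))
      nlinarith
    have h2 : L / 16 / n ≤ 1 / 2 := by
      rw [div_le_iff₀ hn0]; linarith
    linarith
  have hexp : Real.exp (-(2 * q)) ≤ 1 - q := by
    rw [Real.exp_neg, inv_le_iff_one_le_mul₀ (Real.exp_pos _)]
    have := Real.add_one_le_exp (2 * q)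
    nlinarith
  have hpow : y⁻¹ ≤ (1 - q) ^ (n ^ (k - j)) := by
    calc y⁻¹ = Real.exp (-(L / 8)) := by rw [hy, Real.exp_neg]
      _ ≤ Real.exp (-(2 * (q * (n:ℝ) ^ (k - j)))) := by
          apply Real.exp_le_exp.2; linarith
      _ = (Real.exp (-(2 * q))) ^ (n ^ (k - j)) := by
          rw [← Real.exp_nat_mul]; push_cast; congr 1; ring
      _ ≤ _ := pow_le_pow_left₀ (Real.exp_pos _).le hexp _
  have hyi : 0 < y⁻¹ := inv_pos.2 hy0
  have t2 : (1 - (1 - q) ^ (n ^ (k - j))) ^ m ≤ y⁻¹ := by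
    have hle : (1 - q) ^ (n ^ (k - j)) ≤ 1 := pow_le_one₀ (by linarith) (by linarith)
    calc _ ≤ (Real.exp (-y⁻¹)) ^ m := by
          refine pow_le_pow_left₀ (by linarith) ?_ m
          have := Real.add_one_le_exp (-y⁻¹)
          linarith
      _ = Real.exp (-(m * y⁻¹)) := by rw [← Real.exp_nat_mul]; congr 1; ring
      _ ≤ Real.exp (-(y - 1)) := by
          apply Real.exp_le_exp.2
          have h1 : (y ^ 2 - 1) * y⁻¹ ≤ m * y⁻¹ := mul_le_mul_of_nonneg_right (by linarith) hyi.le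
          have h2 : (y ^ 2 - 1) * y⁻¹ = y - y⁻¹ := by field_simp
          have h3 : y⁻¹ ≤ 1 := inv_le_one_of_one_le₀ hy1
          linarith
      _ ≤ y⁻¹ := by
          rw [Real.exp_neg]
          apply inv_anti₀ hy0
          have := Real.add_one_le_exp (y - 1); linarith
  have t1 : (m:ℝ) ^ 2 * ((n:ℝ) ^ (k - j - 1) * q) ≤ y⁻¹ := by
    calc _ ≤ y ^ 4 * (8 * y / 16 / y ^ 8) := by
          rw [hy8]
          refine mul_le_mul hm4 (hqn.trans (by gcongr)) (by positivity) (by positivity)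
      _ = y⁻¹ * (1 / (2 * y ^ 2)) := by field_simp; norm_num
      _ ≤ y⁻¹ * 1 := by
          refine mul_le_mul_of_nonneg_left ?_ hyi.le
          rw [div_le_one (by positivity)]; nlinarith
      _ = _ := mul_one _
  rw [Real.exp_neg, ← hy]
  linarith
end Iso

section Fin8
open MeasureTheory

lemma probHkS_not {n k s : ℕ} (p : Fin s → ℝ) (hp01 : ∀ i, 0 ≤ p i ∧ p i ≤ 1)
    (A : (Fin s → Finset (Finset (Fin n))) → Prop) :
    probHkS n k p (fun E => ¬ A E) = 1 - probHkS n k p A := by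
  obtain ⟨μ, hμP, hμ, hp⟩ := exists_space (Fin s × Finset (Fin n)) (fun i => p i.1) (fun i => hp01 i.1)
  have hm : ∀ A : Set (Fin s × Finset (Fin n) → Bool), MeasurableSet A := fun A => A.toFinite.measurableSet
  unfold probHkS
  rw [probMulti_eq _ p μ hμ hp, probMulti_eq _ p μ hμ hp, ← compl_real hm]
  rfl

lemma probHkS_nonneg {n k s : ℕ} (p : Fin s → ℝ) (hp01 : ∀ i, 0 ≤ p i ∧ p i ≤ 1)
    (A : (Fin s → Finset (Finset (Fin n))) → Prop) : 0 ≤ probHkS n k p A := by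
  obtain ⟨μ, hμP, hμ, hp⟩ := exists_space (Fin s × Finset (Fin n)) (fun i => p i.1) (fun i => hp01 i.1)
  unfold probHkS
  rw [probMulti_eq _ p μ hμ hp]
  exact measureReal_nonneg

lemma probHkS_le_one {n k s : ℕ} (p : Fin s → ℝ) (hp01 : ∀ i, 0 ≤ p i ∧ p i ≤ 1)
    (A : (Fin s → Finset (Finset (Fin n))) → Prop) : probHkS n k p A ≤ 1 := by
  have := probHkS_not (k := k) p hp01 A
  have := probHkS_nonneg (k := k) p hp01 (fun E => ¬ A E)
  linarith

lemma tendsto_not {k s j : ℕ} (p : ℕ → Fin s → ℝ) (hp : ∀ n, ∀ i : Fin s, 0 ≤ p n i ∧ p n i ≤ 1) (g : ℕ → ℝ)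
    (hg : Tendsto g atTop (nhds 0))
    (h : ∀ᶠ n : ℕ in atTop, probHkS n k (p n) (fun E => JPercolatesS j E) ≤ g n) :
    Tendsto (fun n : ℕ => probHkS n k (p n) fun E => ¬ JPercolatesS j E) atTop (nhds 1) := by
  have h1 : Tendsto (fun n => 1 - g n) atTop (nhds 1) := by simpa using hg.const_sub 1
  refine tendsto_of_tendsto_of_tendsto_of_le_of_le' h1 tendsto_const_nhds ?_ ?_
  · filter_upwards [h] with n hn
    rw [probHkS_not _ (hp n)]; linarith
  · exact Eventually.of_forall fun n => probHkS_le_one _ (hp n) _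

end Fin8

theorem multicolour_jigsaw_threshold (k j s : ℕ) (hj : 1 ≤ j) (hjk : j < k) (hs : 2 ≤ s) :
    ∃ c : ℝ, 0 < c ∧
      ∀ p : ℕ → Fin s → ℝ,
        (∀ n, ∀ i : Fin s, 0 ≤ p n i ∧ p n i ≤ 1) →
        (∀ n, ∀ i i' : Fin s, i ≤ i' → p n i ≤ p n i') →
        (((∀ᶠ n : ℕ in atTop, p n ⟨0, by omega⟩ ≤ Real.log n / (c * (n : ℝ) ^ (k - j))) ∨
            (∃ r : ℕ, 2 ≤ r ∧ r ≤ s ∧ ∀ᶠ n : ℕ in atTop,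
              (∏ i ∈ Finset.univ.filter (fun i : Fin s => (i : ℕ) < r), p n i) ≤
                1 / (c * (n : ℝ) ^ (r * (k - j - 1) + 1) * (Real.log n) ^ (r - 1)))) →
          Tendsto
            (fun n : ℕ => probHkS n k (p n) fun E => ¬ JPercolatesS j E)
            atTop (nhds 1)) ∧
        ((∀ᶠ n : ℕ in atTop,
            c * Real.log n / (n : ℝ) ^ (k - j) ≤ p n ⟨0, by omega⟩ ∧
            ∀ r : ℕ, 2 ≤ r → r ≤ s →
              c / ((n : ℝ) ^ (r * (k - j - 1) + 1) * (Real.log n) ^ (r - 1)) ≤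
                ∏ i ∈ Finset.univ.filter (fun i : Fin s => (i : ℕ) < r), p n i) →
          Tendsto
            (fun n : ℕ => probHkS n k (p n) fun E => JPercolatesS j E)
            atTop (nhds 1)) := by
  obtain ⟨c1, hc1, H1⟩ := part1b_bound k j s hj hjk
  obtain ⟨c2, hc2, H2⟩ := part2_bound k j s hj hjk hs
  have H0 := part1a_bound k j s hj hjk (by omega)
  have hlog : Tendsto (fun N : ℕ => Real.log N) atTop atTop :=
    Real.tendsto_log_atTop.comp tendsto_natCast_atTop_atTop
  have hL := hlog.eventually_ge_atTop 1
  have hn1 := eventually_ge_atTop 1 (α := ℕ)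
  have hc0 : 0 < max 16 (max c1 c2) := lt_of_lt_of_le (by norm_num) (le_max_left _ _)
  have hca : 16 ≤ max 16 (max c1 c2) := le_max_left _ _
  have hcb : c1 ≤ max 16 (max c1 c2) := (le_max_left _ _).trans (le_max_right _ _)
  have hcc : c2 ≤ max 16 (max c1 c2) := (le_max_right _ _).trans (le_max_right _ _)
  refine ⟨max 16 (max c1 c2), hc0, ?_⟩
  set c := max 16 (max c1 c2) with hc
  intro p hp01 hmono
  refine ⟨?_, ?_⟩
  · rintro (h | ⟨r, hr, hrs, h⟩)
    · refine tendsto_not p hp01 (fun n => 9 * Real.exp (-(Real.log n / 8))) ?_ ?_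
      · have h1 : Tendsto (fun n : ℕ => Real.log n / 8) atTop atTop := hlog.atTop_div_const (by norm_num)
        have h2 := (Real.tendsto_exp_neg_atTop_nhds_zero.comp h1).const_mul 9
        simpa using h2
      · filter_upwards [h, H0, hL, hn1] with n h h0 hL hn
        refine h0 (p n) (hp01 n) (h.trans ?_)
        have hn0 : (0:ℝ) < n := by exact_mod_cast hn
        have : 0 ≤ Real.log n := by linarith
        gcongr
    · refine tendsto_not p hp01 (fun n => 1 / (n:ℝ)) tendsto_one_div_atTop_nhds_zero_nat ?_
      filter_upwards [h, H1, hL, hn1] with n h h0 hL hn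
      refine h0 (p n) (hp01 n) r hr hrs (h.trans ?_)
      have hn0 : (0:ℝ) < n := by exact_mod_cast hn
      have : 0 < Real.log n := by linarith
      gcongr
  · intro h
    have hg : Tendsto (fun n : ℕ => 1 - 3 ^ (j + 2) / (n:ℝ)) atTop (nhds 1) := by
      have := (tendsto_const_div_atTop_nhds_zero_nat ((3:ℝ) ^ (j + 2))).const_sub 1
      simpa using this
    refine tendsto_of_tendsto_of_tendsto_of_le_of_le' hg tendsto_const_nhds ?_
      (Eventually.of_forall fun n => probHkS_le_one _ (hp01 n) _)
    filter_upwards [h, H2, hL, hn1] with n h h0 hL hn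
    have hn0 : (0:ℝ) < n := by exact_mod_cast hn
    have hl0 : 0 < Real.log n := by linarith
    refine h0 (p n) (hp01 n) (hmono n) (le_trans ?_ h.1) fun r hr hrs => le_trans ?_ (h.2 r hr hrs)
    · gcongr
    · gcongr
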